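/- Let m ≥ 3, n ≥ 1, and let λ(1), …, λ(m) be weakly decreasing sequences of n nonnegative integers (partitions with at most n parts). Define the generalized Littlewood–Richardson coefficient f(λ(1), …, λ(m)) = Σ c_{λ(1),μ(1)}^{λ(2)} · c_{μ(1),μ(2)}^{λ(3)} ⋯ c_{μ(m-3),λ(m)}^{λ(m-1)}, where the sum is over all partitions μ(1), …, μ(m-3) with at most n parts (for m = 3 this is just c_{λ(1),λ(3)}^{λ(2)}). Then for every integer r ≥ 1, f(λ(1), …, λ(m)) ≠ 0 if and only if f(rλ(1), …, rλ(m)) ≠ 0, where rλ denotes the sequence with all parts multiplied by r. -/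

import Mathlib

noncomputable section

open MvPolynomial

/-- The complete homogeneous symmetric polynomial of degree `k` in `n` variables. -/
def completeHomog (n k : ℕ) : MvPolynomial (Fin n) ℤ :=
  ∑ d ∈ Finset.Nat.antidiagonalTuple n k,
    monomial (Finsupp.equivFunOnFinite.symm d) 1

/-- `hInt n k` is `completeHomog n k` for `k ≥ 0` and `0` for `k < 0`. -/
def hInt (n : ℕ) (k : ℤ) : MvPolynomial (Fin n) ℤ :=
  if 0 ≤ k then completeHomog n k.toNat else 0

/-- The Schur polynomial of a partition `lam` with at most `n` parts, via the
Jacobi–Trudi identity `s_λ = det (h_{λ_i - i + j})`. -/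
def schurPoly (n : ℕ) (lam : Fin n → ℕ) : MvPolynomial (Fin n) ℤ :=
  Matrix.det (Matrix.of fun i j : Fin n => hInt n ((lam i : ℤ) + (j : ℤ) - (i : ℤ)))

/-- The Vandermonde alternant `a_δ = ∏_{i < j} (x_i - x_j)`. -/
def vandermondePoly (n : ℕ) : MvPolynomial (Fin n) ℤ :=
  ∏ i : Fin n, ∏ j ∈ Finset.Ioi i, (X i - X j)

/-- The Littlewood–Richardson coefficient `c_{λ,μ}^{ν}` (for partitions with at
most `n` parts): the coefficient of the monomial `x^{ν + δ}`,
`δ = (n-1, n-2, …, 0)`, in `s_λ · s_μ · a_δ = Σ_ρ c_{λ,μ}^{ρ} a_{ρ+δ}`. -/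
def lrCoeff (n : ℕ) (lam mu nu : Fin n → ℕ) : ℤ :=
  MvPolynomial.coeff
    (Finsupp.equivFunOnFinite.symm (fun i : Fin n => nu i + (n - 1 - (i : ℕ))))
    (schurPoly n lam * schurPoly n mu * vandermondePoly n)

/-- The chain `ν_0 = λ(1), ν_1 = μ(1), …, ν_{m-3} = μ(m-3), ν_{m-2} = λ(m)`
used in the definition of the generalized Littlewood–Richardson coefficient. -/
def chainNu (n m : ℕ) (lam : ℕ → Fin n → ℕ) (mu : Fin (m - 3) → Fin n → ℕ)
    (j : ℕ) : Fin n → ℕ :=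
  if j = 0 then lam 1
  else if j = m - 2 then lam m
  else if h : j - 1 < m - 3 then mu ⟨j - 1, h⟩ else 0

/-- The generalized Littlewood–Richardson coefficient
`f(λ(1), …, λ(m)) = Σ_{μ(1),…,μ(m-3)} c_{λ(1),μ(1)}^{λ(2)} ⋯ c_{μ(m-3),λ(m)}^{λ(m-1)}`,
the sum over all partitions `μ(1), …, μ(m-3)` with at most `n` parts
(for `m = 3` it is `c_{λ(1),λ(3)}^{λ(2)}`).  The sum has finitely many nonzero
terms, so it is expressed as a `finsum`. -/
def genLR (n m : ℕ) (lam : ℕ → Fin n → ℕ) : ℤ :=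
  ∑ᶠ mu : Fin (m - 3) → Fin n → ℕ,
    if ∀ k, Antitone (mu k) then
      ∏ j ∈ Finset.range (m - 2),
        lrCoeff n (chainNu n m lam mu j) (chainNu n m lam mu (j + 1)) (lam (j + 2))
    else 0

namespace HexHive

/-- The six unit vectors of the triangular lattice, in cyclic order. -/
def dir (k : Fin 6) : ℤ × ℤ :=
  (![1, 0, -1, -1, 0, 1] k, ![0, 1, 1, 0, -1, -1] k)

/-- The six outer normals of a lattice hexagon, in cyclic order. -/
def lf (k : Fin 6) (v : ℤ × ℤ) : ℤ :=
  ![v.1, v.1 + v.2, v.2, -v.1, -v.1 - v.2, -v.2] k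

/-- The lattice points of the hexagon with support numbers `A`. -/
def region (A : Fin 6 → ℤ) : Set (ℤ × ℤ) := {v | ∀ k, lf k v ≤ A k}

/-- The slack of the rhombus inequality with obtuse vertices `v` and `v + dir k`. -/
def slack (h : ℤ × ℤ → ℝ) (k : Fin 6) (v : ℤ × ℤ) : ℝ :=
  h v + h (v + dir k) - h (v + dir (k + 1)) - h (v + dir (k + 5))

/-- All rhombus inequalities inside the hexagon hold. -/
def IsHive (A : Fin 6 → ℤ) (h : ℤ × ℤ → ℝ) : Prop :=
  ∀ k v, v + dir (k + 1) ∈ region A → v + dir (k + 5) ∈ region A → 0 ≤ slack h k v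

theorem mem_region {A : Fin 6 → ℤ} {v : ℤ × ℤ} : v ∈ region A ↔
    v.1 ≤ A 0 ∧ v.1 + v.2 ≤ A 1 ∧ v.2 ≤ A 2 ∧ -v.1 ≤ A 3 ∧ -v.1 - v.2 ≤ A 4 ∧ -v.2 ≤ A 5 := by
  constructor
  · intro h
    exact ⟨h 0, h 1, h 2, h 3, h 4, h 5⟩
  · rintro ⟨h0, h1, h2, h3, h4, h5⟩ k
    fin_cases k <;> assumption

theorem mk_mem_region {A : Fin 6 → ℤ} {x y : ℤ} : (x, y) ∈ region A ↔
    x ≤ A 0 ∧ x + y ≤ A 1 ∧ y ≤ A 2 ∧ -x ≤ A 3 ∧ -x - y ≤ A 4 ∧ -y ≤ A 5 :=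
  mem_region

theorem finite_region (A : Fin 6 → ℤ) : (region A).Finite := by
  apply (Set.finite_Icc ((-A 3, -A 5) : ℤ × ℤ) (A 0, A 2)).subset
  intro v hv
  rw [mem_region] at hv
  constructor <;> constructor <;> simp <;> omega

theorem lf_add (k : Fin 6) (v w : ℤ × ℤ) : lf k (v + w) = lf k v + lf k w := by
  fin_cases k <;> simp [lf] <;> ring

/-- The affine chart of the lattice with origin `v` and first axis `dir k`. -/
def chart (k : Fin 6) (v w : ℤ × ℤ) : ℤ × ℤ := v + w.1 • dir k + w.2 • dir (k + 1)

theorem lf_chart (j k : Fin 6) (v w : ℤ × ℤ) :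
    lf (j + k) (chart k v w) = lf (j + k) v + lf j w := by
  fin_cases k <;> fin_cases j <;> simp [lf, chart, dir] <;> ring

theorem chart_add_dir (j k : Fin 6) (v w : ℤ × ℤ) :
    chart k v (w + dir j) = chart k v w + dir (j + k) := by
  fin_cases k <;> fin_cases j <;> ext <;> simp [chart, dir] <;> ring

theorem exists_chart (k : Fin 6) (v w : ℤ × ℤ) : ∃ u, w = chart k v u := by
  refine ⟨(lf k (w - v), lf (k + 2) (w - v)), ?_⟩
  fin_cases k <;> ext <;> simp [lf, dir, chart] <;> ring

/-- The support numbers of a hexagon in a chart. -/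
def chartBd (k : Fin 6) (v : ℤ × ℤ) (A : Fin 6 → ℤ) (j : Fin 6) : ℤ := A (j + k) - lf (j + k) v

theorem chart_mem_region {k : Fin 6} {v w : ℤ × ℤ} {A : Fin 6 → ℤ} :
    chart k v w ∈ region A ↔ w ∈ region (chartBd k v A) := by
  constructor
  · intro h j
    have := h (j + k)
    rw [lf_chart] at this
    simp only [chartBd]
    omega
  · intro h j
    have := h (j - k)
    have e := lf_chart (j - k) k v w
    simp only [chartBd, sub_add_cancel] at this e
    omega

theorem slack_chart (h : ℤ × ℤ → ℝ) (j k : Fin 6) (v w : ℤ × ℤ) :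
    slack (fun u => h (chart k v u)) j w = slack h (j + k) (chart k v w) := by
  simp only [slack, chart_add_dir, add_right_comm]

theorem IsHive.chart {A : Fin 6 → ℤ} {h : ℤ × ℤ → ℝ} (H : IsHive A h) (k : Fin 6) (v : ℤ × ℤ) :
    IsHive (chartBd k v A) (fun u => h (chart k v u)) := by
  intro j w h1 h2
  rw [slack_chart]
  rw [← chart_mem_region, chart_add_dir] at h1 h2
  rw [add_right_comm] at h1 h2
  exact H _ _ h1 h2

@[simp] theorem chart_zero (k : Fin 6) (v : ℤ × ℤ) : chart k v (0, 0) = v := by simp [HexHive.chart]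
@[simp] theorem chart_e1 (k : Fin 6) (v : ℤ × ℤ) : chart k v (1, 0) = v + dir k := by
  simp [HexHive.chart]
@[simp] theorem chart_e2 (k : Fin 6) (v : ℤ × ℤ) : chart k v (0, 1) = v + dir (k + 1) := by
  simp [HexHive.chart]

section Concrete

variable {A : Fin 6 → ℤ} {h : ℤ × ℤ → ℝ}

theorem IsHive.rhombus0 (H : IsHive A h) (x y : ℤ) (h1 : (x, y + 1) ∈ region A)
    (h2 : (x + 1, y - 1) ∈ region A) :
    h (x, y + 1) + h (x + 1, y - 1) ≤ h (x, y) + h (x + 1, y) := by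
  have := H 0 (x, y) (by simpa [dir] using h1) (by simpa [dir, ← sub_eq_add_neg] using h2)
  simp [slack, dir, ← sub_eq_add_neg] at this
  linarith

theorem IsHive.rhombus1 (H : IsHive A h) (x y : ℤ) (h1 : (x - 1, y + 1) ∈ region A)
    (h2 : (x + 1, y) ∈ region A) :
    h (x - 1, y + 1) + h (x + 1, y) ≤ h (x, y) + h (x, y + 1) := by
  have := H 1 (x, y) (by simpa [dir, ← sub_eq_add_neg] using h1) (by simpa [dir] using h2)
  simp [slack, dir, ← sub_eq_add_neg] at this
  linarith

theorem IsHive.rhombus2 (H : IsHive A h) (x y : ℤ) (h1 : (x, y) ∈ region A)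
    (h2 : (x + 1, y + 1) ∈ region A) :
    h (x, y) + h (x + 1, y + 1) ≤ h (x + 1, y) + h (x, y + 1) := by
  have := H 2 (x + 1, y) (by simpa [dir, ← sub_eq_add_neg] using h1) (by simpa [dir] using h2)
  simp [slack, dir, ← sub_eq_add_neg] at this
  linarith

/-- A nondegenerate hexagon. -/
def Thick (A : Fin 6 → ℤ) : Prop := ∀ k, 1 ≤ A k + A (k + 3)

theorem Thick.ineqs (T : Thick A) : 1 ≤ A 0 + A 3 ∧ 1 ≤ A 1 + A 4 ∧ 1 ≤ A 2 + A 5 :=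
  ⟨T 0, T 1, T 2⟩

theorem IsHive.line_concave (H : IsHive A h) (T : Thick A) (x y : ℤ)
    (h1 : (x - 1, y) ∈ region A) (h2 : (x + 1, y) ∈ region A) :
    h (x - 1, y) + h (x + 1, y) ≤ 2 * h (x, y) := by
  have T2 := T.ineqs
  rw [mk_mem_region] at h1 h2
  by_cases hy : y + 1 ≤ A 2
  · have q1 := H.rhombus1 x y (by rw [mk_mem_region]; omega) (by rw [mk_mem_region]; omega)
    have q2 := H.rhombus2 (x - 1) y (by rw [mk_mem_region]; omega) (by rw [mk_mem_region]; omega)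
    simp only [sub_add_cancel] at q2
    linarith
  · have q1 := H.rhombus1 x (y - 1) (by rw [mk_mem_region]; omega) (by rw [mk_mem_region]; omega)
    have q2 := H.rhombus2 x (y - 1) (by rw [mk_mem_region]; omega) (by rw [mk_mem_region]; omega)
    simp only [sub_add_cancel] at q1 q2
    linarith

theorem IsHive.strip (H : IsHive A h) (x y : ℤ) (j : ℕ) (h1 : (x, y) ∈ region A)
    (h2 : (x + 1, y + j) ∈ region A) :
    h (x, y) + h (x + 1, y + j) ≤ h (x + 1, y) + h (x, y + j) := by
  induction j with
  | zero => simp [add_comm]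
  | succ j ih =>
    push_cast at *
    rw [mk_mem_region] at h1 h2
    have h3 := ih (by rw [mk_mem_region]; omega)
    have h4 := H.rhombus2 x (y + j) (by rw [mk_mem_region]; omega) (by rw [mk_mem_region]; omega)
    rw [add_assoc] at h4
    linarith

theorem IsHive.parallelogram (H : IsHive A h) (x y : ℤ) (i j : ℕ) (h1 : (x, y) ∈ region A)
    (h2 : (x + i, y + j) ∈ region A) :
    h (x, y) + h (x + i, y + j) ≤ h (x + i, y) + h (x, y + j) := by
  induction i with
  | zero => simp
  | succ i ih =>
    push_cast at *
    rw [mk_mem_region] at h1 h2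
    have h3 := ih (by rw [mk_mem_region]; omega)
    have h4 := H.strip (x + i) y j (by rw [mk_mem_region]; omega) (by rw [mk_mem_region]; omega)
    rw [add_assoc] at h4
    linarith

/-- A concave function on an integer interval that vanishes at two consecutive points is
nonpositive. -/
theorem line_nonpos_aux (g : ℤ → ℝ) (b : ℕ) (hg : ∀ x : ℤ, 0 < x → x < b →
    g (x - 1) + g (x + 1) ≤ 2 * g x) (h0 : g 0 = 0) (h1 : g 1 = 0) : g b ≤ 0 := by
  have key : ∀ i : ℕ, i + 1 ≤ b → g (i + 1) ≤ g i ∧ g (i + 1) ≤ 0 := by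
    intro i
    induction i with
    | zero => intro _; simp [h0, h1]
    | succ i ih =>
      intro hi
      obtain ⟨a1, a2⟩ := ih (by omega)
      have := hg (i + 1) (by omega) (by omega)
      push_cast
      rw [add_sub_cancel_right] at this
      constructor <;> linarith
  cases b with
  | zero => simp [h0]
  | succ b => exact_mod_cast (key b le_rfl).2

theorem IsHive.line_nonpos_zero (H : IsHive A h) (T : Thick A) (h0 : (0, 0) ∈ region A)
    (h1 : (1, 0) ∈ region A) (z0 : h (0, 0) = 0) (z1 : h (1, 0) = 0) (x : ℤ)
    (hx : (x, 0) ∈ region A) : h (x, 0) ≤ 0 := by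
  rw [mk_mem_region] at *
  rcases le_or_gt 0 x with hx0 | hx0
  · obtain ⟨b, rfl⟩ := Int.eq_ofNat_of_zero_le hx0
    refine line_nonpos_aux (fun x => h (x, 0)) b (fun y hy hyb => ?_) z0 z1
    exact H.line_concave T y 0 (by rw [mk_mem_region]; omega) (by rw [mk_mem_region]; omega)
  · obtain ⟨b, hb⟩ := Int.eq_ofNat_of_zero_le (show 0 ≤ 1 - x by omega)
    have := line_nonpos_aux (fun x => h (1 - x, 0)) b (fun y hy hyb => ?_) (by simpa using z1)
      (by simpa using z0)
    · have e : x = 1 - (b : ℤ) := by omega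
      rw [e]; exact this
    · have := H.line_concave T (1 - y) 0 (by rw [mk_mem_region]; omega)
        (by rw [mk_mem_region]; omega)
      have e1 : (1 - y - 1 : ℤ) = 1 - (y + 1) := by ring
      have e2 : (1 - y + 1 : ℤ) = 1 - (y - 1) := by ring
      rw [e1, e2] at this
      linarith

end Concrete

variable {A : Fin 6 → ℤ} {h : ℤ × ℤ → ℝ}

theorem Thick.chart (T : Thick A) (k : Fin 6) (v : ℤ × ℤ) : Thick (chartBd k v A) := by
  intro j
  have e : lf (j + 3 + k) v = - lf (j + k) v := by
    fin_cases k <;> fin_cases j <;> simp [lf] <;> ring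
  have := T (j + k)
  have e2 : j + 3 + k = j + k + 3 := add_right_comm _ _ _
  rw [e2] at e
  simp only [chartBd]
  rw [e2, e]
  omega

/-- A hive vanishing at two adjacent points is nonpositive on the line joining them. -/
theorem IsHive.line_nonpos (H : IsHive A h) (T : Thick A) (k : Fin 6) (v : ℤ × ℤ)
    (h0 : v ∈ region A) (h1 : v + dir k ∈ region A) (z0 : h v = 0) (z1 : h (v + dir k) = 0)
    (x : ℤ) (hx : v + x • dir k ∈ region A) : h (v + x • dir k) ≤ 0 := by
  have e : HexHive.chart k v (x, 0) = v + x • dir k := by simp [HexHive.chart]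
  rw [← e] at hx ⊢
  refine (H.chart k v).line_nonpos_zero (T.chart k v) ?_ ?_ ?_ ?_ x (chart_mem_region.1 hx)
  · rw [← chart_mem_region]; simpa using h0
  · rw [← chart_mem_region]; simpa using h1
  · simpa using z0
  · simpa using z1

theorem IsHive.cone_zero (H : IsHive A h) (T : Thick A) (h0 : (0, 0) ∈ region A)
    (h1 : (1, 0) ∈ region A) (h2 : (0, 1) ∈ region A) (z0 : h (0, 0) = 0) (z1 : h (1, 0) = 0)
    (z2 : h (0, 1) = 0) (x y : ℤ) (hxy : (0 ≤ x ∧ 0 ≤ y) ∨ (x ≤ 0 ∧ y ≤ 0))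
    (hm : (x, y) ∈ region A) : h (x, y) ≤ 0 := by
  have l1 : (x, 0) ∈ region A → h (x, 0) ≤ 0 := H.line_nonpos_zero T h0 h1 z0 z1 x
  have l2 : (0, y) ∈ region A → h (0, y) ≤ 0 := by
    intro hy
    have := H.line_nonpos T 1 (0, 0) h0 (by simpa [dir] using h2) z0 (by simpa [dir] using z2) y
    simp [dir] at this
    exact this hy
  rw [mk_mem_region] at *
  rcases hxy with ⟨hx, hy⟩ | ⟨hx, hy⟩
  · obtain ⟨i, rfl⟩ := Int.eq_ofNat_of_zero_le hx
    obtain ⟨j, rfl⟩ := Int.eq_ofNat_of_zero_le hy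
    have := H.parallelogram 0 0 i j (by rw [mk_mem_region]; omega) (by rw [mk_mem_region]; omega)
    simp only [zero_add] at this
    have := l1 (by omega)
    have := l2 (by omega)
    linarith
  · obtain ⟨i, hi⟩ := Int.eq_ofNat_of_zero_le (show 0 ≤ -x by omega)
    obtain ⟨j, hj⟩ := Int.eq_ofNat_of_zero_le (show 0 ≤ -y by omega)
    have := H.parallelogram x y i j (by rw [mk_mem_region]; omega) (by rw [mk_mem_region]; omega)
    rw [show x + i = 0 by omega, show y + j = 0 by omega] at this
    have := l1 (by omega)
    have := l2 (by omega)
    linarith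

theorem IsHive.cone (H : IsHive A h) (T : Thick A) (k : Fin 6) (v : ℤ × ℤ)
    (h0 : v ∈ region A) (h1 : v + dir k ∈ region A) (h2 : v + dir (k + 1) ∈ region A)
    (z0 : h v = 0) (z1 : h (v + dir k) = 0) (z2 : h (v + dir (k + 1)) = 0) (x y : ℤ)
    (hxy : (0 ≤ x ∧ 0 ≤ y) ∨ (x ≤ 0 ∧ y ≤ 0))
    (hm : HexHive.chart k v (x, y) ∈ region A) : h (HexHive.chart k v (x, y)) ≤ 0 := by
  refine (H.chart k v).cone_zero (T.chart k v) ?_ ?_ ?_ ?_ ?_ ?_ x y hxy (chart_mem_region.1 hm)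
  · rw [← chart_mem_region]; simpa using h0
  · rw [← chart_mem_region]; simpa using h1
  · rw [← chart_mem_region]; simpa using h2
  · simpa using z0
  · simpa using z1
  · simpa using z2

/-- A hive vanishing on a unit triangle is nonpositive. -/
theorem IsHive.nonpos (H : IsHive A h) (T : Thick A) (k : Fin 6) (v : ℤ × ℤ)
    (h0 : v ∈ region A) (h1 : v + dir k ∈ region A) (h2 : v + dir (k + 1) ∈ region A)
    (z0 : h v = 0) (z1 : h (v + dir k) = 0) (z2 : h (v + dir (k + 1)) = 0)
    (w : ℤ × ℤ) (hw : w ∈ region A) : h w ≤ 0 := by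
  obtain ⟨⟨x, y⟩, rfl⟩ := exists_chart k v w
  have e1 : v + dir k + dir (k + 2) = v + dir (k + 1) := by
    fin_cases k <;> ext <;> simp [dir]
  have e2 : v + dir k + dir (k + 2 + 1) = v := by
    fin_cases k <;> ext <;> simp [dir]
  have e3 : v + dir (k + 1) + dir (k + 4) = v := by
    fin_cases k <;> ext <;> simp [dir]
  have e4 : v + dir (k + 1) + dir (k + 4 + 1) = v + dir k := by
    fin_cases k <;> ext <;> simp [dir]
  have c1 : HexHive.chart k v (x, y) = HexHive.chart (k + 2) (v + dir k) (y, 1 - x - y) := by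
    fin_cases k <;> ext <;> simp [HexHive.chart, dir] <;> ring
  have c2 : HexHive.chart k v (x, y) = HexHive.chart (k + 4) (v + dir (k + 1)) (1 - x - y, x) := by
    fin_cases k <;> ext <;> simp [HexHive.chart, dir] <;> ring
  have hc : ((0 ≤ x ∧ 0 ≤ y) ∨ (x ≤ 0 ∧ y ≤ 0)) ∨
      ((0 ≤ y ∧ 0 ≤ 1 - x - y) ∨ (y ≤ 0 ∧ 1 - x - y ≤ 0)) ∨
      ((0 ≤ 1 - x - y ∧ 0 ≤ x) ∨ (1 - x - y ≤ 0 ∧ x ≤ 0)) := by omega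
  rcases hc with hc | hc | hc
  · exact H.cone T k v h0 h1 h2 z0 z1 z2 x y hc hw
  · rw [c1] at hw ⊢
    exact H.cone T (k + 2) (v + dir k) h1 (by rwa [e1]) (by rwa [e2]) z1 (by rwa [e1])
      (by rwa [e2]) _ _ hc hw
  · rw [c2] at hw ⊢
    exact H.cone T (k + 4) (v + dir (k + 1)) h2 (by rwa [e3]) (by rwa [e4]) z2 (by rwa [e3])
      (by rwa [e4]) _ _ hc hw

end HexHive

namespace HexHive

variable {A : Fin 6 → ℤ} {h : ℤ × ℤ → ℝ}

/-- A function that is concave and nonpositive on an integer interval and vanishes at both ends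
vanishes on the whole interval. -/
theorem line_zero_aux (g : ℤ → ℝ) (n : ℕ) (hg : ∀ x : ℤ, 0 < x → x < n →
    g (x - 1) + g (x + 1) ≤ 2 * g x) (hn : ∀ x : ℤ, 0 ≤ x → x ≤ n → g x ≤ 0)
    (h0 : g 0 = 0) (h1 : g n = 0) (i : ℤ) (hi0 : 0 ≤ i) (hi : i ≤ n) : g i = 0 := by
  have key : ∀ i : ℕ, i + 1 ≤ n → g (i + 1) ≤ g i := by
    intro i
    induction i with
    | zero => intro hi; simpa [h0] using hn 1 (by omega) (by omega)
    | succ i ih =>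
      intro hi
      have a1 := ih (by omega)
      have := hg (i + 1) (by omega) (by omega)
      push_cast
      rw [add_sub_cancel_right] at this
      linarith
  have key2 : ∀ j : ℕ, j ≤ n → 0 ≤ g (n - j : ℤ) := by
    intro j
    induction j with
    | zero => intro _; simp [h1]
    | succ j ih =>
      intro hj
      have a1 := ih (by omega)
      have a2 := key (n - (j + 1)) (by omega)
      have e1 : ((n - (j + 1) : ℕ) : ℤ) = n - (j + 1 : ℕ) := by omega
      have e2 : (n : ℤ) - (j + 1 : ℕ) + 1 = n - j := by push_cast; ring
      rw [e1, e2] at a2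
      linarith
  have := key2 (n - i).toNat (by omega)
  rw [show (n : ℤ) - ((n - i).toNat : ℤ) = i by omega] at this
  exact le_antisymm (hn i hi0 hi) this

/-- The zero set of a function in a hexagon. -/
def zeros (A : Fin 6 → ℤ) (h : ℤ × ℤ → ℝ) : Set (ℤ × ℤ) := {v | v ∈ region A ∧ h v = 0}

theorem chart_mem_zeros {k : Fin 6} {v w : ℤ × ℤ} :
    chart k v w ∈ zeros A h ↔ w ∈ zeros (chartBd k v A) (fun u => h (chart k v u)) := by
  simp only [zeros, Set.mem_ofPred_eq, chart_mem_region]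

theorem IsHive.segment_zero (H : IsHive A h) (T : Thick A) (N : ∀ v ∈ region A, h v ≤ 0)
    (n i : ℤ) (h0 : (0, 0) ∈ zeros A h) (h1 : (n, 0) ∈ zeros A h) (hi : 0 ≤ i) (hin : i ≤ n) :
    (i, 0) ∈ zeros A h := by
  obtain ⟨m0, z0⟩ := h0
  obtain ⟨m1, z1⟩ := h1
  have hm : ∀ x : ℤ, 0 ≤ x → x ≤ n → (x, 0) ∈ region A := by
    intro x hx hxn
    rw [mk_mem_region] at *
    omega
  obtain ⟨b, rfl⟩ := Int.eq_ofNat_of_zero_le (hi.trans hin)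
  refine ⟨hm i hi hin, ?_⟩
  exact line_zero_aux (fun x => h (x, 0)) b
    (fun x hx hxn => H.line_concave T x 0 (hm _ (by omega) (by omega)) (hm _ (by omega) (by omega)))
    (fun x hx hxn => N _ (hm x hx hxn)) z0 z1 i hi hin

theorem IsHive.segment (H : IsHive A h) (T : Thick A) (N : ∀ v ∈ region A, h v ≤ 0) (k : Fin 6)
    (v : ℤ × ℤ) (n i : ℤ) (h0 : v ∈ zeros A h) (h1 : v + n • dir k ∈ zeros A h) (hi : 0 ≤ i)
    (hin : i ≤ n) : v + i • dir k ∈ zeros A h := by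
  have e : ∀ x : ℤ, HexHive.chart k v (x, 0) = v + x • dir k := by simp [HexHive.chart]
  rw [← e, chart_mem_zeros]
  rw [← e, chart_mem_zeros] at h1
  refine (H.chart k v).segment_zero (T.chart k v) (fun w hw => N _ (chart_mem_region.2 hw)) n i
    ?_ h1 hi hin
  rw [← chart_mem_zeros]
  simpa using h0

theorem IsHive.corner_zero (H : IsHive A h) (N : ∀ v ∈ region A, h v ≤ 0)
    (p s t q : ℤ) (h0 : (p, s) ∈ zeros A h) (h1 : (t, q) ∈ zeros A h) (htp : t ≤ p) (hqs : q ≤ s) :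
    (t, s) ∈ zeros A h := by
  obtain ⟨m0, z0⟩ := h0
  obtain ⟨m1, z1⟩ := h1
  have m2 : (t, s) ∈ region A := by rw [mk_mem_region] at *; omega
  have m3 : (p, q) ∈ region A := by rw [mk_mem_region] at *; omega
  refine ⟨m2, ?_⟩
  obtain ⟨i, hi⟩ := Int.eq_ofNat_of_zero_le (show 0 ≤ p - t by omega)
  obtain ⟨j, hj⟩ := Int.eq_ofNat_of_zero_le (show 0 ≤ s - q by omega)
  have := H.parallelogram t q i j m1
  rw [show t + i = p by omega, show q + j = s by omega] at this
  have := this m0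
  have := N _ m2
  have := N _ m3
  linarith

theorem IsHive.exists_corner (H : IsHive A h) (N : ∀ v ∈ region A, h v ≤ 0) (k : Fin 6)
    (u v : ℤ × ℤ) (h0 : u ∈ zeros A h) (h1 : v ∈ zeros A h) (huv : lf k v ≤ lf k u)
    (hvu : lf (k + 1) u ≤ lf (k + 1) v) :
    ∃ c ∈ zeros A h, lf k c = lf k u ∧ lf (k + 1) c = lf (k + 1) v := by
  obtain ⟨u, rfl⟩ := exists_chart (k + 4) (0, 0) u
  obtain ⟨v, rfl⟩ := exists_chart (k + 4) (0, 0) v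
  have e1 : k = 2 + (k + 4) := by fin_cases k <;> rfl
  have e2 : k + 1 = 3 + (k + 4) := by fin_cases k <;> rfl
  have f1 : ∀ w, lf k (HexHive.chart (k + 4) (0, 0) w) = lf k (0, 0) + lf 2 w := by
    intro w
    have := lf_chart 2 (k + 4) (0, 0) w
    rwa [← e1] at this
  have f2 : ∀ w, lf (k + 1) (HexHive.chart (k + 4) (0, 0) w) = lf (k + 1) (0, 0) + lf 3 w := by
    intro w
    have := lf_chart 3 (k + 4) (0, 0) w
    rwa [← e2] at this
  rw [chart_mem_zeros] at h0 h1
  rw [f1, f1, add_le_add_iff_left] at huv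
  rw [f2, f2, add_le_add_iff_left] at hvu
  obtain ⟨p, s⟩ := u
  obtain ⟨t, q⟩ := v
  simp only [lf] at huv hvu
  simp at huv hvu
  refine ⟨HexHive.chart (k + 4) (0, 0) (t, s), ?_, ?_, ?_⟩
  · rw [chart_mem_zeros]
    exact (H.chart (k + 4) (0, 0)).corner_zero (fun w hw => N _ (chart_mem_region.2 hw)) p s t q
      h0 h1 hvu huv
  · rw [f1, f1]; simp [lf]
  · rw [f2, f2]; simp [lf]

/-- Every side of the hexagon has nonnegative length. -/
def Tight (M : Fin 6 → ℤ) : Prop := ∀ k, M k ≤ M (k + 5) + M (k + 1)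

theorem Tight.ineqs {M : Fin 6 → ℤ} (t : Tight M) : M 0 ≤ M 5 + M 1 ∧ M 1 ≤ M 0 + M 2 ∧
    M 2 ≤ M 1 + M 3 ∧ M 3 ≤ M 2 + M 4 ∧ M 4 ≤ M 3 + M 5 ∧ M 5 ≤ M 4 + M 0 :=
  ⟨t 0, t 1, t 2, t 3, t 4, t 5⟩

/-- The vertex of a hexagon on sides `k` and `k + 1`. -/
def corner (M : Fin 6 → ℤ) (k : Fin 6) : ℤ × ℤ := M k • dir k + (M (k + 1) - M k) • dir (k + 1)

theorem lf_corner (M : Fin 6 → ℤ) (k : Fin 6) : lf k (corner M k) = M k := by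
  fin_cases k <;> simp [lf, corner, dir]

theorem lf_corner' (M : Fin 6 → ℤ) (k : Fin 6) : lf (k + 1) (corner M k) = M (k + 1) := by
  fin_cases k <;> simp [lf, corner, dir]

theorem eq_corner (M : Fin 6 → ℤ) (k : Fin 6) (v : ℤ × ℤ) (h1 : lf k v = M k)
    (h2 : lf (k + 1) v = M (k + 1)) : v = corner M k := by
  have h2' := h2
  fin_cases k <;> simp [lf, corner, dir] at * <;> ext <;> simp <;> omega

theorem Tight.corner_mem {M : Fin 6 → ℤ} (t : Tight M) (k : Fin 6) : corner M k ∈ region M := by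
  have := t.ineqs
  rw [mem_region]
  fin_cases k <;> simp [corner, dir] <;> omega

/-- The zero set of a nonpositive hive is a lattice hexagon. -/
theorem IsHive.exists_hexagon (H : IsHive A h) (T : Thick A) (N : ∀ v ∈ region A, h v ≤ 0)
    (hne : (zeros A h).Nonempty) : ∃ M, Tight M ∧ region M = zeros A h := by
  have hfin : (zeros A h).Finite := (finite_region A).subset fun v hv => hv.1
  have hmax : ∀ k, ∃ u ∈ zeros A h, ∀ v ∈ zeros A h, lf k v ≤ lf k u := fun k =>
    Set.exists_max_image _ _ hfin hne
  choose u hu hmx using hmax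
  set M : Fin 6 → ℤ := fun k => lf k (u k) with hM
  have hsub : zeros A h ⊆ region M := fun v hv k => hmx k v hv
  have hc : ∀ k, corner M k ∈ zeros A h := by
    intro k
    obtain ⟨c, hc, e1, e2⟩ := H.exists_corner N k (u k) (u (k + 1)) (hu _) (hu _) (hmx _ _ (hu _))
      (hmx _ _ (hu _))
    rwa [eq_corner M k c e1 e2] at hc
  have ht : Tight M := by
    have c0 := mem_region.1 (hsub (hc 0))
    have c1 := mem_region.1 (hsub (hc 1))
    have c2 := mem_region.1 (hsub (hc 2))
    have c3 := mem_region.1 (hsub (hc 3))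
    have c4 := mem_region.1 (hsub (hc 4))
    have c5 := mem_region.1 (hsub (hc 5))
    simp [corner, dir] at c0 c1 c2 c3 c4 c5
    intro k
    fin_cases k <;> simp <;> omega
  have ti := ht.ineqs
  refine ⟨M, ht, Set.Subset.antisymm ?_ hsub⟩
  rintro ⟨x, y⟩ hm
  rw [mk_mem_region] at hm
  have c0 : (M 0, M 1 - M 0) ∈ zeros A h := by simpa [corner, dir] using hc 0
  have c1 : (M 1 - M 2, M 2) ∈ zeros A h := by
    have := hc 1
    simp [corner, dir] at this
    convert this using 2
  have c2 : (-M 3, M 2) ∈ zeros A h := by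
    have := hc 2
    simp [corner, dir] at this
    convert this using 2
    ring
  have c3 : (-M 3, M 3 - M 4) ∈ zeros A h := by
    have := hc 3
    simp [corner, dir] at this
    exact this
  have c4 : (M 5 - M 4, -M 5) ∈ zeros A h := by
    have := hc 4
    simp [corner, dir] at this
    convert this using 2
    ring
  have c5 : (M 0, -M 5) ∈ zeros A h := by
    have := hc 5
    simp [corner, dir] at this
    convert this using 2
  have right : ∃ R, x ≤ R ∧ (R, y) ∈ zeros A h := by
    rcases le_or_gt y (M 1 - M 0) with hy | hy
    · refine ⟨M 0, hm.1, ?_⟩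
      have := H.segment T N 1 (M 0, -M 5) (M 1 - M 0 + M 5) (y + M 5) c5
        (by simpa [dir] using c0) (by omega) (by omega)
      simpa [dir] using this
    · refine ⟨M 1 - y, by omega, ?_⟩
      have := H.segment T N 2 (M 0, M 1 - M 0) (M 2 - M 1 + M 0) (y - M 1 + M 0) c0
        (by simp [dir]; convert c1 using 2) (by omega) (by omega)
      simp [dir] at this
      convert this using 2
  have left : ∃ L, L ≤ x ∧ (L, y) ∈ zeros A h := by
    rcases le_or_gt (M 3 - M 4) y with hy | hy
    · refine ⟨-M 3, by omega, ?_⟩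
      have := H.segment T N 1 (-M 3, M 3 - M 4) (M 2 - M 3 + M 4) (y - M 3 + M 4) c3
        (by simp [dir]; convert c2 using 2) (by omega) (by omega)
      simp [dir] at this
      convert this using 2
    · refine ⟨-M 4 - y, by omega, ?_⟩
      have := H.segment T N 2 (M 5 - M 4, -M 5) (M 3 - M 4 + M 5) (y + M 5) c4
        (by simp [dir]; convert c3 using 2; ring) (by omega) (by omega)
      simp [dir] at this
      convert this using 2; ring
  obtain ⟨R, hR, r⟩ := right
  obtain ⟨L, hL, l⟩ := left
  have := H.segment T N 0 (L, y) (R - L) (x - L) l (by simpa [dir] using r) (by omega) (by omega)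
  simpa [dir] using this

end HexHive

namespace HexHive

variable {A : Fin 6 → ℤ} {h l l' : ℤ × ℤ → ℝ}

/-- Affine functions on the lattice. -/
def IsAff (l : ℤ × ℤ → ℝ) : Prop := ∃ a b c : ℝ, ∀ v, l v = a * v.1 + b * v.2 + c

theorem IsAff.slack_eq (hl : IsAff l) (k : Fin 6) (v : ℤ × ℤ) : slack l k v = 0 := by
  obtain ⟨a, b, c, hl⟩ := hl
  simp only [slack, hl]
  fin_cases k <;> simp [dir] <;> ring

theorem IsHive.sub_aff (H : IsHive A h) (hl : IsAff l) : IsHive A (fun v => h v - l v) := by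
  intro k v h1 h2
  have e := hl.slack_eq k v
  have := H k v h1 h2
  simp only [slack] at *
  linarith

theorem IsAff.sub_lf (hl : IsAff l) (k : Fin 6) (c d : ℝ) :
    IsAff (fun v => l v - c * (lf k v - d)) := by
  obtain ⟨a, b, e, hl⟩ := hl
  have : ∃ p q : ℝ, ∀ v, (lf k v : ℝ) = p * v.1 + q * v.2 := by
    fin_cases k
    · exact ⟨1, 0, fun v => by simp [lf]⟩
    · exact ⟨1, 1, fun v => by simp [lf]⟩
    · exact ⟨0, 1, fun v => by simp [lf]⟩
    · exact ⟨-1, 0, fun v => by simp [lf]⟩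
    · exact ⟨-1, -1, fun v => by simp [lf]; ring⟩
    · exact ⟨0, -1, fun v => by simp [lf]⟩
  obtain ⟨p, q, hpq⟩ := this
  exact ⟨a - c * p, b - c * q, e + c * d, fun v => by simp only [hl, hpq]; ring⟩

theorem exists_aff (k : Fin 6) (v : ℤ × ℤ) (x y z : ℝ) :
    ∃ l, IsAff l ∧ l v = x ∧ l (v + dir k) = y ∧ l (v + dir (k + 1)) = z := by
  have h0 : IsAff (fun _ => x) := ⟨0, 0, x, by simp⟩
  have h1 := (h0.sub_lf k (x - y) (lf k v)).sub_lf (k + 2) (x - z) (lf (k + 2) v)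
  refine ⟨_, h1, ?_, ?_, ?_⟩
  · simp
  · simp only [lf_add]
    have e1 : lf k (dir k) = 1 := by fin_cases k <;> simp [lf, dir]
    have e2 : lf (k + 2) (dir k) = 0 := by fin_cases k <;> simp [lf, dir]
    rw [e1, e2]; push_cast; ring
  · simp only [lf_add]
    have e1 : lf k (dir (k + 1)) = 0 := by fin_cases k <;> simp [lf, dir]
    have e2 : lf (k + 2) (dir (k + 1)) = 1 := by fin_cases k <;> simp [lf, dir]
    rw [e1, e2]; push_cast; ring

theorem IsAff.ext_tri (hl : IsAff l) (hl' : IsAff l') (k : Fin 6) (v : ℤ × ℤ) (h0 : l v = l' v)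
    (h1 : l (v + dir k) = l' (v + dir k)) (h2 : l (v + dir (k + 1)) = l' (v + dir (k + 1))) :
    l = l' := by
  obtain ⟨a, b, c, hl⟩ := hl
  obtain ⟨a', b', c', hl'⟩ := hl'
  simp only [hl, hl'] at h0 h1 h2
  have : a = a' ∧ b = b' := by
    fin_cases k <;> simp [dir] at h1 h2 <;> constructor <;> linarith
  obtain ⟨rfl, rfl⟩ := this
  funext w
  rw [hl, hl']
  linarith

/-- Slope of an affine function along side `k` of a hexagon. -/
def slope (l : ℤ × ℤ → ℝ) (k : Fin 6) : ℝ := l (dir (k + 1)) - l 0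

theorem IsAff.add_dir (hl : IsAff l) (k : Fin 6) (v : ℤ × ℤ) :
    l (v + dir (k + 1)) = l v + slope l k := by
  obtain ⟨a, b, c, hl⟩ := hl
  simp only [slope, hl, Prod.fst_add, Prod.snd_add, Prod.fst_zero, Prod.snd_zero]
  push_cast; ring

theorem IsAff.slope_neg (hl : IsAff l) (k : Fin 6) : slope l (k + 3) = - slope l k := by
  obtain ⟨a, b, c, hl⟩ := hl
  simp only [slope, hl]
  fin_cases k <;> simp [dir] <;> ring

theorem IsAff.slope_add (hl : IsAff l) (k : Fin 6) :
    slope l k = slope l (k + 5) + slope l (k + 1) := by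
  obtain ⟨a, b, c, hl⟩ := hl
  simp only [slope, hl]
  fin_cases k <;> simp [dir] <;> ring

/-- An affine function that agrees with `h` on a unit triangle of the hexagon. -/
structure Piece (A : Fin 6 → ℤ) (h l : ℤ × ℤ → ℝ) : Prop where
  aff : IsAff l
  tri : ∃ k v, v ∈ region A ∧ v + dir k ∈ region A ∧ v + dir (k + 1) ∈ region A ∧
    h v = l v ∧ h (v + dir k) = l (v + dir k) ∧ h (v + dir (k + 1)) = l (v + dir (k + 1))

theorem Piece.le (H : IsHive A h) (T : Thick A) (p : Piece A h l) (v : ℤ × ℤ)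
    (hv : v ∈ region A) : h v ≤ l v := by
  obtain ⟨hl, k, u, h0, h1, h2, z0, z1, z2⟩ := p
  have := (H.sub_aff hl).nonpos T k u h0 h1 h2 (by simp [z0]) (by simp [z1]) (by simp [z2]) v hv
  simpa using this

theorem exists_piece (k : Fin 6) (v : ℤ × ℤ) (h0 : v ∈ region A) (h1 : v + dir k ∈ region A)
    (h2 : v + dir (k + 1) ∈ region A) : ∃ l, Piece A h l ∧ h v = l v ∧
      h (v + dir k) = l (v + dir k) ∧ h (v + dir (k + 1)) = l (v + dir (k + 1)) := by
  obtain ⟨l, hl, e0, e1, e2⟩ := exists_aff k v (h v) (h (v + dir k)) (h (v + dir (k + 1)))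
  exact ⟨l, ⟨hl, k, v, h0, h1, h2, e0.symm, e1.symm, e2.symm⟩, e0.symm, e1.symm, e2.symm⟩

theorem finite_pieces : {l | Piece A h l}.Finite := by
  classical
  have hf : ((Set.univ : Set (Fin 6)) ×ˢ region A).Finite :=
    Set.finite_univ.prod (finite_region A)
  have : ∀ q : Fin 6 × (ℤ × ℤ), ∃ l, IsAff l ∧ l q.2 = h q.2 ∧
      l (q.2 + dir q.1) = h (q.2 + dir q.1) ∧
      l (q.2 + dir (q.1 + 1)) = h (q.2 + dir (q.1 + 1)) := fun q => exists_aff _ _ _ _ _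
  choose f hf1 hf2 hf3 hf4 using this
  refine (hf.image f).subset ?_
  rintro l ⟨hl, k, v, h0, h1, h2, z0, z1, z2⟩
  refine ⟨(k, v), ⟨trivial, h0⟩, ?_⟩
  exact (hf1 (k, v)).ext_tri hl k v ((hf2 (k, v)).trans z0) ((hf3 (k, v)).trans z1)
    ((hf4 (k, v)).trans z2)

theorem Piece.exists_hexagon (H : IsHive A h) (T : Thick A) (p : Piece A h l) :
    ∃ M, Tight M ∧ Thick M ∧ region M = {v | v ∈ region A ∧ h v = l v} := by
  have N : ∀ v ∈ region A, (fun v => h v - l v) v ≤ 0 := fun v hv => by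
    simpa using p.le H T v hv
  obtain ⟨hl, k, u, h0, h1, h2, z0, z1, z2⟩ := p
  obtain ⟨M, hM, hz⟩ := (H.sub_aff hl).exists_hexagon T N ⟨u, h0, by simp [z0]⟩
  have hz' : region M = {v | v ∈ region A ∧ h v = l v} := by
    rw [hz]; ext v; simp [zeros, sub_eq_zero]
  refine ⟨M, hM, ?_, hz'⟩
  have m0 : u ∈ region M := by rw [hz']; exact ⟨h0, z0⟩
  have m1 : u + dir k ∈ region M := by rw [hz']; exact ⟨h1, z1⟩
  have m2 : u + dir (k + 1) ∈ region M := by rw [hz']; exact ⟨h2, z2⟩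
  rw [mem_region] at m0 m1 m2
  intro j
  fin_cases k <;> simp [dir] at m1 m2 <;> fin_cases j <;> simp <;> omega

open Classical in
/-- The support numbers of the hexagon on which `h` agrees with `l`. -/
def supp (A : Fin 6 → ℤ) (h l : ℤ × ℤ → ℝ) : Fin 6 → ℤ :=
  if hM : ∃ M, Tight M ∧ Thick M ∧ region M = {v | v ∈ region A ∧ h v = l v} then hM.choose else 0

theorem Piece.supp_spec (H : IsHive A h) (T : Thick A) (p : Piece A h l) :
    Tight (supp A h l) ∧ Thick (supp A h l) ∧
      region (supp A h l) = {v | v ∈ region A ∧ h v = l v} := by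
  have hM := p.exists_hexagon H T
  rw [supp, dif_pos hM]
  exact hM.choose_spec

theorem Piece.mem_supp (H : IsHive A h) (T : Thick A) (p : Piece A h l) {v : ℤ × ℤ} :
    v ∈ region (supp A h l) ↔ v ∈ region A ∧ h v = l v := by
  rw [(p.supp_spec H T).2.2]; rfl

/-- The length of a side of a hexagon. -/
def side (M : Fin 6 → ℤ) (k : Fin 6) : ℤ := M (k + 5) + M (k + 1) - M k

theorem lf_dir_self (k : Fin 6) : lf k (dir k) = 1 := by fin_cases k <;> simp [lf, dir]
theorem lf_dir_side (k : Fin 6) : lf k (dir (k + 1)) = 0 := by fin_cases k <;> simp [lf, dir]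
theorem lf_opp (k : Fin 6) (v : ℤ × ℤ) : lf (k + 3) v = - lf k v := by
  fin_cases k <;> simp [lf] <;> ring
theorem lf_rel (k : Fin 6) (v : ℤ × ℤ) : lf k v = lf (k + 5) v + lf (k + 1) v := by
  fin_cases k <;> simp [lf] <;> ring

/-- `l'` is the piece across side `k` of the piece `l`. -/
structure Adj (A : Fin 6 → ℤ) (h : ℤ × ℤ → ℝ) (k : Fin 6) (l l' : ℤ × ℤ → ℝ) : Prop where
  left : Piece A h l
  right : Piece A h l'
  diff : ∃ c : ℝ, 0 < c ∧ ∃ u ∈ region A, h u = l u ∧ ∀ v, l' v = l v - c * (lf k v - lf k u)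

theorem lf_le_of_adj (H : IsHive A h) (T : Thick A) (p : Piece A h l) (p' : Piece A h l')
    {k : Fin 6} {c m : ℝ} (hc : 0 < c) (hd : ∀ v, l' v = l v - c * (lf k v - m)) (v : ℤ × ℤ)
    (hv : v ∈ region (supp A h l)) : (lf k v : ℝ) ≤ m := by
  obtain ⟨hv1, hv2⟩ := (p.mem_supp H T).1 hv
  have := p'.le H T v hv1
  by_contra! hlt
  have h2 := mul_pos hc (sub_pos.2 hlt)
  rw [hd, hv2] at this
  linarith

theorem Adj.supp_eq (H : IsHive A h) (T : Thick A) {k : Fin 6} (a : Adj A h k l l') :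
    ∃ c : ℝ, 0 < c ∧ ∀ v, l' v = l v - c * (lf k v - supp A h l k) := by
  obtain ⟨p, p', c, hc, u, hu, hul, hd⟩ := a
  refine ⟨c, hc, ?_⟩
  have hum : u ∈ region (supp A h l) := (p.mem_supp H T).2 ⟨hu, hul⟩
  have h1 : lf k u ≤ supp A h l k := hum k
  have h2 := lf_le_of_adj H T p p' hc hd _ ((p.supp_spec H T).1.corner_mem k)
  rw [lf_corner] at h2
  have : lf k u = supp A h l k := le_antisymm h1 (by exact_mod_cast h2)
  rw [← this]
  exact hd

theorem Adj.symm {k : Fin 6} (a : Adj A h k l l') :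
    Adj A h (k + 3) l' l := by
  obtain ⟨p, p', c, hc, u, hu, hul, hd⟩ := a
  refine ⟨p', p, c, hc, u, hu, ?_, fun v => ?_⟩
  · rw [hd]; simp [hul]
  · rw [hd, lf_opp, lf_opp]; push_cast; ring

theorem Adj.supp_opp (H : IsHive A h) (T : Thick A) {k : Fin 6} (a : Adj A h k l l') :
    supp A h l' (k + 3) = - supp A h l k := by
  obtain ⟨c, hc, hd⟩ := a.supp_eq H T
  obtain ⟨c', hc', hd'⟩ := a.symm.supp_eq H T
  set u := corner (supp A h l) k
  have eu : lf k u = supp A h l k := lf_corner _ _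
  have e1 := hd u
  have e2 := hd' u
  rw [eu, sub_self, mul_zero, sub_zero] at e1
  rw [e1] at e2
  have e3 : c' * (lf (k + 3) u - supp A h l' (k + 3)) = 0 := by linarith
  rw [mul_eq_zero, sub_eq_zero, lf_opp, eu] at e3
  rcases e3 with e3 | e3
  · exact absurd e3 hc'.ne'
  · exact_mod_cast e3.symm

theorem Adj.unique (H : IsHive A h) (T : Thick A) {k : Fin 6} {l'' : ℤ × ℤ → ℝ}
    (a : Adj A h k l l') (b : Adj A h k l l'') : l' = l'' := by
  obtain ⟨c, hc, hd⟩ := a.supp_eq H T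
  obtain ⟨c', hc', hd'⟩ := b.supp_eq H T
  have key : ∀ {m m' : ℤ × ℤ → ℝ} (a : Adj A h k l m) (b : Adj A h k l m') {c c' : ℝ}
      (hd : ∀ v, m v = l v - c * (lf k v - supp A h l k))
      (hd' : ∀ v, m' v = l v - c' * (lf k v - supp A h l k)), ¬ c < c' := by
    intro m m' a b c c' hd hd' hlt
    have h1 : ∀ v ∈ region (supp A h m), lf (k + 3) v = supp A h m (k + 3) := by
      intro v hv
      refine le_antisymm (hv _) ?_
      rw [a.supp_opp H T, lf_opp, neg_le_neg_iff]
      have h3 := lf_le_of_adj H T a.right b.right (c := c' - c) (m := supp A h l k) (k := k)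
        (by linarith) (fun v => by rw [hd, hd']; ring) v hv
      exact_mod_cast h3
    have ts := a.right.supp_spec H T
    have h2 := h1 _ (ts.1.corner_mem k)
    rw [lf_opp, lf_corner] at h2
    have := ts.2.1 k
    omega
  have : c = c' := le_antisymm (not_lt.1 (key b a hd' hd)) (not_lt.1 (key a b hd hd'))
  subst this
  funext v
  rw [hd, hd']

theorem Adj.mem_iff (H : IsHive A h) (T : Thick A) {k : Fin 6} (a : Adj A h k l l') (v : ℤ × ℤ)
    (hv : lf k v = supp A h l k) : v ∈ region (supp A h l') ↔ v ∈ region (supp A h l) := by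
  obtain ⟨c, hc, hd⟩ := a.supp_eq H T
  rw [a.left.mem_supp H T, a.right.mem_supp H T, hd, hv]
  simp

theorem Adj.supp_next_le (H : IsHive A h) (T : Thick A) {k : Fin 6} (a : Adj A h k l l') :
    supp A h l (k + 5) - supp A h l k ≤ supp A h l' (k + 4) ∧
      supp A h l (k + 1) - supp A h l k ≤ supp A h l' (k + 2) := by
  have ts := a.left.supp_spec H T
  have h5 : k + 5 + 1 = k := by fin_cases k <;> rfl
  have e4 : ∀ v, lf (k + 4) v = lf (k + 5) v - lf k v := by
    intro v; fin_cases k <;> simp [lf] <;> ring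
  have e2 : ∀ v, lf (k + 2) v = lf (k + 1) v - lf k v := by
    intro v; fin_cases k <;> simp [lf] <;> ring
  constructor
  · have h1 := (a.mem_iff H T (corner (supp A h l) (k + 5))
      (by have := lf_corner' (supp A h l) (k + 5); rwa [h5] at this)).2 (ts.1.corner_mem _) (k + 4)
    have h2 := lf_corner' (supp A h l) (k + 5)
    rw [h5] at h2
    rwa [e4, lf_corner, h2] at h1
  · have h1 := (a.mem_iff H T (corner (supp A h l) k) (lf_corner _ _)).2
      (ts.1.corner_mem _) (k + 2)
    rwa [e2, lf_corner, lf_corner'] at h1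

theorem Adj.supp_next (H : IsHive A h) (T : Thick A) {k : Fin 6} (a : Adj A h k l l') :
    supp A h l' (k + 4) = supp A h l (k + 5) - supp A h l k ∧
      supp A h l' (k + 2) = supp A h l (k + 1) - supp A h l k := by
  have h1 := a.supp_next_le H T
  have h2 := a.symm.supp_next_le H T
  have h3 := a.supp_opp H T
  have e1 : k + 3 + 5 = k + 2 := by fin_cases k <;> rfl
  have e2 : k + 3 + 4 = k + 1 := by fin_cases k <;> rfl
  have e3 : k + 3 + 1 = k + 4 := by fin_cases k <;> rfl
  have e4 : k + 3 + 2 = k + 5 := by fin_cases k <;> rfl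
  rw [e1, e2, e3, e4] at h2
  omega

theorem Adj.side_eq (H : IsHive A h) (T : Thick A) {k : Fin 6} (a : Adj A h k l l') :
    side (supp A h l') (k + 3) = side (supp A h l) k := by
  have h1 := a.supp_next H T
  have h3 := a.supp_opp H T
  have e1 : k + 3 + 5 = k + 2 := by fin_cases k <;> rfl
  have e3 : k + 3 + 1 = k + 4 := by fin_cases k <;> rfl
  rw [side, side, e1, e3]
  omega

theorem Adj.slope_eq {k : Fin 6} (a : Adj A h k l l') : slope l' k = slope l k := by
  obtain ⟨p, p', c, hc, u, hu, hul, hd⟩ := a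
  rw [slope, slope, hd, hd, lf_dir_side]
  have : lf k 0 = 0 := by fin_cases k <;> simp [lf]
  rw [this]; ring

theorem Tight.corner_add_dir {M : Fin 6 → ℤ} (t : Tight M) (k : Fin 6) (hk : 0 < side M k) :
    corner M (k + 5) + dir (k + 1) ∈ region M := by
  have := t.ineqs
  rw [mem_region]
  fin_cases k <;> simp [corner, dir, side] at * <;> omega

theorem Piece.exists_adj (H : IsHive A h) (T : Thick A) (p : Piece A h l) (k : Fin 6)
    (hk : 0 < side (supp A h l) k) (hA : supp A h l k < A k) : ∃ l', Adj A h k l l' := by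
  have ts := p.supp_spec H T
  set M := supp A h l
  set u := corner M (k + 5) with hu
  have h5 : k + 5 + 1 = k := by fin_cases k <;> rfl
  have u0 := ts.1.corner_mem (k + 5)
  have u1 := ts.1.corner_add_dir k hk
  rw [← hu] at u0 u1
  have euk : lf k u = M k := by have := lf_corner' M (k + 5); rwa [h5] at this
  obtain ⟨r0, z0⟩ := (p.mem_supp H T).1 u0
  obtain ⟨r1, z1⟩ := (p.mem_supp H T).1 u1
  have r2 : u + dir k ∈ region A := by
    rw [← euk] at hA
    clear_value u
    clear euk hu u0 u1
    rw [mem_region] at *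
    fin_cases k <;> simp [lf, dir] at * <;> omega
  set c := l (u + dir k) - h (u + dir k) with hc
  have c0 : 0 < c := by
    refine lt_of_le_of_ne (sub_nonneg.2 (p.le H T _ r2)) fun h0 => ?_
    have : lf k (u + dir k) ≤ M k := (p.mem_supp H T).2 ⟨r2, (sub_eq_zero.1 h0.symm).symm⟩ k
    rw [lf_add, lf_dir_self, euk] at this
    omega
  refine ⟨fun v => l v - c * (lf k v - lf k u), p, ⟨p.aff.sub_lf k c _, k,
      u, r0, r2, r1, ?_, ?_, ?_⟩,
    c, c0, u, r0, z0, fun v => rfl⟩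
  · simp [z0]
  · simp [lf_add, lf_dir_self, hc]
  · simp [lf_add, lf_dir_side, z1]

theorem eq_or_adj (H : IsHive A h) (T : Thick A) (p : Piece A h l) (p' : Piece A h l')
    (k : Fin 6) (u : ℤ × ℤ) (r0 : u ∈ region A) (r1 : u + dir (k + 1) ∈ region A)
    (r2 : u + dir k ∈ region A) (z0 : h u = l u) (z1 : h (u + dir (k + 1)) = l (u + dir (k + 1)))
    (w0 : h u = l' u) (w1 : h (u + dir (k + 1)) = l' (u + dir (k + 1)))
    (w2 : h (u + dir k) = l' (u + dir k)) :
    l' = l ∨ (Adj A h k l l' ∧ lf k u = supp A h l k ∧ 0 < side (supp A h l) k) := by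
  set c := l (u + dir k) - h (u + dir k) with hc
  have e : l' = fun v => l v - c * (lf k v - lf k u) := by
    refine p'.aff.ext_tri (p.aff.sub_lf k c _) k u ?_ ?_ ?_
    · simp [← w0, z0]
    · simp [← w2, lf_add, lf_dir_self, hc]
    · simp [← w1, lf_add, lf_dir_side, z1]
  have hc0 : 0 ≤ c := sub_nonneg.2 (p.le H T _ r2)
  rcases hc0.eq_or_lt with hc0 | hc0
  · left
    rw [e, ← hc0]; simp
  · right
    have hd : ∀ v, l' v = l v - c * (lf k v - lf k u) := fun v => by rw [e]
    have u0 := (p.mem_supp H T).2 ⟨r0, z0⟩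
    have u1 := (p.mem_supp H T).2 ⟨r1, z1⟩
    have h1 : lf k u ≤ supp A h l k := u0 k
    have h2 := lf_le_of_adj H T p p' hc0 hd _ ((p.supp_spec H T).1.corner_mem k)
    rw [lf_corner] at h2
    have h3 : lf k u = supp A h l k := le_antisymm h1 (by exact_mod_cast h2)
    refine ⟨⟨p, p', c, hc0, u, r0, z0, hd⟩, h3, ?_⟩
    have q1 := u1 (k + 1)
    have q5 := u0 (k + 5)
    rw [lf_add, lf_dir_self] at q1
    have := lf_rel k u
    rw [side]
    omega

end HexHive

namespace HexHive

open Classical in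
/-- The indicator of the points off the sides met when turning from side `i` to side `j`. -/
def wt (M : Fin 6 → ℤ) (i j : Fin 6) (v : ℤ × ℤ) : ℤ :=
  if ∃ s, 0 < s - i ∧ s - i < j - i ∧ lf s v = M s then 0 else 1

/-- The pairs of sides through which a strip may cross a hexagon. -/
def Allowed (M : Fin 6 → ℤ) (i j : Fin 6) : Prop :=
  0 < side M i ∧ 0 < side M j ∧
    (j = i + 3 ∨ ((j = i + 2 ∨ j = i + 4) ∧ 0 < side M (i + 2) ∧ 0 < side M (i + 4)))

theorem Allowed.symm {M : Fin 6 → ℤ} {i j : Fin 6} (a : Allowed M i j) : Allowed M j i := by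
  obtain ⟨h1, h2, rfl | ⟨rfl | rfl, h3, h4⟩⟩ := a
  · refine ⟨h2, h1, Or.inl ?_⟩
    fin_cases i <;> rfl
  · refine ⟨h2, h1, Or.inr ⟨Or.inr ?_, ?_, ?_⟩⟩
    · fin_cases i <;> rfl
    · rwa [add_assoc]
    · rw [add_assoc]
      convert h1 using 2
      fin_cases i <;> rfl
  · refine ⟨h2, h1, Or.inr ⟨Or.inl ?_, ?_, ?_⟩⟩
    · fin_cases i <;> rfl
    · rw [add_assoc]
      convert h1 using 2
      fin_cases i <;> rfl
    · rw [add_assoc]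
      convert h3 using 2
      fin_cases i <;> rfl

theorem wt_chart (M : Fin 6 → ℤ) (i j : Fin 6) (v u : ℤ × ℤ) :
    wt M i j (chart i v u) = wt (chartBd i v M) 0 (j - i) u := by
  classical
  simp only [wt, sub_zero]
  congr 1
  apply propext
  constructor
  · rintro ⟨s, h1, h2, h3⟩
    refine ⟨s - i, h1, h2, ?_⟩
    have := lf_chart (s - i) i v u
    simp only [sub_add_cancel, chartBd] at *
    omega
  · rintro ⟨s, h1, h2, h3⟩
    refine ⟨s + i, by simpa using h1, by simpa using h2, ?_⟩
    rw [lf_chart, h3, chartBd]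
    omega

theorem side_chartBd (M : Fin 6 → ℤ) (i j : Fin 6) (v : ℤ × ℤ) :
    side (chartBd i v M) j = side M (j + i) := by
  have := lf_rel (j + i) v
  simp only [side, chartBd, add_right_comm _ _ i]
  omega

theorem tight_chartBd {M : Fin 6 → ℤ} (t : Tight M) (i : Fin 6) (v : ℤ × ℤ) :
    Tight (chartBd i v M) := by
  intro j
  have h1 := t (j + i)
  have := lf_rel (j + i) v
  simp only [chartBd, add_right_comm _ _ i]
  omega

theorem wt02 (M : Fin 6 → ℤ) (v : ℤ × ℤ) : wt M 0 2 v = if v.1 + v.2 = M 1 then 0 else 1 := by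
  simp [wt, Fin.exists_fin_succ, lf]
theorem wt03 (M : Fin 6 → ℤ) (v : ℤ × ℤ) :
    wt M 0 3 v = if v.1 + v.2 = M 1 ∨ v.2 = M 2 then 0 else 1 := by
  simp [wt, Fin.exists_fin_succ, lf]
theorem wt04 (M : Fin 6 → ℤ) (v : ℤ × ℤ) :
    wt M 0 4 v = if v.1 + v.2 = M 1 ∨ v.2 = M 2 ∨ -v.1 = M 3 then 0 else 1 := by
  simp [wt, Fin.exists_fin_succ, lf]

theorem wt_eq_zero_or_one (M : Fin 6 → ℤ) (i j : Fin 6) (v : ℤ × ℤ) :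
    wt M i j v = 0 ∨ wt M i j v = 1 := by
  rw [wt]; split_ifs <;> simp

theorem Allowed.cases {M : Fin 6 → ℤ} {i j : Fin 6} (a : Allowed M i j) :
    j - i = 2 ∨ j - i = 3 ∨ j - i = 4 := by
  obtain ⟨h1, h2, rfl | ⟨rfl | rfl, h3, h4⟩⟩ := a <;> simp

theorem Allowed.chart {M : Fin 6 → ℤ} {i j : Fin 6} (a : Allowed M i j) (v : ℤ × ℤ) :
    Allowed (chartBd i v M) 0 (j - i) := by
  obtain ⟨h1, h2, h3⟩ := a
  refine ⟨by rwa [side_chartBd, zero_add], by rwa [side_chartBd, sub_add_cancel], ?_⟩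
  rcases h3 with rfl | ⟨rfl | rfl, h3, h4⟩
  · left; simp
  · right
    simp only [side_chartBd, zero_add, add_comm _ i]
    exact ⟨Or.inl (by simp), h3, h4⟩
  · right
    simp only [side_chartBd, zero_add, add_comm _ i]
    exact ⟨Or.inr (by simp), h3, h4⟩

set_option maxHeartbeats 1000000 in
theorem wt_slack_zero {M : Fin 6 → ℤ} (t : Tight M) (T : Thick M) {j : Fin 6}
    (a : Allowed M 0 j) (k : Fin 6) (x y : ℤ) (h1 : (x, y) + dir (k + 1) ∈ region M)
    (h2 : (x, y) + dir (k + 5) ∈ region M) :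
    wt M 0 j ((x, y) + dir (k + 1)) + wt M 0 j ((x, y) + dir (k + 5)) ≤
      wt M 0 j (x, y) + wt M 0 j ((x, y) + dir k) := by
  have tt := t.ineqs
  have TT := T.ineqs
  have hj := a.cases
  obtain ⟨a1, a2, a3⟩ := a
  rw [mem_region] at h1 h2
  rw [sub_zero] at hj
  rcases hj with rfl | rfl | rfl
  · simp only [wt02]
    clear a3 a1 a2
    fin_cases k <;> simp [dir] at h1 h2 ⊢ <;> split_ifs <;> omega
  · simp only [wt03]
    clear a3 a1 a2
    fin_cases k <;> simp [dir] at h1 h2 ⊢ <;> split_ifs <;> omega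
  · simp only [wt04]
    have a4 : M 2 < M 1 + M 3 := by
      rcases a3 with h | ⟨h, h3, h4⟩
      · exact absurd h (by decide)
      · simp [side] at h3
        exact h3
    clear a3 a1 a2
    fin_cases k <;> simp [dir] at h1 h2 ⊢ <;> split_ifs <;> omega

theorem wt_side_zero {M : Fin 6 → ℤ} (t : Tight M) (T : Thick M) {j : Fin 6}
    (a : Allowed M 0 j) (s : Fin 6) (x y : ℤ) (hm : (x, y) ∈ region M) (hs : lf s (x, y) = M s) :
    (s = 0 → (wt M 0 j (x, y) = if lf 1 (x, y) = M 1 then 0 else 1)) ∧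
    (s = j → (wt M 0 j (x, y) = if lf (j + 5) (x, y) = M (j + 5) then 0 else 1)) ∧
    (s ≠ 0 → s ≠ j → wt M 0 j (x, y) = if s < j then 0 else 1) := by
  have tt := t.ineqs
  have TT := T.ineqs
  have hj := a.cases
  obtain ⟨a1, a2, a3⟩ := a
  rw [mem_region] at hm
  rw [sub_zero] at hj
  rcases hj with rfl | rfl | rfl
  · simp only [wt02]
    clear a3
    fin_cases s <;> simp [side, lf] at a1 a2 hs hm ⊢ <;> omega
  · simp only [wt03]
    clear a3
    fin_cases s <;> simp [side, lf] at a1 a2 hs hm ⊢ <;> omega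
  · simp only [wt04]
    clear a3
    fin_cases s <;> simp [side, lf] at a1 a2 hs hm ⊢ <;> omega

end HexHive

namespace TransitFlow

variable {D : Type*} {Tr : D → D → Prop}

/-- `w` is a walk of length `L` for the relation `Tr`. -/
def IsWalk (Tr : D → D → Prop) (w : ℕ → D) (L : ℕ) : Prop := ∀ i < L, Tr (w i) (w (i + 1))

theorem IsWalk.reach {w : ℕ → D} {L : ℕ} (hw : IsWalk Tr w L) (i j : ℕ) (hij : i ≤ j) (hj : j ≤ L) :
    Relation.ReflTransGen Tr (w i) (w j) := by
  induction j, hij using Nat.le_induction with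
  | base => exact .refl
  | succ j hij ih => exact (ih (by omega)).tail (hw j (by omega))

theorem exists_walk {a b : D} (hab : Relation.ReflTransGen Tr a b) :
    ∃ w L, IsWalk Tr w L ∧ w 0 = a ∧ w L = b := by
  induction hab with
  | refl => exact ⟨fun _ => a, 0, fun i hi => absurd hi (by omega), rfl, rfl⟩
  | @tail b c hab hbc ih =>
    obtain ⟨w, L, hw, h0, hL⟩ := ih
    refine ⟨fun i => if i ≤ L then w i else c, L + 1, fun i hi => ?_, by simpa using h0, by simp⟩
    rcases (Nat.lt_succ_iff.1 hi).eq_or_lt with rfl | hlt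
    · simpa [hL] using hbc
    · simp only [if_pos hlt.le, if_pos (Nat.succ_le_of_lt hlt)]
      exact hw i hlt

variable [DecidableEq D]

/-- Number of passages of a walk along a transit. -/
def passes (w : ℕ → D) (L : ℕ) (a b : D) : ℝ :=
  ∑ i ∈ Finset.range L, if w i = a ∧ w (i + 1) = b then 1 else 0

/-- Number of departures of a walk from a state. -/
def outs (w : ℕ → D) (L : ℕ) (a : D) : ℝ := ∑ i ∈ Finset.range L, if w i = a then 1 else 0

theorem passes_nonneg (w : ℕ → D) (L : ℕ) (a b : D) : 0 ≤ passes w L a b :=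
  Finset.sum_nonneg fun i _ => by split_ifs <;> simp

theorem IsWalk.tr_of_passes_ne {w : ℕ → D} {L : ℕ} (hw : IsWalk Tr w L) {a b : D}
    (h : passes w L a b ≠ 0) : Tr a b := by
  obtain ⟨i, hi, hne⟩ := Finset.exists_ne_zero_of_sum_ne_zero h
  have : w i = a ∧ w (i + 1) = b := by by_contra hc; simp [hc] at hne
  rw [← this.1, ← this.2]
  exact hw i (Finset.mem_range.1 hi)

theorem one_le_outs (w : ℕ → D) {L i : ℕ} (hi : i < L) : 1 ≤ outs w L (w i) := by
  refine le_trans (le_of_eq ?_)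
    (Finset.single_le_sum (f := fun n => if w n = w i then (1 : ℝ) else 0)
    (s := Finset.range L) (fun i _ => by split_ifs <;> simp) (Finset.mem_range.2 hi))
  simp

variable [Fintype D]

theorem sum_passes_right (w : ℕ → D) (L : ℕ) (a : D) : ∑ b, passes w L a b = outs w L a := by
  simp only [passes, outs]
  rw [Finset.sum_comm]
  refine Finset.sum_congr rfl fun i _ => ?_
  by_cases h : w i = a <;> simp [h]

theorem sum_passes_left (w : ℕ → D) (L : ℕ) (a : D) : ∑ b, passes w L b a =
    outs w L a + (if w L = a then 1 else 0) - (if w 0 = a then 1 else 0) := by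
  have : ∑ b, passes w L b a = ∑ i ∈ Finset.range L, if w (i + 1) = a then 1 else 0 := by
    simp only [passes]
    rw [Finset.sum_comm]
    refine Finset.sum_congr rfl fun i _ => ?_
    by_cases h : w (i + 1) = a <;> simp [h]
  rw [this, outs]
  have := (Finset.sum_range_succ (fun i => if w i = a then (1 : ℝ) else 0) L).symm.trans
    (Finset.sum_range_succ' _ _)
  linarith

/-- A flow on transits: nonnegative, supported on allowed transits and conserved. -/
structure IsFlow (Tr : D → D → Prop) (y : D → D → ℝ) : Prop where
  nonneg : ∀ a b, 0 ≤ y a b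
  supp : ∀ a b, y a b ≠ 0 → Tr a b
  conserve : ∀ a, ∑ b, y a b = ∑ b, y b a

theorem exists_flow_of_walks (rev : D → D) (hrr : ∀ d, rev (rev d) = d)
    (hsymm : ∀ a b, Tr a b → Tr (rev b) (rev a)) (d : D) {p b : ℕ → D} {L m : ℕ}
    (hp : IsWalk Tr p L) (hb : IsWalk Tr b m) (p0 : p 0 = d) (pL : p L = rev d)
    (b0 : b 0 = rev d) (bm : b m = d) (hL : 1 < L) (p1d : p 1 ≠ d) (p1r : p 1 ≠ rev d)
    (hp1 : ∀ i < L, p i ≠ rev (p 1)) :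
    ∃ y, IsFlow Tr y ∧ ∃ d, ∑ b, y d b ≠ ∑ b, y (rev d) b := by
  have hinv : Function.Involutive rev := hrr
  have s1 : ∀ a, ∑ c, passes b m (rev c) (rev a) = ∑ c, passes b m c (rev a) := fun a =>
    Equiv.sum_comp hinv.toPerm (fun c => passes b m c (rev a))
  have s2 : ∀ a, ∑ c, passes b m (rev a) (rev c) = ∑ c, passes b m (rev a) c := fun a =>
    Equiv.sum_comp hinv.toPerm (fun c => passes b m (rev a) c)
  have e1 : ∀ a c, (rev a = c) ↔ (a = rev c) := fun a c =>
    ⟨fun h => by rw [← h, hrr], fun h => by rw [h, hrr]⟩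
  refine ⟨fun a c => 2 * passes p L a c + passes b m a c + passes b m (rev c) (rev a), ?_, p 1, ?_⟩
  · refine ⟨fun a c => ?_, fun a c h => ?_, fun a => ?_⟩
    · have := passes_nonneg p L a c
      have := passes_nonneg b m a c
      have := passes_nonneg b m (rev c) (rev a)
      linarith
    · by_contra hn
      have h1 : passes p L a c = 0 := by_contra fun h => hn (hp.tr_of_passes_ne h)
      have h2 : passes b m a c = 0 := by_contra fun h => hn (hb.tr_of_passes_ne h)
      have h3 : passes b m (rev c) (rev a) = 0 := by_contra fun h => hn (by
        have := hsymm _ _ (hb.tr_of_passes_ne h)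
        rwa [hrr, hrr] at this)
      simp [h1, h2, h3] at h
    · simp only [Finset.sum_add_distrib, ← Finset.mul_sum, sum_passes_left, sum_passes_right, s1,
        s2, p0, pL, b0, bm]
      have q1 : (rev d = rev a) ↔ (d = a) := hinv.injective.eq_iff
      have q2 : (d = rev a) ↔ (rev d = a) := (e1 d a).symm
      simp only [q1, q2]
      ring
  · simp only [Finset.sum_add_distrib, ← Finset.mul_sum, sum_passes_left, sum_passes_right, s1,
      b0, bm]
    have n1 : ¬ (d = rev (p 1)) := fun h => p1r (by rw [h, hrr])
    have n2 : ¬ (rev d = rev (p 1)) := fun h => p1d (hinv.injective h).symm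
    simp only [hrr, n1, n2, p1d.symm, p1r.symm, if_false]
    have o1 : outs p L (rev (p 1)) = 0 :=
      Finset.sum_eq_zero fun i hi => if_neg (hp1 i (Finset.mem_range.1 hi))
    have o2 : 1 ≤ outs p L (p 1) := one_le_outs p hL
    rw [o1]
    intro h
    linarith

/-- A finite reversible transit system without dead ends or reversals carries a flow that is not
symmetric under reversal. -/
theorem exists_flow [Nonempty D] (rev : D → D) (hrr : ∀ d, rev (rev d) = d)
    (hsymm : ∀ a b, Tr a b → Tr (rev b) (rev a)) (hsucc : ∀ a, ∃ b, Tr a b)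
    (hrev : ∀ a, ¬ Tr a (rev a)) (hne : ∀ a, rev a ≠ a) :
    ∃ y, IsFlow Tr y ∧ ∃ d, ∑ b, y d b ≠ ∑ b, y (rev d) b := by
  by_contra! hcon
  choose s hs using hsucc
  have hcyc : ∃ d, Relation.ReflTransGen Tr d (rev d) ∧ Relation.ReflTransGen Tr (rev d) d := by
    obtain ⟨a⟩ := ‹Nonempty D›
    obtain ⟨i, j, hij, he⟩ := Finite.exists_ne_map_eq_of_infinite (fun n : ℕ => s^[n] a)
    wlog hlt : i < j generalizing i j
    · exact this j i hij.symm he.symm (by omega)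
    set w : ℕ → D := fun n => s^[i + n] a with hw
    have hww : IsWalk Tr w (j - i) := by
      intro n _
      simp only [hw]
      rw [← add_assoc, Function.iterate_succ_apply']
      exact hs _
    have w0 : w (j - i) = w 0 := by
      simp only [hw]
      rw [show i + (j - i) = j by omega]
      exact he.symm
    have := hcon (passes w (j - i)) ⟨passes_nonneg _ _, fun a b h => hww.tr_of_passes_ne h,
      fun a => by rw [sum_passes_left, sum_passes_right, w0]; ring⟩ (w 0)
    rw [sum_passes_right, sum_passes_right] at this
    have o2 : 1 ≤ outs w (j - i) (w 0) := one_le_outs w (show 0 < j - i by omega)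
    have o3 : outs w (j - i) (rev (w 0)) ≠ 0 := by
      rw [← this]; linarith
    obtain ⟨n, hn, hnn⟩ := Finset.exists_ne_zero_of_sum_ne_zero o3
    have hn' : w n = rev (w 0) := by by_contra hc; simp [hc] at hnn
    have hnlt := Finset.mem_range.1 hn
    refine ⟨w 0, ?_, ?_⟩
    · rw [← hn']; exact hww.reach 0 n (by omega) hnlt.le
    · have := hww.reach n (j - i) hnlt.le le_rfl
      rwa [w0, hn'] at this
  have hex : ∃ L d p, IsWalk Tr p L ∧ p 0 = d ∧ p L = rev d ∧
      Relation.ReflTransGen Tr (rev d) d := by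
    obtain ⟨d, h1, h2⟩ := hcyc
    obtain ⟨p, L, hp, h3, h4⟩ := exists_walk h1
    exact ⟨L, d, p, hp, h3, h4, h2⟩
  classical
  obtain ⟨d, p, hp, p0, pL, hd⟩ := Nat.find_spec hex
  set L := Nat.find hex with hLdef
  have hmin : ∀ i j, i ≤ j → j ≤ L → p j = rev (p i) → j - i < L → False := by
    intro i j hij hj hji hlt
    refine Nat.find_min hex hlt ⟨p i, fun n => p (i + n), ?_, rfl, ?_, ?_⟩
    · intro n hn
      have := hp (i + n) (by omega)
      rwa [add_assoc] at this
    · rw [← hji]; simp only; rw [Nat.add_sub_cancel' hij]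
    · rw [← hji]
      refine (hp.reach j L hj le_rfl).trans ?_
      rw [pL]
      refine hd.trans ?_
      rw [← p0]
      exact hp.reach 0 i (by omega) (by omega)
  obtain ⟨b, m, hb, b0, bm⟩ := exists_walk hd
  have L0 : L ≠ 0 := by
    intro h
    rw [h, p0] at pL
    exact hne d pL.symm
  have L1 : L ≠ 1 := by
    intro h
    have := hp 0 (by omega)
    rw [p0, zero_add, ← h, pL] at this
    exact hrev d this
  have hp01 := hp 0 (by omega)
  rw [p0, zero_add] at hp01
  have p1r : p 1 ≠ rev d := fun h => hrev d (by rwa [h] at hp01)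
  have p1d : p 1 ≠ d := by
    intro h
    exact hmin 1 L (by omega) le_rfl (by rw [pL, h]) (by omega)
  obtain ⟨y, hy, e, he⟩ := exists_flow_of_walks rev hrr hsymm d hp hb p0 pL b0 bm (by omega) p1d p1r
    (fun i hi h => by
      rcases Nat.eq_zero_or_pos i with rfl | hi0
      · rw [p0] at h
        exact p1r (by rw [h, hrr])
      · exact hmin 1 i hi0 hi.le h (by omega))
  exact he (hcon y hy e)

end TransitFlow

namespace HexHive

theorem Thick.chartBd {M : Fin 6 → ℤ} (T : Thick M) (i : Fin 6) (v : ℤ × ℤ) :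
    Thick (chartBd i v M) := by
  intro j
  have h1 := T (j + i)
  have := lf_opp (j + i) v
  simp only [HexHive.chartBd, add_right_comm _ _ i]
  omega

theorem wt_slack {M : Fin 6 → ℤ} (t : Tight M) (T : Thick M) {i j : Fin 6}
    (a : Allowed M i j) (k : Fin 6) (v : ℤ × ℤ) (h1 : v + dir (k + 1) ∈ region M)
    (h2 : v + dir (k + 5) ∈ region M) :
    wt M i j (v + dir (k + 1)) + wt M i j (v + dir (k + 5)) ≤
      wt M i j v + wt M i j (v + dir k) := by
  obtain ⟨⟨x, y⟩, rfl⟩ := exists_chart i (0, 0) v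
  have e : ∀ m : Fin 6, chart i (0, 0) (x, y) + dir (k + m)
      = chart i (0, 0) ((x, y) + dir (k - i + m)) := by
    intro m
    rw [chart_add_dir]
    congr 2
    abel
  have e0 := e 0
  simp only [add_zero] at e0
  rw [e] at h1 h2 ⊢
  rw [e 5, e0]
  simp only [wt_chart]
  rw [chart_mem_region] at h1 h2
  exact wt_slack_zero (tight_chartBd t _ _) (T.chartBd _ _) (a.chart _) _ _ _ h1 h2

theorem wt_side {M : Fin 6 → ℤ} (t : Tight M) (T : Thick M) {i j : Fin 6}
    (a : Allowed M i j) (s : Fin 6) (v : ℤ × ℤ) (hm : v ∈ region M) (hs : lf s v = M s) :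
    wt M i j v = if s = i then (if lf (s + 1) v = M (s + 1) then 0 else 1) else
      if s = j then (if lf (s + 5) v = M (s + 5) then 0 else 1) else
      if s - i < j - i then 0 else 1 := by
  obtain ⟨⟨x, y⟩, rfl⟩ := exists_chart i (0, 0) v
  have key : ∀ m : Fin 6, lf m (chart i (0, 0) (x, y)) = M m ↔
      lf (m - i) (x, y) = chartBd i (0, 0) M (m - i) := by
    intro m
    have := lf_chart (m - i) i (0, 0) (x, y)
    simp only [sub_add_cancel, HexHive.chartBd] at *
    omega
  rw [chart_mem_region] at hm
  rw [key] at hs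
  obtain ⟨h1, h2, h3⟩ := wt_side_zero (tight_chartBd t _ _) (T.chartBd _ _) (a.chart (0, 0)) _ _ _
    hm hs
  rw [wt_chart]
  simp only [key]
  rw [sub_eq_zero] at h1
  rw [sub_left_inj] at h2
  split_ifs with c1 c2 c3 c4 c5
  · rw [h1 c1, if_pos]
    subst c1
    simpa using c2
  · rw [h1 c1, if_neg]
    subst c1
    simpa using c2
  · rw [h2 c3, if_pos]
    rw [← c3, sub_add_eq_add_sub]
    exact c4
  · rw [h2 c3, if_neg]
    rw [← c3, sub_add_eq_add_sub]
    exact c4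
  · rw [h3 (by rwa [Ne, sub_eq_zero]) (by rwa [Ne, sub_left_inj]), if_pos c5]
  · rw [h3 (by rwa [Ne, sub_eq_zero]) (by rwa [Ne, sub_left_inj]), if_neg c5]

theorem Allowed.ne {M : Fin 6 → ℤ} {i j : Fin 6} (a : Allowed M i j) : i ≠ j := by
  rintro rfl
  have := a.cases
  simp at this

theorem wt_add_wt_swap {M : Fin 6 → ℤ} (t : Tight M) (T : Thick M) {i j : Fin 6}
    (a : Allowed M i j) (s : Fin 6) (v : ℤ × ℤ) (hm : v ∈ region M) (hs : lf s v = M s)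
    (hi : s ≠ i) (hj : s ≠ j) : wt M i j v + wt M j i v = 1 := by
  rw [wt_side t T a s v hm hs, wt_side t T a.symm s v hm hs]
  simp only [hi, hj, if_false]
  have := a.ne
  revert hi hj this
  clear * -
  revert i j s
  decide

theorem one_le_wt_add {M : Fin 6 → ℤ} (t : Tight M) (T : Thick M) {i j : Fin 6}
    (a : Allowed M i j) (v : ℤ × ℤ) (hm : v ∈ region M) : 1 ≤ wt M i j v + wt M j i v := by
  rcases wt_eq_zero_or_one M i j v with h | h
  · rw [wt] at h
    split_ifs at h with hc
    · obtain ⟨s, h1, h2, h3⟩ := hc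
      rw [wt_add_wt_swap t T a s v hm h3]
      · rintro rfl; simp at h1
      · rintro rfl; simp at h2
    · simp at h
  · rw [h]
    rcases wt_eq_zero_or_one M j i v with h | h <;> rw [h] <;> norm_num

/-- A real number is integral. -/
def IsInt (x : ℝ) : Prop := ∃ m : ℤ, x = m

theorem IsInt.add {x y : ℝ} : IsInt x → IsInt y → IsInt (x + y) := by
  rintro ⟨a, rfl⟩ ⟨b, rfl⟩; exact ⟨a + b, by push_cast; rfl⟩
theorem IsInt.neg {x : ℝ} : IsInt x → IsInt (-x) := by
  rintro ⟨a, rfl⟩; exact ⟨-a, by push_cast; rfl⟩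
theorem IsInt.sub {x y : ℝ} : IsInt x → IsInt y → IsInt (x - y) := by
  rintro ⟨a, rfl⟩ ⟨b, rfl⟩; exact ⟨a - b, by push_cast; rfl⟩

/-- The function takes integral values on the border of the hexagon. -/
def IntBorder (A : Fin 6 → ℤ) (h : ℤ × ℤ → ℝ) : Prop :=
  ∀ v ∈ region A, ∀ k, lf k v = A k → IsInt (h v)

variable {A : Fin 6 → ℤ} {h l l' : ℤ × ℤ → ℝ}

theorem Piece.supp_le (H : IsHive A h) (T : Thick A) (p : Piece A h l) (k : Fin 6) :
    supp A h l k ≤ A k := by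
  have t := (p.supp_spec H T).1
  have hc : corner (supp A h l) k ∈ region (supp A h l) := t.corner_mem k
  have := ((p.mem_supp H T).1 hc).1 k
  rwa [lf_corner] at this

theorem Piece.slope_eq_of_edge (H : IsHive A h) (T : Thick A) (p : Piece A h l) {k : Fin 6}
    {u : ℤ × ℤ} (h0 : u ∈ region (supp A h l)) (h1 : u + dir (k + 1) ∈ region (supp A h l)) :
    slope l k = h (u + dir (k + 1)) - h u := by
  rw [((p.mem_supp H T).1 h0).2, ((p.mem_supp H T).1 h1).2, p.aff.add_dir]
  ring

theorem IntBorder.isInt_slope (B : IntBorder A h) (H : IsHive A h) (T : Thick A)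
    (p : Piece A h l) {k : Fin 6} {u : ℤ × ℤ} (h0 : u ∈ region (supp A h l))
    (h1 : u + dir (k + 1) ∈ region (supp A h l)) (hu : lf k u = A k) : IsInt (slope l k) := by
  rw [p.slope_eq_of_edge H T h0 h1]
  refine IsInt.sub (B _ ((p.mem_supp H T).1 h1).1 k ?_) (B _ ((p.mem_supp H T).1 h0).1 k hu)
  rw [lf_add, lf_dir_side, hu, add_zero]

theorem IntBorder.supp_lt (B : IntBorder A h) (H : IsHive A h) (T : Thick A) (p : Piece A h l)
    {k : Fin 6} (hk : 0 < side (supp A h l) k) (hs : ¬ IsInt (slope l k)) :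
    supp A h l k < A k := by
  refine lt_of_le_of_ne (p.supp_le H T k) fun he => hs ?_
  have t := (p.supp_spec H T).1
  refine B.isInt_slope H T p (t.corner_mem (k + 5)) (t.corner_add_dir k hk) ?_
  rw [← he]
  have := lf_corner' (supp A h l) (k + 5)
  rwa [show k + 5 + 1 = k by rw [add_assoc]; exact add_zero k] at this

/-- The oriented fractional edges of the subdivision of a hive. -/
def State (A : Fin 6 → ℤ) (h : ℤ × ℤ → ℝ) : Type :=
  {d : (ℤ × ℤ → ℝ) × Fin 6 // Piece A h d.1 ∧ 0 < side (supp A h d.1) d.2 ∧ ¬ IsInt (slope d.1 d.2)}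

instance : Finite (State A h) := by
  have := (finite_pieces (A := A) (h := h)).to_subtype
  refine Finite.of_injective
    (fun d : State A h => ((⟨d.1.1, d.2.1⟩, d.1.2) : {l | Piece A h l} × Fin 6)) ?_
  intro a b hab
  simp only [Prod.mk.injEq, Subtype.mk.injEq] at hab
  exact Subtype.ext (Prod.ext hab.1 hab.2)

/-- The transitions between oriented edges through a piece. -/
def Transit (a b : State A h) : Prop :=
  Allowed (supp A h a.1.1) a.1.2 (b.1.2 + 3) ∧ Adj A h (b.1.2 + 3) a.1.1 b.1.1

theorem add_three_three (k : Fin 6) : k + 3 + 3 = k := by rw [add_assoc]; exact add_zero k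

theorem State.exists_of_adj (H : IsHive A h) (T : Thick A) {k : Fin 6} (a : Adj A h k l l')
    (h1 : 0 < side (supp A h l) k) (h2 : ¬ IsInt (slope l k)) :
    ∃ b : State A h, b.1 = (l', k + 3) := by
  refine ⟨⟨(l', k + 3), a.right, ?_, ?_⟩, rfl⟩
  · simpa only [a.side_eq H T] using h1
  · simp only [a.right.aff.slope_neg, a.slope_eq]
    exact fun h => h2 (by simpa using h.neg)

theorem State.exists_rev (H : IsHive A h) (T : Thick A) (B : IntBorder A h) (a : State A h) :
    ∃ b : State A h, Adj A h a.1.2 a.1.1 b.1.1 ∧ b.1.2 = a.1.2 + 3 := by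
  obtain ⟨⟨l, k⟩, p, h1, h2⟩ := a
  obtain ⟨l', hl'⟩ := p.exists_adj H T k h1 (B.supp_lt H T p h1 h2)
  obtain ⟨b, hb⟩ := State.exists_of_adj H T hl' h1 h2
  exact ⟨b, by rw [hb]; exact hl', by rw [hb]⟩

theorem exists_state_flow (H : IsHive A h) (T : Thick A) (B : IntBorder A h)
    [Nonempty (State A h)] [Fintype (State A h)] :
    ∃ (rev : State A h → State A h) (y : State A h → State A h → ℝ),
      (∀ a, rev (rev a) = a) ∧ (∀ a, Adj A h a.1.2 a.1.1 (rev a).1.1 ∧ (rev a).1.2 = a.1.2 + 3) ∧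
      TransitFlow.IsFlow Transit y ∧ TransitFlow.IsFlow Transit (fun a b => y (rev b) (rev a)) ∧
      ∃ d, ∑ b, y d b ≠ ∑ b, y (rev d) b := by
  classical
  choose rev hr hr2 using State.exists_rev H T B
  have hext : ∀ a b : State A h, a.1.1 = b.1.1 → a.1.2 = b.1.2 → a = b :=
    fun a b e1 e2 => Subtype.ext (Prod.ext e1 e2)
  have hrr : ∀ a, rev (rev a) = a := by
    intro a
    refine hext _ _ ?_ ?_
    · have h1 := hr (rev a)
      have h2 := (hr a).symm
      rw [hr2] at h1
      exact h1.unique H T h2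
    · rw [hr2, hr2, add_three_three]
  have hb : ∀ a b : State A h, Transit a b → (rev b).1.1 = a.1.1 := by
    intro a b hab
    have h1 := hab.2.symm
    rw [add_three_three] at h1
    exact (hr b).unique H T h1
  have hsymm : ∀ a b : State A h, Transit a b → Transit (rev b) (rev a) := by
    intro a b hab
    unfold Transit
    rw [hb a b hab, hr2, hr2, add_three_three]
    exact ⟨hab.1.symm, hr a⟩
  have hsucc : ∀ a : State A h, ∃ b, Transit a b := by
    intro a
    obtain ⟨⟨l, k⟩, p, h1, h2⟩ := a
    dsimp only at p h1 h2
    have main : ∃ j, Allowed (supp A h l) k j ∧ ¬ IsInt (slope l j) := by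
      by_cases h3 : 0 < side (supp A h l) (k + 3)
      · refine ⟨k + 3, ⟨h1, h3, Or.inl rfl⟩, ?_⟩
        rw [p.aff.slope_neg]
        exact fun h => h2 (by simpa using h.neg)
      · have t := (p.supp_spec H T).1
        have T' := (p.supp_spec H T).2.1
        have q0 : 0 ≤ side (supp A h l) (k + 3) := by
          have := t (k + 3); simp only [side]; omega
        have e1 : ∀ m : Fin 6, k + m + 5 = k + (m + 5) := fun m => add_assoc _ _ _
        have e2 : ∀ m : Fin 6, k + m + 1 = k + (m + 1) := fun m => add_assoc _ _ _
        have T0 := T' k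
        have T1 := T' (k + 1)
        have T2 := T' (k + 2)
        have t0 := t k
        have t1 := t (k + 1)
        have t2 := t (k + 2)
        have t3 := t (k + 3)
        have t4 := t (k + 4)
        have t5 := t (k + 5)
        simp only [add_assoc, side] at *
        norm_num at *
        simp only [Fin.reduceAdd, add_zero] at *
        have q2 : 0 < supp A h l (k + 1) + supp A h l (k + 3) - supp A h l (k + 2) := by omega
        have q4 : 0 < supp A h l (k + 3) + supp A h l (k + 5) - supp A h l (k + 4) := by omega
        have s1 := p.aff.slope_add k
        have s2 := p.aff.slope_neg (k + 2)
        have s4 := p.aff.slope_neg (k + 1)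
        simp only [add_assoc, Fin.reduceAdd] at s2 s4
        by_cases h4 : IsInt (slope l (k + 2))
        · refine ⟨k + 4, ⟨?_, ?_, Or.inr ⟨Or.inr rfl, ?_, ?_⟩⟩, ?_⟩
          · simp only [side]; omega
          · simp only [side, add_assoc, Fin.reduceAdd]; omega
          · simp only [side, add_assoc, Fin.reduceAdd]; omega
          · simp only [side, add_assoc, Fin.reduceAdd]; omega
          · intro h5
            apply h2
            rw [s1, s2]
            have : slope l (k + 1) = - slope l (k + 4) := by rw [s4]; ring
            rw [this]
            exact h4.neg.add h5.neg
        · refine ⟨k + 2, ⟨?_, ?_, Or.inr ⟨Or.inl rfl, ?_, ?_⟩⟩, h4⟩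
          · simp only [side]; omega
          · simp only [side, add_assoc, Fin.reduceAdd]; omega
          · simp only [side, add_assoc, Fin.reduceAdd]; omega
          · simp only [side, add_assoc, Fin.reduceAdd]; omega
    obtain ⟨j, hj, hj2⟩ := main
    obtain ⟨l', hl'⟩ := p.exists_adj H T j hj.2.1 (B.supp_lt H T p hj.2.1 hj2)
    obtain ⟨b, hb⟩ := State.exists_of_adj H T hl' hj.2.1 hj2
    refine ⟨b, ?_⟩
    unfold Transit
    rw [hb]
    simp only [add_three_three]
    exact ⟨hj, hl'⟩
  obtain ⟨y, hy, d, hd⟩ := TransitFlow.exists_flow (Tr := Transit) rev hrr hsymm hsucc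
    (fun a ha => by
      have := ha.1.ne
      rw [hr2, add_three_three] at this
      exact this rfl)
    (fun a ha => by
      have := hr2 a
      rw [ha] at this
      simp at this)
  have hinv : Function.Involutive rev := hrr
  refine ⟨rev, y, hrr, fun a => ⟨hr a, hr2 a⟩, hy, ⟨fun a b => hy.nonneg _ _, fun a b hab => ?_,
    fun a => ?_⟩, d, hd⟩
  · have := hsymm _ _ (hy.supp _ _ hab)
    rwa [hrr, hrr] at this
  · exact (Equiv.sum_comp hinv.toPerm (fun c => y c (rev a))).trans
      ((hy.conserve (rev a)).symm.trans (Equiv.sum_comp hinv.toPerm (fun c => y (rev a) c)).symm)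

end HexHive

namespace HexHive

/-- A hexagon in the positive quadrant with a corner at the origin. -/
structure Quad (A : Fin 6 → ℤ) : Prop where
  tight : Tight A
  thick : Thick A
  z3 : A 3 = 0
  z4 : A 4 = 0
  z5 : A 5 = 0

theorem Quad.mem {A : Fin 6 → ℤ} (q : Quad A) {x y : ℤ} : (x, y) ∈ region A ↔
    0 ≤ x ∧ 0 ≤ y ∧ x ≤ A 0 ∧ y ≤ A 2 ∧ x + y ≤ A 1 := by
  rw [mk_mem_region, q.z3, q.z4, q.z5]
  omega

theorem Quad.bounds {A : Fin 6 → ℤ} (q : Quad A) :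
    1 ≤ A 0 ∧ 1 ≤ A 2 ∧ A 0 ≤ A 1 ∧ A 2 ≤ A 1 ∧ A 1 ≤ A 0 + A 2 := by
  have h1 := q.tight.ineqs
  have h2 := q.thick.ineqs
  have := q.z3
  have := q.z4
  have := q.z5
  omega

theorem add_dir0 (x y : ℤ) : (x, y) + dir 0 = (x + 1, y) := by simp [dir]
theorem add_dir1 (x y : ℤ) : (x, y) + dir 1 = (x, y + 1) := by simp [dir]
theorem add_dir2 (x y : ℤ) : (x, y) + dir 2 = (x - 1, y + 1) := by simp [dir, sub_eq_add_neg]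
theorem add_dir3 (x y : ℤ) : (x, y) + dir 3 = (x - 1, y) := by simp [dir, sub_eq_add_neg]
theorem add_dir4 (x y : ℤ) : (x, y) + dir 4 = (x, y - 1) := by simp [dir, sub_eq_add_neg]
theorem add_dir5 (x y : ℤ) : (x, y) + dir 5 = (x + 1, y - 1) := by simp [dir, sub_eq_add_neg]

theorem fin6_cases (k : Fin 6) : k = 0 ∨ k = 1 ∨ k = 2 ∨ k = 3 ∨ k = 4 ∨ k = 5 := by
  revert k; decide

theorem edge_induction {A : Fin 6 → ℤ} (q : Quad A) (P : ℤ × ℤ → ℤ × ℤ → Prop)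
    (symm : ∀ u v, P u v → P v u)
    (border : ∀ k u, u ∈ region A → u + dir (k + 1) ∈ region A → lf k u = A k →
      P u (u + dir (k + 1)))
    (tri : ∀ k u, u ∈ region A → u + dir k ∈ region A → u + dir (k + 1) ∈ region A →
      P u (u + dir k) → P u (u + dir (k + 1)))
    (k : Fin 6) (u : ℤ × ℤ) (hu : u ∈ region A) (huk : u + dir k ∈ region A) :
    P u (u + dir k) := by
  have b := q.bounds
  have vert : ∀ (a : ℕ) (y : ℤ), ((a : ℤ), y) ∈ region A → ((a : ℤ), y + 1) ∈ region A →
      P ((a : ℤ), y) ((a : ℤ), y + 1) := by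
    intro a
    induction a with
    | zero =>
      intro y h1 h2
      apply symm
      have := border 3 (((0 : ℕ) : ℤ), y + 1) h2 (by simpa [dir] using h1) (by simp [lf, q.z3])
      simpa [dir] using this
    | succ a ih =>
      intro y h1 h2
      push_cast at *
      have m1 : ((a : ℤ), y) ∈ region A := by rw [q.mem] at *; omega
      have m2 : ((a : ℤ), y + 1) ∈ region A := by rw [q.mem] at *; omega
      have s1 := tri 4 ((a : ℤ), y + 1) m2 (by simpa [dir] using m1)
        (by simpa [dir] using h1) (by simpa [dir] using symm _ _ (ih y m1 m2))
      have s2 := tri 5 ((a : ℤ), y + 1) m2 (by simpa [dir] using h1)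
        (by simpa [dir] using h2) (by simpa [dir] using s1)
      have s3 := tri 3 ((a : ℤ) + 1, y + 1) h2 (by simpa [dir] using m2)
        (by simpa [dir] using h1) (by simpa [dir] using symm _ _ s2)
      simpa [dir] using symm _ _ s3
  have vert' : ∀ x y : ℤ, (x, y) ∈ region A → (x, y + 1) ∈ region A → P (x, y) (x, y + 1) := by
    intro x y h1 h2
    lift x to ℕ using (q.mem.1 h1).1
    exact vert x y h1 h2
  have diag : ∀ x y : ℤ, (x, y + 1) ∈ region A → (x + 1, y) ∈ region A →
      P (x, y + 1) (x + 1, y) := by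
    intro x y h1 h2
    have m1 : (x, y) ∈ region A := by rw [q.mem] at *; omega
    have := tri 4 (x, y + 1) h1 (by simpa [dir] using m1)
        (by simpa [dir] using h2) (by simpa [dir] using symm _ _ (vert' x y m1 h1))
    simpa [dir] using this
  have hor : ∀ x y : ℤ, (x, y) ∈ region A → (x + 1, y) ∈ region A →
      P (x, y) (x + 1, y) := by
    intro x y h1 h2
    by_cases hy : y = 0
    · subst hy
      simpa [dir] using border 5 (x, 0) h1 (by simpa [dir] using h2) (by simp [lf, q.z5])
    · have m1 : (x + 1, y - 1) ∈ region A := by rw [q.mem] at *; omega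
      have s1 := tri 5 (x, y) h1 (by rwa [add_dir5]) (by simpa [dir] using h2)
        (by rw [add_dir5]; simpa using diag x (y - 1) (by simpa using h1) m1)
      simpa [dir] using s1
  obtain ⟨x, y⟩ := u
  rcases fin6_cases k with rfl | rfl | rfl | rfl | rfl | rfl
  · rw [add_dir0] at *
    exact hor x y hu huk
  · rw [add_dir1] at *
    exact vert' x y hu huk
  · rw [add_dir2] at *
    simpa using symm _ _ (diag (x - 1) y huk (by simpa using hu))
  · rw [add_dir3] at *
    simpa using symm _ _ (hor (x - 1) y huk (by simpa using hu))
  · rw [add_dir4] at *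
    simpa using symm _ _ (vert' x (y - 1) huk (by simpa using hu))
  · rw [add_dir5] at *
    simpa using diag x (y - 1) (by simpa using hu) huk

theorem exists_potential {A : Fin 6 → ℤ} (q : Quad A) (e : ℤ × ℤ → ℤ × ℤ → ℝ)
    (anti : ∀ k u, u ∈ region A → u + dir k ∈ region A → e (u + dir k) u = - e u (u + dir k))
    (border : ∀ k u, u ∈ region A → u + dir (k + 1) ∈ region A → lf k u = A k →
      e u (u + dir (k + 1)) = 0)
    (tri : ∀ k u, u ∈ region A → u + dir k ∈ region A → u + dir (k + 1) ∈ region A →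
      e u (u + dir k) + e (u + dir k) (u + dir (k + 1)) = e u (u + dir (k + 1))) :
    ∃ w : ℤ × ℤ → ℝ, (∀ k u, u ∈ region A → u + dir k ∈ region A →
      w (u + dir k) - w u = e u (u + dir k)) ∧
      ∀ v ∈ region A, ∀ k, lf k v = A k → w v = 0 := by
  have b := q.bounds
  let w : ℤ × ℤ → ℝ := fun v => ∑ i ∈ Finset.range v.1.toNat, e ((i : ℤ), v.2) ((i : ℤ) + 1, v.2)
  have hor : ∀ x y : ℤ, (x, y) ∈ region A → w (x + 1, y) - w (x, y) = e (x, y) (x + 1, y) := by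
    intro x y h1
    lift x to ℕ using (q.mem.1 h1).1
    have : ((x : ℤ) + 1).toNat = x + 1 := by omega
    simp [w, this, Finset.sum_range_succ]
  have w0 : ∀ y, w (0, y) = 0 := fun y => by simp [w]
  have vert : ∀ (a : ℕ) (y : ℤ), ((a : ℤ), y) ∈ region A → ((a : ℤ), y + 1) ∈ region A →
      w ((a : ℤ), y + 1) - w ((a : ℤ), y) = e ((a : ℤ), y) ((a : ℤ), y + 1) := by
    intro a
    induction a with
    | zero =>
      intro y h1 h2
      have := border 3 (((0 : ℕ) : ℤ), y + 1) h2 (by simpa [dir] using h1) (by simp [lf, q.z3])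
      have h3 := anti 1 (0, y) (by simpa using h1) (by simpa [dir] using h2)
      simp [dir] at this h3
      simp [w0, h3] at this ⊢
      exact this.symm
    | succ a ih =>
      intro y h1 h2
      push_cast at *
      have m1 : ((a : ℤ), y) ∈ region A := by rw [q.mem] at *; omega
      have m2 : ((a : ℤ), y + 1) ∈ region A := by rw [q.mem] at *; omega
      have s0 := ih y m1 m2
      have s1 := tri 0 ((a : ℤ), y) m1 (by simpa [dir] using h1) (by simpa [dir] using m2)
      have s2 := tri 3 ((a : ℤ) + 1, y + 1) h2 (by simpa [dir] using m2) (by simpa [dir] using h1)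
      have s3 := anti 2 ((a : ℤ) + 1, y) h1 (by simpa [dir] using m2)
      have s4 := anti 0 ((a : ℤ), y + 1) m2 (by simpa [dir] using h2)
      have s5 := anti 1 ((a : ℤ) + 1, y) h1 (by simpa [dir] using h2)
      simp [dir] at s1 s2 s3 s4 s5
      have s6 := hor a y m1
      have s7 := hor a (y + 1) m2
      linarith
  have vert' : ∀ x y : ℤ, (x, y) ∈ region A → (x, y + 1) ∈ region A →
      w (x, y + 1) - w (x, y) = e (x, y) (x, y + 1) := by
    intro x y h1 h2
    lift x to ℕ using (q.mem.1 h1).1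
    exact vert x y h1 h2
  have diag : ∀ x y : ℤ, (x, y + 1) ∈ region A → (x + 1, y) ∈ region A →
      w (x, y + 1) - w (x + 1, y) = e (x + 1, y) (x, y + 1) := by
    intro x y h1 h2
    have m1 : (x, y) ∈ region A := by rw [q.mem] at *; omega
    have s1 := tri 0 (x, y) m1 (by simpa [dir] using h2) (by simpa [dir] using h1)
    simp [dir] at s1
    have := hor x y m1
    have := vert' x y m1 h1
    linarith
  have flip : ∀ k u, u ∈ region A → u + dir k ∈ region A →
      w (u + dir k) - w u = e u (u + dir k) → w u - w (u + dir k) = e (u + dir k) u := by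
    intro k u h1 h2 h3
    rw [anti k u h1 h2, ← h3]
    ring
  have main : ∀ k u, u ∈ region A → u + dir k ∈ region A →
      w (u + dir k) - w u = e u (u + dir k) := by
    rintro k ⟨x, y⟩ hu huk
    rcases fin6_cases k with rfl | rfl | rfl | rfl | rfl | rfl
    · rw [add_dir0] at *
      exact hor x y hu
    · rw [add_dir1] at *
      exact vert' x y hu huk
    · rw [add_dir2] at *
      simpa using diag (x - 1) y huk (by simpa using hu)
    · rw [add_dir3] at *
      have := flip 0 (x - 1, y) huk (by simpa [dir] using hu)
        (by simpa [dir] using hor (x - 1) y huk)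
      simpa [dir] using this
    · rw [add_dir4] at *
      have := flip 1 (x, y - 1) huk (by simpa [dir] using hu)
        (by simpa [dir] using vert' x (y - 1) huk (by simpa using hu))
      simpa [dir] using this
    · rw [add_dir5] at *
      have := flip 2 (x + 1, y - 1) huk (by simpa [dir] using hu)
        (by simpa [dir] using diag x (y - 1) (by simpa using hu) huk)
      simpa [dir] using this
  refine ⟨w, main, ?_⟩
  have bd : ∀ k u, u ∈ region A → u + dir (k + 1) ∈ region A → lf k u = A k →
      w (u + dir (k + 1)) = w u := by
    intro k u h1 h2 h3
    have := main (k + 1) u h1 h2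
    rw [border k u h1 h2 h3] at this
    linarith
  have bot : ∀ x : ℕ, ((x : ℤ), 0) ∈ region A → w ((x : ℤ), 0) = 0 := by
    intro x
    induction x with
    | zero => intro _; exact w0 0
    | succ x ih =>
      intro h1
      have m1 : ((x : ℤ), 0) ∈ region A := by rw [q.mem] at *; push_cast at h1; omega
      have := bd 5 ((x : ℤ), 0) m1 (by simpa [dir] using h1) (by simp [lf, q.z5])
      rw [ih m1] at this
      simpa [dir] using this
  have top : ∀ x : ℕ, ((x : ℤ), A 2) ∈ region A → w ((x : ℤ), A 2) = 0 := by
    intro x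
    induction x with
    | zero => intro _; exact w0 _
    | succ x ih =>
      intro h1
      have m1 : ((x : ℤ), A 2) ∈ region A := by rw [q.mem] at *; push_cast at h1; omega
      have := bd 2 (((x + 1 : ℕ) : ℤ), A 2) h1 (by simpa [dir] using m1) (by simp [lf])
      simp [dir, ih m1] at this
      simpa using this.symm
  have right : ∀ y : ℕ, (A 0, (y : ℤ)) ∈ region A → w (A 0, (y : ℤ)) = 0 := by
    intro y
    induction y with
    | zero =>
      intro h
      have := bot (A 0).toNat
      rw [Int.toNat_of_nonneg (by omega)] at this
      exact this h
    | succ y ih =>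
      intro h1
      have m1 : (A 0, (y : ℤ)) ∈ region A := by rw [q.mem] at *; push_cast at h1; omega
      have := bd 0 (A 0, (y : ℤ)) m1 (by simpa [dir] using h1) (by simp [lf])
      rw [ih m1] at this
      simpa [dir] using this
  have slant : ∀ (m : ℕ) (x y : ℤ), (x, y) ∈ region A → x + y = A 1 → A 2 - y = m →
      w (x, y) = 0 := by
    intro m
    induction m with
    | zero =>
      intro x y h1 h2 h3
      lift x to ℕ using (q.mem.1 h1).1
      obtain rfl : y = A 2 := by simp at h3; omega
      exact top x h1
    | succ m ih =>
      intro x y h1 h2 h3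
      have m1 : (x - 1, y + 1) ∈ region A := by rw [q.mem] at *; push_cast at h3; omega
      have := bd 1 (x, y) h1 m1 (by simp [lf]; omega)
      rw [← this]
      exact ih (x - 1) (y + 1) m1 (by omega) (by push_cast at h3; omega)
  rintro ⟨x, y⟩ hv k hk
  have hm := q.mem.1 hv
  have z3 := q.z3
  have z4 := q.z4
  have z5 := q.z5
  lift x to ℕ using hm.1
  lift y to ℕ using hm.2.1
  fin_cases k <;> simp [lf] at hk
  · rw [hk] at hv ⊢
    exact right y hv
  · exact slant (A 2 - y).toNat _ _ hv hk (by omega)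
  · rw [hk] at hv ⊢
    exact top x hv
  · obtain rfl : x = 0 := by omega
    exact w0 _
  · obtain rfl : x = 0 := by omega
    exact w0 _
  · obtain rfl : y = 0 := by omega
    exact bot x hv

end HexHive

namespace HexHive

variable {A : Fin 6 → ℤ} {h l l' : ℤ × ℤ → ℝ}

theorem dir_add_opp (k : Fin 6) : dir (k + 1) + dir (k + 4) = 0 := by
  fin_cases k <;> simp [dir]

theorem dir_add_next (k : Fin 6) : dir (k + 1) + dir (k + 3) = dir (k + 2) := by
  fin_cases k <;> simp [dir]

theorem exists_third {M : Fin 6 → ℤ} (t : Tight M) (T : Thick M) (k : Fin 6) (u : ℤ × ℤ)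
    (h0 : u ∈ region M) (h1 : u + dir (k + 1) ∈ region M) :
    u + dir k ∈ region M ∨ u + dir (k + 2) ∈ region M := by
  have tt := t.ineqs
  have TT := T.ineqs
  obtain ⟨x, y⟩ := u
  simp only [mem_region] at *
  fin_cases k <;> simp [dir] at * <;> omega

theorem exists_piece_edge (t : Tight A) (T : Thick A) (H : IsHive A h) (k : Fin 6) (u : ℤ × ℤ)
    (h0 : u ∈ region A) (h1 : u + dir (k + 1) ∈ region A) :
    ∃ l, Piece A h l ∧ u ∈ region (supp A h l) ∧ u + dir (k + 1) ∈ region (supp A h l) := by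
  rcases exists_third t T k u h0 h1 with h2 | h2
  · obtain ⟨l, p, e0, e1, e2⟩ := exists_piece (h := h) k u h0 h2 h1
    exact ⟨l, p, (p.mem_supp H T).2 ⟨h0, e0⟩, (p.mem_supp H T).2 ⟨h1, e2⟩⟩
  · obtain ⟨l, p, e0, e1, e2⟩ := exists_piece (h := h) (k + 1) u h0 h1
      (by rwa [add_assoc, show (1 : Fin 6) + 1 = 2 from rfl])
    exact ⟨l, p, (p.mem_supp H T).2 ⟨h0, e0⟩, (p.mem_supp H T).2 ⟨h1, e1⟩⟩

theorem eq_or_adj_of_edge (H : IsHive A h) (T : Thick A) (p : Piece A h l) (p' : Piece A h l')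
    (k : Fin 6) (u : ℤ × ℤ) (h0 : u ∈ region (supp A h l))
    (h1 : u + dir (k + 1) ∈ region (supp A h l)) (h0' : u ∈ region (supp A h l'))
    (h1' : u + dir (k + 1) ∈ region (supp A h l')) :
    l' = l ∨ (Adj A h k l l' ∧ lf k u = supp A h l k) ∨
      (Adj A h (k + 3) l l' ∧ lf (k + 3) u = supp A h l (k + 3)) := by
  obtain ⟨t', T', -⟩ := p'.supp_spec H T
  have m0 := (p.mem_supp H T).1 h0
  have m1 := (p.mem_supp H T).1 h1
  have m0' := (p'.mem_supp H T).1 h0'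
  have m1' := (p'.mem_supp H T).1 h1'
  rcases exists_third t' T' k u h0' h1' with h2 | h2
  · have m2 := (p'.mem_supp H T).1 h2
    rcases eq_or_adj H T p p' k u m0.1 m1.1 m2.1 m0.2 m1.2 m0'.2 m1'.2 m2.2 with e | ⟨e, e2, -⟩
    · exact Or.inl e
    · exact Or.inr (Or.inl ⟨e, e2⟩)
  · have m2 := (p'.mem_supp H T).1 h2
    have e1 : u + dir (k + 1) + dir (k + 3 + 1) = u := by
      rw [add_assoc, add_assoc k, show (3 : Fin 6) + 1 = 4 from rfl, dir_add_opp, add_zero]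
    have e2 : u + dir (k + 1) + dir (k + 3) = u + dir (k + 2) := by
      rw [add_assoc, dir_add_next]
    rcases eq_or_adj H T p p' (k + 3) (u + dir (k + 1)) m1.1 (by rw [e1]; exact m0.1)
      (by rw [e2]; exact m2.1) m1.2 (by rw [e1]; exact m0.2) m1'.2 (by rw [e1]; exact m0'.2)
      (by rw [e2]; exact m2.2) with e | ⟨e, e3, -⟩
    · exact Or.inl e
    · refine Or.inr (Or.inr ⟨e, ?_⟩)
      rw [← e3, lf_add, lf_opp k (dir _), lf_dir_side]
      simp

instance : Fintype (State A h) := Fintype.ofFinite _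

open Classical in
/-- The total weight function of a flow on a piece. -/
def tv (y : State A h → State A h → ℝ) (l : ℤ × ℤ → ℝ) (v : ℤ × ℤ) : ℝ :=
  ∑ a : State A h, ∑ b : State A h,
    if a.1.1 = l then y a b * wt (supp A h l) a.1.2 (b.1.2 + 3) v else 0

open Classical in
/-- The excess of the weights of a flow and its reverse on a piece. -/
def tq (y : State A h → State A h → ℝ) (l : ℤ × ℤ → ℝ) (v : ℤ × ℤ) : ℝ :=
  ∑ a : State A h, ∑ b : State A h,
    if a.1.1 = l then y a b * (wt (supp A h l) a.1.2 (b.1.2 + 3) v +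
      wt (supp A h l) (b.1.2 + 3) a.1.2 v - 1) else 0

open Classical in
/-- The amount of flow entering a piece through a side. -/
def inF (y : State A h → State A h → ℝ) (l : ℤ × ℤ → ℝ) (k : Fin 6) : ℝ :=
  ∑ a : State A h, ∑ b : State A h, if a.1.1 = l ∧ a.1.2 = k then y a b else 0

open Classical in
/-- The amount of flow leaving a piece through a side. -/
def outF (y : State A h → State A h → ℝ) (l : ℤ × ℤ → ℝ) (k : Fin 6) : ℝ :=
  ∑ a : State A h, ∑ b : State A h, if b.1.2 + 3 = k ∧ Adj A h k l b.1.1 then y a b else 0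

/-- The indicator of the points off a side. -/
def offSide (M : Fin 6 → ℤ) (k : Fin 6) (v : ℤ × ℤ) : ℝ := if lf k v = M k then 0 else 1

variable {y : State A h → State A h → ℝ}

theorem eq_of_out (H : IsHive A h) (T : Thick A) {a b : State A h} (ht : Transit a b) {k : Fin 6}
    (h1 : b.1.2 + 3 = k) (h2 : Adj A h k l b.1.1) : a.1.1 = l := by
  have := ht.2
  rw [h1] at this
  exact this.symm.unique H T h2.symm

theorem tv_side (hy : TransitFlow.IsFlow Transit y) (H : IsHive A h) (T : Thick A)
    (p : Piece A h l) (s : Fin 6) : ∃ c, ∀ v ∈ region (supp A h l), lf s v = supp A h l s →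
      tv y l v = inF y l s * offSide (supp A h l) (s + 1) v +
        outF y l s * offSide (supp A h l) (s + 5) v + c := by
  classical
  obtain ⟨t, T', -⟩ := p.supp_spec H T
  refine ⟨∑ a : State A h, ∑ b : State A h, if a.1.1 = l ∧ s ≠ a.1.2 ∧ s ≠ b.1.2 + 3 then
    y a b * (if s - a.1.2 < b.1.2 + 3 - a.1.2 then 0 else 1) else 0, ?_⟩
  intro v hv hs
  simp only [tv, inF, outF, Finset.sum_mul, ← Finset.sum_add_distrib]
  refine Finset.sum_congr rfl fun a _ => Finset.sum_congr rfl fun b _ => ?_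
  by_cases h0 : y a b = 0
  · simp [h0]
  have ht := hy.supp _ _ h0
  by_cases hl : a.1.1 = l
  · have hA := ht.1
    rw [hl] at hA
    rw [wt_side t T' hA s v hv hs]
    have hadj := ht.2
    rw [hl] at hadj
    have hne := hA.ne
    simp only [hl, offSide, true_and, if_true]
    by_cases c1 : s = a.1.2
    · have : ¬ b.1.2 + 3 = s := fun h => hne (c1 ▸ h.symm)
      simp [c1, hne, hne.symm]
    · by_cases c2 : s = b.1.2 + 3
      · simp [c2, hne, hne.symm, hadj]
      · have : ¬ b.1.2 + 3 = s := fun h => c2 h.symm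
        have : ¬ a.1.2 = s := fun h => c1 h.symm
        simp [*]
  · have : ¬ (b.1.2 + 3 = s ∧ Adj A h s l b.1.1) := fun h => hl (eq_of_out H T ht h.1 h.2)
    simp [hl, this]

theorem tq_side (hy : TransitFlow.IsFlow Transit y) (H : IsHive A h) (T : Thick A)
    (p : Piece A h l) (s : Fin 6) (v : ℤ × ℤ) (hv : v ∈ region (supp A h l))
    (hs : lf s v = supp A h l s) :
      tq y l v = (inF y l s + outF y l s) * (offSide (supp A h l) (s + 1) v +
        offSide (supp A h l) (s + 5) v - 1) := by
  classical
  obtain ⟨t, T', -⟩ := p.supp_spec H T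
  simp only [tq, inF, outF, Finset.sum_mul, ← Finset.sum_add_distrib]
  refine Finset.sum_congr rfl fun a _ => Finset.sum_congr rfl fun b _ => ?_
  by_cases h0 : y a b = 0
  · simp [h0]
  have ht := hy.supp _ _ h0
  by_cases hl : a.1.1 = l
  · have hA := ht.1
    rw [hl] at hA
    have hadj := ht.2
    rw [hl] at hadj
    have hne := hA.ne
    simp only [hl, true_and, if_true]
    by_cases c1 : s = a.1.2
    · have : ¬ b.1.2 + 3 = s := fun h => hne (c1 ▸ h.symm)
      rw [wt_side t T' hA s v hv hs, wt_side t T' hA.symm s v hv hs]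
      simp [c1, hne, hne.symm, offSide]
    · by_cases c2 : s = b.1.2 + 3
      · rw [wt_side t T' hA s v hv hs, wt_side t T' hA.symm s v hv hs]
        simp [c2, hne, hne.symm, offSide, hadj]
        left
        ring
      · have h3 := wt_add_wt_swap t T' hA s v hv hs c1 c2
        have : ¬ b.1.2 + 3 = s := fun h => c2 h.symm
        have : ¬ a.1.2 = s := fun h => c1 h.symm
        have h4 : (wt (supp A h l) a.1.2 (b.1.2 + 3) v : ℝ) +
            wt (supp A h l) (b.1.2 + 3) a.1.2 v = 1 := by
          exact_mod_cast h3
        simp [*]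
  · have : ¬ (b.1.2 + 3 = s ∧ Adj A h s l b.1.1) := fun h => hl (eq_of_out H T ht h.1 h.2)
    simp [hl, this]

theorem tq_nonneg (hy : TransitFlow.IsFlow Transit y) (H : IsHive A h) (T : Thick A)
    (p : Piece A h l) (v : ℤ × ℤ) (hv : v ∈ region (supp A h l)) : 0 ≤ tq y l v := by
  classical
  obtain ⟨t, T', -⟩ := p.supp_spec H T
  refine Finset.sum_nonneg fun a _ => Finset.sum_nonneg fun b _ => ?_
  split_ifs with hl
  · by_cases h0 : y a b = 0
    · simp [h0]
    have hA := (hy.supp _ _ h0).1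
    rw [hl] at hA
    have := one_le_wt_add t T' hA v hv
    have h4 : (1 : ℝ) ≤ wt (supp A h l) a.1.2 (b.1.2 + 3) v +
        wt (supp A h l) (b.1.2 + 3) a.1.2 v := by
      exact_mod_cast this
    exact mul_nonneg (hy.nonneg _ _) (by linarith)
  · exact le_rfl

theorem tv_slack (hy : TransitFlow.IsFlow Transit y) (H : IsHive A h) (T : Thick A)
    (p : Piece A h l) (k : Fin 6) (v : ℤ × ℤ) (h1 : v + dir (k + 1) ∈ region (supp A h l))
    (h2 : v + dir (k + 5) ∈ region (supp A h l)) :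
    tv y l (v + dir (k + 1)) + tv y l (v + dir (k + 5)) ≤ tv y l v + tv y l (v + dir k) := by
  classical
  obtain ⟨t, T', -⟩ := p.supp_spec H T
  simp only [tv, ← Finset.sum_add_distrib]
  refine Finset.sum_le_sum fun a _ => Finset.sum_le_sum fun b _ => ?_
  split_ifs with hl
  · by_cases h0 : y a b = 0
    · simp [h0]
    have hA := (hy.supp _ _ h0).1
    rw [hl] at hA
    have h3 := wt_slack t T' hA k v h1 h2
    rw [← mul_add, ← mul_add]
    refine mul_le_mul_of_nonneg_left ?_ (hy.nonneg _ _)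
    exact_mod_cast h3
  · simp

theorem inF_eq_outF (hy : TransitFlow.IsFlow Transit y) (H : IsHive A h) (T : Thick A) {k : Fin 6}
    (a : Adj A h k l l') : inF y l' (k + 3) = outF y l k := by
  classical
  have e1 : inF y l' (k + 3) = ∑ a : State A h,
      if a.1.1 = l' ∧ a.1.2 = k + 3 then ∑ b, y a b else 0 := by
    refine Finset.sum_congr rfl fun a _ => ?_
    split_ifs <;> simp
  have e2 : outF y l k = ∑ b : State A h,
      if b.1.2 + 3 = k ∧ Adj A h k l b.1.1 then ∑ a, y a b else 0 := by
    rw [outF, Finset.sum_comm]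
    refine Finset.sum_congr rfl fun b _ => ?_
    split_ifs <;> simp
  rw [e1, e2]
  refine Finset.sum_congr rfl fun b _ => ?_
  have : (b.1.1 = l' ∧ b.1.2 = k + 3) ↔ (b.1.2 + 3 = k ∧ Adj A h k l b.1.1) := by
    constructor
    · rintro ⟨rfl, h⟩
      exact ⟨by rw [h, add_three_three], a⟩
    · rintro ⟨h1, h2⟩
      exact ⟨h2.unique H T a, by rw [← h1, add_three_three]⟩
  simp only [this, hy.conserve]

theorem inF_eq_zero (hs : IsInt (slope l k)) : inF y l k = 0 := by
  refine Finset.sum_eq_zero fun a _ => Finset.sum_eq_zero fun b _ => ?_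
  rw [if_neg]
  rintro ⟨rfl, rfl⟩
  exact a.2.2.2 hs

theorem outF_eq_zero (hs : IsInt (slope l k)) : outF y l k = 0 := by
  refine Finset.sum_eq_zero fun a _ => Finset.sum_eq_zero fun b _ => ?_
  rw [if_neg]
  rintro ⟨h1, h2⟩
  apply b.2.2.2
  have h3 : b.1.2 = k + 3 := by rw [← h1, add_three_three]
  rw [h3, h2.right.aff.slope_neg, h2.slope_eq]
  exact hs.neg

theorem Adj.offSide_eq (H : IsHive A h) (T : Thick A) {k : Fin 6} (a : Adj A h k l l')
    {v : ℤ × ℤ} (hv : lf k v = supp A h l k) :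
    offSide (supp A h l') (k + 3 + 1) v = offSide (supp A h l) (k + 5) v ∧
      offSide (supp A h l') (k + 3 + 5) v = offSide (supp A h l) (k + 1) v := by
  have hn := a.supp_next H T
  have r1 := lf_rel (k + 5) v
  have r2 := lf_rel (k + 1) v
  have e1 : k + 3 + 1 = k + 4 := by rw [add_assoc]; rfl
  have e2 : k + 3 + 5 = k + 2 := by rw [add_assoc]; rfl
  have e3 : k + 5 + 5 = k + 4 := by rw [add_assoc]; rfl
  have e4 : k + 5 + 1 = k := by rw [add_assoc]; exact add_zero k
  have e5 : k + 1 + 5 = k := by rw [add_assoc]; exact add_zero k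
  have e6 : k + 1 + 1 = k + 2 := by rw [add_assoc]; rfl
  rw [e3, e4] at r1
  rw [e5, e6] at r2
  rw [e1, e2]
  simp only [offSide]
  constructor
  · have : lf (k + 4) v = supp A h l' (k + 4) ↔ lf (k + 5) v = supp A h l (k + 5) := by omega
    simp only [this]
  · have : lf (k + 2) v = supp A h l' (k + 2) ↔ lf (k + 1) v = supp A h l (k + 1) := by omega
    simp only [this]

theorem Adj.lf_opp_eq (H : IsHive A h) (T : Thick A) {k : Fin 6} (a : Adj A h k l l')
    {v : ℤ × ℤ} (hv : lf k v = supp A h l k) : lf (k + 3) v = supp A h l' (k + 3) := by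
  rw [lf_opp, hv, a.supp_opp H T]

theorem Adj.tq_eq (hy : TransitFlow.IsFlow Transit y) (H : IsHive A h) (T : Thick A) {k : Fin 6}
    (a : Adj A h k l l') {v : ℤ × ℤ} (hv : lf k v = supp A h l k)
    (h0 : v ∈ region (supp A h l)) : tq y l' v = tq y l v := by
  have h1 := inF_eq_outF hy H T a
  have h2 := inF_eq_outF hy H T a.symm
  rw [add_three_three] at h2
  obtain ⟨h3, h4⟩ := a.offSide_eq H T hv
  rw [tq_side hy H T a.left k v h0 hv,
    tq_side hy H T a.right (k + 3) v ((a.mem_iff H T v hv).2 h0) (a.lf_opp_eq H T hv),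
    h1, h2, h3, h4]
  ring

theorem Adj.tv_sub_eq (hy : TransitFlow.IsFlow Transit y) (H : IsHive A h) (T : Thick A) {k : Fin 6}
    (a : Adj A h k l l') {v w : ℤ × ℤ} (hv : lf k v = supp A h l k) (hw : lf k w = supp A h l k)
    (h0 : v ∈ region (supp A h l)) (h0' : w ∈ region (supp A h l)) :
    tv y l' v - tv y l' w = tv y l v - tv y l w := by
  have h1 := inF_eq_outF hy H T a
  have h2 := inF_eq_outF hy H T a.symm
  rw [add_three_three] at h2
  obtain ⟨h3, h4⟩ := a.offSide_eq H T hv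
  obtain ⟨h3', h4'⟩ := a.offSide_eq H T hw
  obtain ⟨c, hc⟩ := tv_side hy H T a.left k
  obtain ⟨c', hc'⟩ := tv_side hy H T a.right (k + 3)
  rw [hc v h0 hv, hc w h0' hw, hc' v ((a.mem_iff H T v hv).2 h0) (a.lf_opp_eq H T hv),
    hc' w ((a.mem_iff H T w hw).2 h0') (a.lf_opp_eq H T hw), h1, h2, h3, h4, h3', h4']
  ring

theorem tv_edge (hy : TransitFlow.IsFlow Transit y) (H : IsHive A h) (T : Thick A)
    (p : Piece A h l) (p' : Piece A h l')
    (k : Fin 6) (u : ℤ × ℤ) (h0 : u ∈ region (supp A h l))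
    (h1 : u + dir (k + 1) ∈ region (supp A h l)) (h0' : u ∈ region (supp A h l'))
    (h1' : u + dir (k + 1) ∈ region (supp A h l')) :
    tv y l' (u + dir (k + 1)) - tv y l' u = tv y l (u + dir (k + 1)) - tv y l u ∧
      tq y l' u = tq y l u := by
  rcases eq_or_adj_of_edge H T p p' k u h0 h1 h0' h1' with rfl | ⟨a, ha⟩ | ⟨a, ha⟩
  · exact ⟨rfl, rfl⟩
  · refine ⟨a.tv_sub_eq hy H T ?_ ha h1 h0, a.tq_eq hy H T ha h0⟩
    rw [lf_add, lf_dir_side, ha, add_zero]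
  · refine ⟨a.tv_sub_eq hy H T ?_ ha h1 h0, a.tq_eq hy H T ha h0⟩
    rw [lf_add, lf_opp k (dir _), lf_dir_side, ha, neg_zero, add_zero]

end HexHive

namespace HexHive

variable {A : Fin 6 → ℤ} {h l l' : ℤ × ℤ → ℝ}

open Classical in
/-- A piece containing two given points, if there is one. -/
def pieceAt (A : Fin 6 → ℤ) (h : ℤ × ℤ → ℝ) (u v : ℤ × ℤ) : ℤ × ℤ → ℝ :=
  if H : ∃ l, Piece A h l ∧ u ∈ region (supp A h l) ∧ v ∈ region (supp A h l) then H.choose else h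

theorem pieceAt_spec (t : Tight A) (T : Thick A) (H : IsHive A h) (k : Fin 6) (u : ℤ × ℤ)
    (h0 : u ∈ region A) (h1 : u + dir (k + 1) ∈ region A) :
    Piece A h (pieceAt A h u (u + dir (k + 1))) ∧
      u ∈ region (supp A h (pieceAt A h u (u + dir (k + 1)))) ∧
      u + dir (k + 1) ∈ region (supp A h (pieceAt A h u (u + dir (k + 1)))) := by
  have := exists_piece_edge t T H k u h0 h1
  rw [pieceAt, dif_pos this]
  exact this.choose_spec

/-- The function changes along the edges of every piece as the weight of the flow does. -/
def Follows (y : State A h → State A h → ℝ) (w : ℤ × ℤ → ℝ) : Prop :=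
  ∀ l, Piece A h l → ∀ k u, u ∈ region (supp A h l) → u + dir k ∈ region (supp A h l) →
    w (u + dir k) - w u = tv y l (u + dir k) - tv y l u

theorem add_five_one (k : Fin 6) : k + 5 + 1 = k := by rw [add_assoc]; exact add_zero k

theorem border_const (q : Quad A) (H : IsHive A h) (B : IntBorder A h)
    {k : Fin 6} {u : ℤ × ℤ} (p : Piece A h l)
    (m0 : u ∈ region (supp A h l)) (m1 : u + dir (k + 1) ∈ region (supp A h l))
    (hk : lf k u = A k) : lf k u = supp A h l k ∧ lf k (u + dir (k + 1)) = supp A h l k ∧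
      IsInt (slope l k) := by
  have e : lf k u = supp A h l k := by
    have h1 := m0 k
    have h2 := p.supp_le H q.thick k
    omega
  refine ⟨e, by rw [lf_add, lf_dir_side, e, add_zero], B.isInt_slope H q.thick p m0 m1 hk⟩

theorem exists_follows (q : Quad A) (H : IsHive A h) (B : IntBorder A h)
    {y : State A h → State A h → ℝ} (hy : TransitFlow.IsFlow Transit y) :
    ∃ w, Follows y w ∧ ∀ v ∈ region A, ∀ k, lf k v = A k → w v = 0 := by
  have T := q.thick
  have key : ∀ l, Piece A h l → ∀ k u, u ∈ region (supp A h l) → u + dir k ∈ region (supp A h l) →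
      tv y (pieceAt A h u (u + dir k)) (u + dir k) - tv y (pieceAt A h u (u + dir k)) u =
        tv y l (u + dir k) - tv y l u := by
    intro l p k u h0 h1
    obtain ⟨k, rfl⟩ : ∃ k', k = k' + 1 := ⟨k + 5, (add_five_one k).symm⟩
    obtain ⟨p', h0', h1'⟩ := pieceAt_spec q.tight T H k u ((p.mem_supp H T).1 h0).1
      ((p.mem_supp H T).1 h1).1
    exact (tv_edge hy H T p p' k u h0 h1 h0' h1').1
  refine (exists_potential q
    (fun u v => tv y (pieceAt A h u v) v - tv y (pieceAt A h u v) u) ?_ ?_ ?_).imp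
    fun w hw => ⟨fun l p k u h0 h1 => ?_, hw.2⟩
  rotate_right
  · rw [hw.1 k u ((p.mem_supp H T).1 h0).1 ((p.mem_supp H T).1 h1).1]
    exact key l p k u h0 h1
  · intro k u h0 h1
    obtain ⟨k, rfl⟩ : ∃ k', k = k' + 1 := ⟨k + 5, (add_five_one k).symm⟩
    obtain ⟨l, p, m0, m1⟩ := exists_piece_edge q.tight T H k u h0 h1
    have e : u + dir (k + 1) + dir (k + 4) = u := by rw [add_assoc, dir_add_opp, add_zero]
    have := key l p (k + 4) (u + dir (k + 1)) m1 (by rwa [e])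
    rw [e] at this
    rw [this, key l p (k + 1) u m0 m1]
    ring
  · intro k u h0 h1 hk
    obtain ⟨l, p, m0, m1⟩ := exists_piece_edge q.tight T H k u h0 h1
    obtain ⟨e1, e2, e3⟩ := border_const q H B p m0 m1 hk
    obtain ⟨c, hc⟩ := tv_side hy H T p k
    rw [key l p (k + 1) u m0 m1, hc _ m0 e1, hc _ m1 e2, inF_eq_zero e3, outF_eq_zero e3]
    ring
  · intro k u h0 h1 h2
    obtain ⟨l, p, e0, e1, e2⟩ := exists_piece (h := h) k u h0 h1 h2
    have m0 := (p.mem_supp H T).2 ⟨h0, e0⟩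
    have m1 := (p.mem_supp H T).2 ⟨h1, e1⟩
    have m2 := (p.mem_supp H T).2 ⟨h2, e2⟩
    have e : u + dir k + dir (k + 2) = u + dir (k + 1) := by
      have := dir_add_next (k + 5)
      rw [add_five_one, add_assoc k, add_assoc k] at this
      rw [add_assoc, ← show k + (5 + 2) = k + 1 from rfl, ← this]
      rfl
    have := key l p (k + 2) (u + dir k) m1 (by rwa [e])
    rw [e] at this
    rw [this, key l p k u m0 m1, key l p (k + 1) u m0 m2]
    ring

theorem Follows.slack_nonneg {y : State A h → State A h → ℝ} {w : ℤ × ℤ → ℝ}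
    (hw : Follows y w) (hy : TransitFlow.IsFlow Transit y) (q : Quad A) (H : IsHive A h)
    (k : Fin 6) (v : ℤ × ℤ) (h0 : v ∈ region A) (h1 : v + dir k ∈ region A)
    (h2 : v + dir (k + 1) ∈ region A)
    (h3 : v + dir (k + 5) ∈ region A) (hs : slack h k v = 0) : 0 ≤ slack w k v := by
  have T := q.thick
  obtain ⟨l, p, e0, e1, e2⟩ := exists_piece (h := h) k v h0 h1 h2
  have e3 : h (v + dir (k + 5)) = l (v + dir (k + 5)) := by
    have := p.aff.slack_eq k v
    simp only [slack] at hs this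
    linarith
  have m0 := (p.mem_supp H T).2 ⟨h0, e0⟩
  have m1 := (p.mem_supp H T).2 ⟨h1, e1⟩
  have m2 := (p.mem_supp H T).2 ⟨h2, e2⟩
  have m3 := (p.mem_supp H T).2 ⟨h3, e3⟩
  have := tv_slack hy H T p k v m2 m3
  have f1 := hw l p k v m0 m1
  have f2 := hw l p (k + 1) v m0 m2
  have f3 := hw l p (k + 5) v m0 m3
  simp only [slack]
  linarith

theorem Follows.eq_of_strict {y : State A h → State A h → ℝ} {w : ℤ × ℤ → ℝ}
    (hw : Follows y w) (hy : TransitFlow.IsFlow Transit y) (q : Quad A) (H : IsHive A h)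
    (k : Fin 6) (v : ℤ × ℤ) (h0 : v ∈ region A) (h1 : v + dir (k + 1) ∈ region A)
    (h2 : v + dir (k + 2) ∈ region A)
    (h3 : v + dir k ∈ region A) (hs : 0 < slack h (k + 1) v)
    (hi : IsInt (h (v + dir (k + 1)) - h v)) : w (v + dir (k + 1)) = w v := by
  have T := q.thick
  have d2 : k + 1 + 1 = k + 2 := by rw [add_assoc]; rfl
  have d5 : k + 1 + 5 = k := by rw [add_assoc]; exact add_zero k
  obtain ⟨l, p, e0, e1, e2⟩ := exists_piece (h := h) (k + 1) v h0 h1 (by rwa [d2])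
  obtain ⟨l', p', e0', e1', e2'⟩ := exists_piece (h := h) k v h0 h3 h1
  have m0 := (p.mem_supp H T).2 ⟨h0, e0⟩
  have m1 := (p.mem_supp H T).2 ⟨h1, e1⟩
  rw [hw l p (k + 1) v m0 m1 |> sub_eq_iff_eq_add.1]
  rcases eq_or_adj H T p p' k v h0 h1 h3 e0 e1 e0' e2' e1' with rfl | ⟨a, ha, -⟩
  · exfalso
    have := p.aff.slack_eq (k + 1) v
    rw [slack, d2, d5] at hs this
    rw [d2] at e2
    linarith
  · obtain ⟨c, hc⟩ := tv_side hy H T p k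
    have hI : IsInt (slope l k) := by rwa [p.slope_eq_of_edge H T m0 m1]
    rw [hc _ m0 ha, hc _ m1 (by rw [lf_add, lf_dir_side, ha, add_zero]), inF_eq_zero hI,
      outF_eq_zero hI]
    ring

theorem Follows.inF_eq_zero {y : State A h → State A h → ℝ} {w : ℤ × ℤ → ℝ}
    (hw : Follows y w) (hy : TransitFlow.IsFlow Transit y) (q : Quad A) (H : IsHive A h)
    (h0 : ∀ v ∈ region A, w v = 0) (p : Piece A h l) (k : Fin 6)
    (hk : 0 < side (supp A h l) k) :
    outF y l k = if side (supp A h l) k = 1 then inF y l k else 0 := by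
  have T := q.thick
  have t := (p.supp_spec H T).1
  have m0 := t.corner_mem (k + 5)
  have m1 := t.corner_add_dir k hk
  have f := hw l p (k + 1) _ m0 m1
  rw [h0 _ ((p.mem_supp H T).1 m0).1, h0 _ ((p.mem_supp H T).1 m1).1] at f
  obtain ⟨c, hc⟩ := tv_side hy H T p k
  have c5 : lf (k + 5) (corner (supp A h l) (k + 5)) = supp A h l (k + 5) := lf_corner _ _
  have c0 : lf k (corner (supp A h l) (k + 5)) = supp A h l k := by
    have := lf_corner' (supp A h l) (k + 5)
    rwa [add_five_one] at this
  have c1 := lf_rel k (corner (supp A h l) (k + 5))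
  have d5 : lf (k + 5) (dir (k + 1)) = -1 := by fin_cases k <;> simp [lf, dir]
  have d1 : lf (k + 1) (dir (k + 1)) = 1 := lf_dir_self _
  have d0 := lf_dir_side k
  rw [hc _ m0 c0, hc _ m1 (by rw [lf_add, d0, c0, add_zero])] at f
  have o1 : ¬ lf (k + 1) (corner (supp A h l) (k + 5)) = supp A h l (k + 1) := by
    simp only [side] at hk; omega
  have o2 : ¬ supp A h l (k + 5) + -1 = supp A h l (k + 5) := by omega
  have o3 : lf (k + 1) (corner (supp A h l) (k + 5)) + 1 = supp A h l (k + 1) ↔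
    side (supp A h l) k = 1 := by simp only [side]; omega
  simp only [offSide, lf_add, d5, d1, c5, if_neg o1, if_neg o2, o3, if_true] at f
  split_ifs at f ⊢ <;> linarith

theorem tv_rev {y : State A h → State A h → ℝ} (hy : TransitFlow.IsFlow Transit y) (H : IsHive A h)
    (T : Thick A) {rev : State A h → State A h}
    (hrr : ∀ a, rev (rev a) = a)
    (hr : ∀ a, Adj A h a.1.2 a.1.1 (rev a).1.1 ∧ (rev a).1.2 = a.1.2 + 3) :
    ∃ c : (ℤ × ℤ → ℝ) → ℝ, ∀ l v,
      tv y l v + tv (fun a b => y (rev b) (rev a)) l v = tq y l v + c l := by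
  classical
  have hinv : Function.Involutive rev := hrr
  refine ⟨fun l => ∑ a : State A h, ∑ b, if a.1.1 = l then y a b else 0, fun l v => ?_⟩
  have e : tv (fun a b => y (rev b) (rev a)) l v = ∑ a : State A h, ∑ b : State A h,
      if a.1.1 = l then y a b * wt (supp A h l) (b.1.2 + 3) a.1.2 v else 0 := by
    rw [tv, ← Equiv.sum_comp hinv.toPerm, Finset.sum_comm, ← Equiv.sum_comp hinv.toPerm]
    refine Finset.sum_congr rfl fun a _ => Finset.sum_congr rfl fun b _ => ?_
    simp only [Function.Involutive.coe_toPerm, hrr, (hr _).2, add_three_three]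
    by_cases h0 : y a b = 0
    · simp [h0]
    have h1 := (hy.supp _ _ h0).2.symm
    rw [add_three_three] at h1
    rw [(hr b).1.unique H T h1]
  rw [e, tv, tq]
  simp only [← Finset.sum_add_distrib]
  refine Finset.sum_congr rfl fun a _ => Finset.sum_congr rfl fun b _ => ?_
  split_ifs
  · ring
  · ring

end HexHive

namespace HexHive

variable {A : Fin 6 → ℤ} {h l l' : ℤ × ℤ → ℝ}

theorem rhombus_mem (k : Fin 6) (v : ℤ × ℤ) (h1 : v + dir (k + 1) ∈ region A)
    (h2 : v + dir (k + 5) ∈ region A) : v ∈ region A ∧ v + dir k ∈ region A := by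
  obtain ⟨x, y⟩ := v
  rcases fin6_cases k with rfl | rfl | rfl | rfl | rfl | rfl <;>
    simp only [Fin.reduceAdd, add_dir0, add_dir1, add_dir2, add_dir3, add_dir4, add_dir5,
      mk_mem_region, zero_add] at * <;> omega

/-- A direction in which a hive may be moved. -/
structure Good (A : Fin 6 → ℤ) (h w : ℤ × ℤ → ℝ) : Prop where
  border : ∀ v ∈ region A, ∀ k, lf k v = A k → w v = 0
  slack_nonneg : ∀ k v, v + dir (k + 1) ∈ region A → v + dir (k + 5) ∈ region A →
    slack h k v = 0 → 0 ≤ slack w k v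
  eq_of_strict : ∀ k v, v + dir (k + 1) ∈ region A → v + dir (k + 5) ∈ region A →
    0 < slack h k v → IsInt (h (v + dir k) - h v) → w (v + dir k) = w v

theorem Follows.good {y : State A h → State A h → ℝ} {w : ℤ × ℤ → ℝ}
    (hw : Follows y w) (hb : ∀ v ∈ region A, ∀ k, lf k v = A k → w v = 0)
    (hy : TransitFlow.IsFlow Transit y) (q : Quad A) (H : IsHive A h) : Good A h w := by
  refine ⟨hb, fun k v h1 h2 hs => ?_, fun k v h1 h2 hs hi => ?_⟩
  · obtain ⟨h3, h4⟩ := rhombus_mem k v h1 h2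
    exact hw.slack_nonneg hy q H k v h3 h4 h1 h2 hs
  · obtain ⟨h3, h4⟩ := rhombus_mem k v h1 h2
    obtain ⟨k, rfl⟩ : ∃ k', k = k' + 1 := ⟨k + 5, (add_five_one k).symm⟩
    rw [show k + 1 + 1 = k + 2 by rw [add_assoc]; rfl] at h1
    rw [show k + 1 + 5 = k by rw [add_assoc]; exact add_zero k] at h2
    exact hw.eq_of_strict hy q H k v h3 h4 h1 h2 hs hi

theorem Quad.exists_edge (q : Quad A) (v : ℤ × ℤ) (hv : v ∈ region A) :
    ∃ k, v + dir (k + 1) ∈ region A := by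
  obtain ⟨x, y⟩ := v
  have b := q.bounds
  have hm := q.mem.1 hv
  by_cases hx : 1 ≤ x
  · refine ⟨2, ?_⟩
    rw [show (2 : Fin 6) + 1 = 3 from rfl, add_dir3, q.mem]
    omega
  · by_cases hy : 1 ≤ y
    · refine ⟨3, ?_⟩
      rw [show (3 : Fin 6) + 1 = 4 from rfl, add_dir4, q.mem]
      omega
    · refine ⟨5, ?_⟩
      rw [show (5 : Fin 6) + 1 = 0 from rfl, add_dir0, q.mem]
      omega

theorem exists_perturbation (q : Quad A) (H : IsHive A h) (B : IntBorder A h)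
    [Nonempty (State A h)] : ∃ w w' : ℤ × ℤ → ℝ, Good A h w ∧ Good A h w' ∧
      (∀ v ∈ region A, 0 ≤ w v + w' v) ∧ ∃ v ∈ region A, w v ≠ 0 := by
  classical
  have T := q.thick
  obtain ⟨rev, y, hrr, hr, hy, hy', d, hd⟩ := exists_state_flow H T B
  obtain ⟨w, hw, hb⟩ := exists_follows q H B hy
  obtain ⟨w', hw', hb'⟩ := exists_follows q H B hy'
  obtain ⟨c, hc⟩ := tv_rev hy H T hrr hr
  refine ⟨w, w', hw.good hb hy q H, hw'.good hb' hy' q H, ?_, ?_⟩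
  · have diff : ∀ l, Piece A h l → ∀ k u, u ∈ region (supp A h l) →
        u + dir k ∈ region (supp A h l) →
        w (u + dir k) + w' (u + dir k) - (w u + w' u) = tq y l (u + dir k) - tq y l u := by
      intro l p k u h0 h1
      have e1 := hw l p k u h0 h1
      have e2 := hw' l p k u h0 h1
      have e3 := hc l u
      have e4 := hc l (u + dir k)
      linarith
    have main := edge_induction q (fun u v => ∀ l, Piece A h l → u ∈ region (supp A h l) →
      v ∈ region (supp A h l) → w u + w' u = tq y l u ∧ w v + w' v = tq y l v) ?_ ?_ ?_
    rotate_left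
    · intro u v huv l p h0 h1
      exact (huv l p h1 h0).symm
    · intro k u h0 h1 hk l p m0 m1
      obtain ⟨e1, e2, e3⟩ := border_const q H B p m0 m1 hk
      rw [hb _ h0 k hk, hb' _ h0 k hk, hb _ h1 k, hb' _ h1 k, tq_side hy H T p k _ m0 e1,
        tq_side hy H T p k _ m1 e2, inF_eq_zero e3, outF_eq_zero e3]
      · simp
      · rw [lf_add, lf_dir_side, hk, add_zero]
      · rw [lf_add, lf_dir_side, hk, add_zero]
    · intro k u h0 h1 h2 ih l p m0 m2
      obtain ⟨l0, p0, e0, e1, e2⟩ := exists_piece (h := h) k u h0 h1 h2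
      have n0 := (p0.mem_supp H T).2 ⟨h0, e0⟩
      have n1 := (p0.mem_supp H T).2 ⟨h1, e1⟩
      have n2 := (p0.mem_supp H T).2 ⟨h2, e2⟩
      have s0 := (ih l0 p0 n0 n1).1
      have s1 := (tv_edge hy H T p0 p k u n0 n2 m0 m2).2
      have s2 := diff l p (k + 1) u m0 m2
      constructor <;> linarith
    intro v hv
    obtain ⟨k, hk⟩ := q.exists_edge v hv
    obtain ⟨l, p, m0, m1⟩ := exists_piece_edge q.tight T H k v hv hk
    rw [(main (k + 1) v hv hk l p m0 m1).1]
    exact tq_nonneg hy H T p v m0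
  · by_contra! h0
    have hin : ∀ a : State A h, inF y a.1.1 a.1.2 = ∑ b, y a b := by
      intro a
      rw [inF, Finset.sum_eq_single a]
      · simp
      · intro b _ hb
        refine Finset.sum_eq_zero fun _ _ => if_neg fun hc => hb ?_
        exact Subtype.ext (Prod.ext hc.1 hc.2)
      · simp
    have r := (hr d).1
    have e1 := inF_eq_outF hy H T r
    have e2 := inF_eq_outF hy H T r.symm
    have f1 := hw.inF_eq_zero hy q H h0 d.2.1 d.1.2 d.2.2.1
    have f2 := hw.inF_eq_zero hy q H h0 r.right (d.1.2 + 3) (by rw [r.side_eq H T]; exact d.2.2.1)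
    rw [add_three_three] at e2
    rw [r.side_eq H T] at f2
    have g1 := hin d
    have g2 := hin (rev d)
    rw [(hr d).2] at g2
    apply hd
    rw [← g1, ← g2, e1]
    split_ifs at f1 f2
    · linarith
    · linarith

theorem nonempty_state (q : Quad A) (H : IsHive A h) (B : IntBorder A h)
    (hn : ∃ v ∈ region A, ¬ IsInt (h v)) : Nonempty (State A h) := by
  have T := q.thick
  by_contra he
  have hs : ∀ l, Piece A h l → ∀ k, 0 < side (supp A h l) k → IsInt (slope l k) := by
    intro l p k hk
    by_contra hi
    exact he ⟨⟨(l, k), p, hk, hi⟩⟩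
  have hs2 : ∀ l, Piece A h l → ∀ k, 0 < side (supp A h l) k ∨ 0 < side (supp A h l) (k + 3) →
      IsInt (slope l k) := by
    rintro l p k (hk | hk)
    · exact hs l p k hk
    · have := (hs l p _ hk).neg
      rwa [p.aff.slope_neg, neg_neg] at this
  have hall : ∀ l, Piece A h l → ∀ k, IsInt (slope l k) := by
    intro l p k
    by_cases hk : 0 < side (supp A h l) k ∨ 0 < side (supp A h l) (k + 3)
    · exact hs2 l p k hk
    · have t := (p.supp_spec H T).1
      have T' := (p.supp_spec H T).2.1
      have t0 := t k
      have t1 := t (k + 1)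
      have t2 := t (k + 2)
      have t3 := t (k + 3)
      have t4 := t (k + 4)
      have t5 := t (k + 5)
      have T0 := T' k
      have T1 := T' (k + 1)
      have T2 := T' (k + 2)
      have a1 : 0 < side (supp A h l) (k + 1) ∨ 0 < side (supp A h l) (k + 1 + 3) := by
        simp only [side, add_assoc, Fin.reduceAdd, add_zero] at *
        omega
      have a2 : 0 < side (supp A h l) (k + 5) ∨ 0 < side (supp A h l) (k + 5 + 3) := by
        simp only [side, add_assoc, Fin.reduceAdd, add_zero] at *
        omega
      rw [p.aff.slope_add]
      exact (hs2 l p _ a2).add (hs2 l p _ a1)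
  obtain ⟨⟨x, y⟩, hv, hi⟩ := hn
  apply hi
  lift x to ℕ using (q.mem.1 hv).1
  clear hi
  induction x with
  | zero => exact B _ hv 3 (by simp [lf, q.z3])
  | succ x ih =>
    have m : ((x : ℤ), y) ∈ region A := by rw [q.mem] at *; push_cast at hv; omega
    have e : ((x : ℤ), y) + dir (5 + 1) = (((x + 1 : ℕ) : ℤ), y) := by
      rw [show (5 : Fin 6) + 1 = 0 from rfl, add_dir0]; push_cast; rfl
    obtain ⟨l, p, m0, m1⟩ := exists_piece_edge q.tight T H 5 ((x : ℤ), y) m (by rwa [e])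
    have := p.slope_eq_of_edge H T m0 m1
    rw [e] at this
    have h2 := (hall l p 5).add (ih m)
    rw [this] at h2
    simpa using h2

end HexHive

namespace HexHive

/-- The polytope of hives with fixed border and with given lower bounds for the
increments along some unit edges. -/
def hivePolytope (A : Fin 6 → ℤ) (b : ℤ × ℤ → ℝ) (E : Finset ((ℤ × ℤ) × Fin 6))
    (c : (ℤ × ℤ) × Fin 6 → ℤ) : Set (ℤ × ℤ → ℝ) :=
  {h | (∀ v, v ∉ region A → h v = 0) ∧ (∀ v ∈ region A, ∀ k, lf k v = A k → h v = b v) ∧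
    IsHive A h ∧ ∀ e ∈ E, (c e : ℝ) ≤ h (e.1 + dir e.2) - h e.1}

variable {A : Fin 6 → ℤ} {h w b : ℤ × ℤ → ℝ} {E : Finset ((ℤ × ℤ) × Fin 6)}
  {c : (ℤ × ℤ) × Fin 6 → ℤ}

theorem slack_add_smul (h w : ℤ × ℤ → ℝ) (ε : ℝ) (k : Fin 6) (v : ℤ × ℤ) :
    slack (h + ε • w) k v = slack h k v + ε * slack w k v := by
  simp only [slack, Pi.add_apply, Pi.smul_apply, smul_eq_mul]
  ring

theorem isClosed_hivePolytope : IsClosed (hivePolytope A b E c) := by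
  have e : hivePolytope A b E c =
      (⋂ v, ⋂ (_ : v ∉ region A), {h | h v = 0}) ∩
      ((⋂ v, ⋂ (_ : v ∈ region A), ⋂ k, ⋂ (_ : lf k v = A k), {h | h v = b v}) ∩
      ((⋂ k, ⋂ v, ⋂ (_ : v + dir (k + 1) ∈ region A), ⋂ (_ : v + dir (k + 5) ∈ region A),
        {h | 0 ≤ slack h k v}) ∩
      (⋂ e, ⋂ (_ : e ∈ E), {h | (c e : ℝ) ≤ h (e.1 + dir e.2) - h e.1}))) := by
    ext h
    simp only [Set.mem_inter_iff, Set.mem_iInter, Set.mem_ofPred_eq]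
    rfl
  rw [e]
  refine IsClosed.inter ?_ (IsClosed.inter ?_ (IsClosed.inter ?_ ?_))
  · exact isClosed_iInter fun v => isClosed_iInter fun _ =>
      isClosed_eq (by fun_prop) (by fun_prop)
  · exact isClosed_iInter fun v => isClosed_iInter fun _ => isClosed_iInter fun k =>
      isClosed_iInter fun _ => isClosed_eq (by fun_prop) (by fun_prop)
  · refine isClosed_iInter fun v => isClosed_iInter fun _ => isClosed_iInter fun k =>
      isClosed_iInter fun _ => isClosed_le (by fun_prop) ?_
    unfold slack
    fun_prop
  · exact isClosed_iInter fun e => isClosed_iInter fun _ =>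
      isClosed_le (by fun_prop) (by fun_prop)

theorem isCompact_hivePolytope {R : ℝ}
    (hR : ∀ h ∈ hivePolytope A b E c, ∀ v ∈ region A, |h v| ≤ R) :
    IsCompact (hivePolytope A b E c) := by
  refine (isCompact_univ_pi
    (fun _ : ℤ × ℤ => isCompact_Icc (a := -|R|) (b := |R|))).of_isClosed_subset
    isClosed_hivePolytope fun h hh v _ => ?_
  by_cases hv : v ∈ region A
  · exact abs_le.1 ((hR h hh v hv).trans (le_abs_self R))
  · rw [hh.1 v hv]
    exact ⟨neg_nonpos.2 (abs_nonneg _), abs_nonneg _⟩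

theorem Good.eventually_mem (g : Good A h w) (hw : ∀ v, v ∉ region A → w v = 0)
    (hh : h ∈ hivePolytope A b E c)
    (hE : ∀ e ∈ E, e.1 + dir (e.2 + 1) ∈ region A ∧ e.1 + dir (e.2 + 5) ∈ region A ∧
      0 < slack h e.2 e.1) :
    ∀ᶠ ε in nhdsWithin (0 : ℝ) (Set.Ioi 0), h + ε • w ∈ hivePolytope A b E c := by
  obtain ⟨h1, h2, h3, h4⟩ := hh
  have key : ∀ x y : ℝ, 0 ≤ x → (x = 0 → 0 ≤ y) →
      ∀ᶠ ε in nhdsWithin (0 : ℝ) (Set.Ioi 0), 0 ≤ x + ε * y := by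
    intro x y hx hy
    rcases hx.eq_or_lt with rfl | hx
    · filter_upwards [self_mem_nhdsWithin] with ε hε
      rw [zero_add]
      exact mul_nonneg (le_of_lt hε) (hy rfl)
    · have : Filter.Tendsto (fun ε : ℝ => x + ε * y) (nhds 0) (nhds (x + 0 * y)) :=
        Continuous.tendsto (by fun_prop) 0
      rw [zero_mul, add_zero] at this
      exact ((this.eventually (lt_mem_nhds hx)).mono fun _ => le_of_lt).filter_mono
        nhdsWithin_le_nhds
  have ev1 : ∀ᶠ ε in nhdsWithin (0 : ℝ) (Set.Ioi 0), ∀ v ∈ region A, ∀ k,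
      v + dir (k + 1) ∈ region A → v + dir (k + 5) ∈ region A → 0 ≤ slack (h + ε • w) k v := by
    rw [Filter.eventually_all_finite (finite_region A)]
    intro v _
    rw [Filter.eventually_all]
    intro k
    by_cases q : v + dir (k + 1) ∈ region A ∧ v + dir (k + 5) ∈ region A
    · refine (key _ _ (h3 k v q.1 q.2) (g.slack_nonneg k v q.1 q.2)).mono fun ε hε _ _ => ?_
      rwa [slack_add_smul]
    · exact Filter.Eventually.of_forall fun ε a b => (q ⟨a, b⟩).elim
  have ev2 : ∀ᶠ ε in nhdsWithin (0 : ℝ) (Set.Ioi 0), ∀ e ∈ E,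
      (c e : ℝ) ≤ (h + ε • w) (e.1 + dir e.2) - (h + ε • w) e.1 := by
    rw [Filter.eventually_all_finset]
    intro e he
    obtain ⟨a1, a2, a3⟩ := hE e he
    refine (key (h (e.1 + dir e.2) - h e.1 - c e) (w (e.1 + dir e.2) - w e.1)
      (sub_nonneg.2 (h4 e he)) fun h0 => ?_).mono fun ε hε => ?_
    · rw [g.eq_of_strict e.2 e.1 a1 a2 a3 ⟨c e, sub_eq_zero.1 h0⟩, sub_self]
    · simp only [Pi.add_apply, Pi.smul_apply, smul_eq_mul]
      linarith
  filter_upwards [ev1, ev2] with ε e1 e2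
  refine ⟨fun v hv => ?_, fun v hv k hk => ?_,
    fun k v a1 a2 => e1 v (rhombus_mem k v a1 a2).1 k a1 a2,
    e2⟩
  · simp [h1 v hv, hw v hv]
  · simp [h2 v hv k hk, g.border v hv k hk]

theorem slack_congr {h h' : ℤ × ℤ → ℝ} (e : ∀ v ∈ region A, h v = h' v) {k : Fin 6} {v : ℤ × ℤ}
    (h1 : v + dir (k + 1) ∈ region A) (h2 : v + dir (k + 5) ∈ region A) :
    slack h k v = slack h' k v := by
  obtain ⟨h3, h4⟩ := rhombus_mem k v h1 h2
  simp only [slack, e _ h1, e _ h2, e _ h3, e _ h4]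

theorem Good.congr {w' : ℤ × ℤ → ℝ} (g : Good A h w) (e : ∀ v ∈ region A, w v = w' v) :
    Good A h w' where
  border v hv k hk := by rw [← e v hv, g.border v hv k hk]
  slack_nonneg k v h1 h2 hs := by
    rw [← slack_congr e h1 h2]; exact g.slack_nonneg k v h1 h2 hs
  eq_of_strict k v h1 h2 hs hi := by
    obtain ⟨h3, h4⟩ := rhombus_mem k v h1 h2
    rw [← e _ h3, ← e _ h4]; exact g.eq_of_strict k v h1 h2 hs hi

/-- A nonempty bounded hive polytope with integral border, all of whose edge constraints are
diagonals of strict rhombi, contains an integral hive. -/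
theorem exists_integral_mem (q : Quad A) {R : ℝ}
    (hR : ∀ h ∈ hivePolytope A b E c, ∀ v ∈ region A, |h v| ≤ R)
    (hne : (hivePolytope A b E c).Nonempty)
    (hb : ∀ v ∈ region A, ∀ k, lf k v = A k → IsInt (b v))
    (hE : ∀ h ∈ hivePolytope A b E c, ∀ e ∈ E, e.1 + dir (e.2 + 1) ∈ region A ∧
      e.1 + dir (e.2 + 5) ∈ region A ∧ 0 < slack h e.2 e.1) :
    ∃ h ∈ hivePolytope A b E c, ∀ v ∈ region A, IsInt (h v) := by
  classical
  have hK := isCompact_hivePolytope hR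
  set K := hivePolytope A b E c with hKdef
  let S : (ℤ × ℤ → ℝ) → ℝ := fun h => ∑ v ∈ (finite_region A).toFinset, h v
  have hSc : Continuous S := by unfold S; fun_prop
  have hSadd : ∀ (h w : ℤ × ℤ → ℝ) (ε : ℝ), S (h + ε • w) = S h + ε * S w := by
    intro h w ε
    simp only [S, Pi.add_apply, Pi.smul_apply, smul_eq_mul, Finset.sum_add_distrib, Finset.mul_sum]
  obtain ⟨m, hm, hmax⟩ := hK.exists_isMaxOn hne hSc.continuousOn
  have hFc : IsCompact (K ∩ {h | S h = S m}) := hK.inter_right (isClosed_eq hSc continuous_const)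
  obtain ⟨h, hh⟩ := hFc.extremePoints_nonempty ⟨m, hm, rfl⟩
  obtain ⟨⟨hhK, hhS⟩, hext⟩ := (mem_extremePoints ..).1 hh
  rw [Set.mem_ofPred_eq] at hhS
  refine ⟨h, hhK, ?_⟩
  by_contra h_int
  push Not at h_int
  have B : IntBorder A h := fun v hv k hk => by rw [hhK.2.1 v hv k hk]; exact hb v hv k hk
  have := nonempty_state q hhK.2.2.1 B h_int
  obtain ⟨w₀, w₀', g, g', hs, v, hv, hvw⟩ := exists_perturbation q hhK.2.2.1 B
  have trunc : ∀ w₀ : ℤ × ℤ → ℝ, Good A h w₀ → ∃ w : ℤ × ℤ → ℝ, Good A h w ∧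
      (∀ v ∈ region A, w v = w₀ v) ∧ ∀ v, v ∉ region A → w v = 0 := fun w₀ g =>
    ⟨fun v => if v ∈ region A then w₀ v else 0, g.congr fun v hv => by simp [hv],
      fun v hv => by simp [hv], fun v hv => by simp [hv]⟩
  obtain ⟨w, gw, ew, zw⟩ := trunc w₀ g
  obtain ⟨w', gw', ew', zw'⟩ := trunc w₀' g'
  obtain ⟨ε, ⟨m1, m2⟩, hε⟩ := (((gw.eventually_mem zw hhK (hE h hhK)).and
    (gw'.eventually_mem zw' hhK (hE h hhK))).and self_mem_nhdsWithin).exists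
  have s1 : S (h + ε • w) ≤ S m := hmax m1
  have s2 : S (h + ε • w') ≤ S m := hmax m2
  rw [hSadd, hhS] at s1 s2
  have t1 : S w ≤ 0 := by
    by_contra! hlt
    have := mul_pos hε hlt
    linarith
  have t2 : S w' ≤ 0 := by
    by_contra! hlt
    have := mul_pos hε hlt
    linarith
  have t3 : S w + S w' = ∑ v ∈ (finite_region A).toFinset, (w v + w' v) := by
    simp only [S, Finset.sum_add_distrib]
  have pos : ∀ v ∈ (finite_region A).toFinset, 0 ≤ w v + w' v := fun v hv => by
    rw [Set.Finite.mem_toFinset] at hv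
    rw [ew v hv, ew' v hv]; exact hs v hv
  have t4 := Finset.sum_nonneg pos
  have zero : ∀ v, w v + w' v = 0 := fun v => by
    by_cases hv : v ∈ region A
    · exact (Finset.sum_eq_zero_iff_of_nonneg pos).1 (by linarith) v (by simpa using hv)
    · rw [zw v hv, zw' v hv, add_zero]
  have t5 : S w = 0 := by linarith
  have t6 : S w' = 0 := by linarith
  have f1 : h + ε • w ∈ K ∩ {h | S h = S m} :=
    ⟨m1, by rw [Set.mem_ofPred_eq, hSadd, t5, mul_zero, add_zero, hhS]⟩
  have f2 : h + ε • w' ∈ K ∩ {h | S h = S m} :=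
    ⟨m2, by rw [Set.mem_ofPred_eq, hSadd, t6, mul_zero, add_zero, hhS]⟩
  have seg : h ∈ openSegment ℝ (h + ε • w) (h + ε • w') := by
    refine ⟨1 / 2, 1 / 2, by norm_num, by norm_num, by norm_num, ?_⟩
    funext v
    have := zero v
    simp only [Pi.add_apply, Pi.smul_apply, smul_eq_mul]
    have : w' v = - w v := by linarith
    rw [this]; ring
  have e := congrFun (hext _ f1 _ f2 seg).1 v
  simp only [Pi.add_apply, Pi.smul_apply, smul_eq_mul, add_eq_left, mul_eq_zero] at e
  rcases e with e | e
  · exact hε.ne' e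
  · exact hvw (by rw [← ew v hv, e])

end HexHive

namespace LRRule

/-- The alternant `det (x_j ^ α_i)`. -/
def alternant (n : ℕ) (α : Fin n → ℕ) : MvPolynomial (Fin n) ℤ :=
  Matrix.det (Matrix.of fun i j : Fin n => (X j : MvPolynomial (Fin n) ℤ) ^ α i)

/-- The staircase `δ = (n-1, …, 1, 0)`. -/
def stair (n : ℕ) (i : Fin n) : ℕ := n - 1 - i

theorem vandermondePoly_eq (n : ℕ) : vandermondePoly n = alternant n (stair n) := by
  have := Matrix.det_projVandermonde (fun _ : Fin n => (1 : MvPolynomial (Fin n) ℤ)) X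
  simp only [one_mul] at this
  rw [vandermondePoly, ← this, alternant, ← Matrix.det_transpose]
  congr 1
  ext1 i j
  rw [Matrix.transpose_apply, Matrix.of_apply, Matrix.projVandermonde_apply, one_pow, one_mul,
    Fin.val_rev, stair]
  congr 1
  omega

theorem completeHomog_eq (n k : ℕ) : completeHomog n k =
    PowerSeries.coeff k
      (∏ i : Fin n, PowerSeries.mk fun j => (X i : MvPolynomial (Fin n) ℤ) ^ j) := by
  rw [PowerSeries.coeff_prod, completeHomog]
  simp only [PowerSeries.coeff_mk]
  refine Finset.sum_nbij (fun d => Finsupp.equivFunOnFinite.symm d) ?_ ?_ ?_ ?_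
  · intro d hd
    rw [Finset.Nat.mem_antidiagonalTuple] at hd
    simp [Finset.mem_finsuppAntidiag, hd]
  · exact fun _ _ _ _ h => Finsupp.equivFunOnFinite.symm.injective h
  · intro d hd
    refine ⟨d, ?_, Finsupp.equivFunOnFinite_symm_coe d⟩
    simpa [Finset.Nat.mem_antidiagonalTuple, Finset.mem_finsuppAntidiag] using hd
  · intro d _
    rw [monomial_eq, Finsupp.prod_fintype _ _ (by simp)]
    simp

theorem geom_mul {R : Type*} [CommRing R] (x : R) :
    (PowerSeries.mk fun j => x ^ j) * (1 - PowerSeries.C x * PowerSeries.X) = 1 := by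
  ext k
  rw [mul_sub, mul_one, map_sub, mul_left_comm, PowerSeries.coeff_C_mul]
  cases k with
  | zero => simp
  | succ k => simp [pow_succ', PowerSeries.coeff_succ_mul_X]

/-- The product of `1 - x_i t` over `i ≠ l`. -/
def omitProd (n : ℕ) (l : Fin n) : Polynomial (MvPolynomial (Fin n) ℤ) :=
  ∏ i ∈ Finset.univ.erase l, (1 - Polynomial.C (X i) * Polynomial.X)

theorem natDegree_omitProd (n : ℕ) (l : Fin n) : (omitProd n l).natDegree ≤ n - 1 := by
  refine (Polynomial.natDegree_prod_le _ _).trans ?_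
  refine (Finset.sum_le_card_nsmul _ _ 1 fun i _ => ?_).trans ?_
  · compute_degree
  · simp

theorem prod_geom_mul_omitProd (n : ℕ) (l : Fin n) :
    (∏ i : Fin n, PowerSeries.mk fun j => (X i : MvPolynomial (Fin n) ℤ) ^ j) *
        (omitProd n l : PowerSeries _)
      = PowerSeries.mk fun j => (X l : MvPolynomial (Fin n) ℤ) ^ j := by
  have e : (omitProd n l : PowerSeries _) = ∏ i ∈ Finset.univ.erase l,
      (1 - PowerSeries.C (X i) * PowerSeries.X : PowerSeries (MvPolynomial (Fin n) ℤ)) := by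
    rw [omitProd, ← Polynomial.coeToPowerSeries.ringHom_apply, map_prod]
    simp
  rw [e, ← Finset.mul_prod_erase _ _ (Finset.mem_univ l), mul_assoc, ← Finset.prod_mul_distrib,
    Finset.prod_congr rfl fun i _ => geom_mul _, Finset.prod_const_one, mul_one]

theorem sum_hInt_mul (n : ℕ) (l : Fin n) (a : ℕ) :
    ∑ j : Fin n, hInt n ((a : ℤ) + j - (n - 1 : ℕ)) * (omitProd n l).coeff (n - 1 - j) =
      X l ^ a := by
  have e := congrArg (PowerSeries.coeff a) (prod_geom_mul_omitProd n l)
  rw [PowerSeries.coeff_mk, mul_comm, PowerSeries.coeff_mul,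
    Finset.Nat.sum_antidiagonal_eq_sum_range_succ_mk] at e
  rw [← e]
  simp only [Polynomial.coeff_coe, ← completeHomog_eq]
  have hn : 1 ≤ n := l.pos
  have h1 : ∀ N, n ≤ N → ∑ r ∈ Finset.range N, hInt n ((a : ℤ) - r) * (omitProd n l).coeff r =
      ∑ r ∈ Finset.range n, hInt n ((a : ℤ) - r) * (omitProd n l).coeff r := by
    intro N hN
    refine (Finset.sum_subset (Finset.range_mono hN) fun r _ hr => ?_).symm
    rw [Finset.mem_range, not_lt] at hr
    rw [Polynomial.coeff_eq_zero_of_natDegree_lt, mul_zero]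
    have := natDegree_omitProd n l
    omega
  have h2 : ∀ N, a + 1 ≤ N → ∑ r ∈ Finset.range N, hInt n ((a : ℤ) - r) * (omitProd n l).coeff r =
      ∑ r ∈ Finset.range (a + 1), hInt n ((a : ℤ) - r) * (omitProd n l).coeff r := by
    intro N hN
    refine (Finset.sum_subset (Finset.range_mono hN) fun r _ hr => ?_).symm
    rw [Finset.mem_range, not_lt] at hr
    rw [hInt, if_neg (by omega), zero_mul]
  rw [Fin.sum_univ_eq_sum_range
    (fun j => hInt n ((a : ℤ) + j - (n - 1 : ℕ)) * (omitProd n l).coeff (n - 1 - j)) n,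
    ← Finset.sum_range_reflect]
  trans ∑ r ∈ Finset.range n, hInt n ((a : ℤ) - r) * (omitProd n l).coeff r
  · refine Finset.sum_congr rfl fun r hr => ?_
    rw [Finset.mem_range] at hr
    congr 2
    · omega
    · omega
  · rw [← h1 (n + (a + 1)) (by omega), h2 (n + (a + 1)) (by omega)]
    refine Finset.sum_congr rfl fun r hr => ?_
    rw [Finset.mem_range] at hr
    rw [hInt, if_pos (by omega), mul_comm]
    congr 2
    omega

theorem alternant_eq_schurPoly_mul (n : ℕ) (lam : Fin n → ℕ) :
    alternant n (fun i => lam i + stair n i) = schurPoly n lam *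
      Matrix.det (Matrix.of fun j l : Fin n => (omitProd n l).coeff (n - 1 - j)) := by
  rw [schurPoly, ← Matrix.det_mul, alternant]
  congr 1
  ext1 i l
  simp only [Matrix.mul_apply, Matrix.of_apply]
  rw [← sum_hInt_mul]
  refine Finset.sum_congr rfl fun j _ => ?_
  congr 2
  have := i.isLt
  simp only [stair]
  omega

theorem schurPoly_zero (n : ℕ) : schurPoly n 0 = 1 := by
  rw [schurPoly, Matrix.det_of_isUpperTriangular]
  · refine Finset.prod_eq_one fun i _ => ?_
    have e : completeHomog n 0 = 1 := by simp [completeHomog_eq, map_prod]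
    simp [hInt, e]
  · intro i j h
    have : j < i := h
    simp only [Matrix.of_apply, Pi.zero_apply]
    rw [hInt, if_neg]
    have := Fin.lt_def.1 this
    simp; omega

/-- The bialternant formula. -/
theorem schurPoly_mul_vandermondePoly (n : ℕ) (lam : Fin n → ℕ) :
    schurPoly n lam * vandermondePoly n = alternant n (fun i => lam i + stair n i) := by
  have h0 := alternant_eq_schurPoly_mul n 0
  rw [schurPoly_zero, one_mul] at h0
  rw [alternant_eq_schurPoly_mul, ← h0, vandermondePoly_eq]
  congr 2
  funext i
  simp

end LRRule

namespace LRRule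

/-- Gelfand–Tsetlin patterns with `n` rows and top row `μ`; the `k`-th row has `k` entries,
extended by zeros. -/
structure IsGT (n : ℕ) (μ : ℕ → ℕ) (t : ℕ → ℕ → ℕ) : Prop where
  zero : ∀ k i, k ≤ i → t k i = 0
  big : ∀ k i, n < k → t k i = 0
  top : ∀ i, i < n → t n i = μ i
  le : ∀ k i, k < n → t k i ≤ t (k + 1) i
  ge : ∀ k i, k < n → t (k + 1) (i + 1) ≤ t k i

/-- The largest value at most `J` allowed between the rows `a` above and `b` below. -/
def upperBd (a b : ℕ → ℕ) (J : ℕ) : ℕ → ℕ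
  | 0 => min J (a 0)
  | i + 1 => min J (min (a (i + 1)) (b i))

/-- The toggle of row `k + 1` in the columns up to `J`. -/
def tog (k J : ℕ) (t : ℕ → ℕ → ℕ) (r i : ℕ) : ℕ :=
  if r = k + 1 ∧ t (k + 1) i ≤ J then
    upperBd (t (k + 2)) (t k) J i + max (t (k + 2) (i + 1)) (t k i) - t (k + 1) i
  else t r i

variable {n k J : ℕ} {μ : ℕ → ℕ} {t : ℕ → ℕ → ℕ}

theorem tog_of_ne {r : ℕ} (h : r ≠ k + 1) (i : ℕ) : tog k J t r i = t r i := by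
  simp [tog, h]

theorem tog_of_lt {i : ℕ} (h : J < t (k + 1) i) : tog k J t (k + 1) i = t (k + 1) i := by
  simp [tog, h]

theorem tog_of_le {i : ℕ} (h : t (k + 1) i ≤ J) : tog k J t (k + 1) i =
    upperBd (t (k + 2)) (t k) J i + max (t (k + 2) (i + 1)) (t k i) - t (k + 1) i := by
  simp [tog, h]

theorem IsGT.bounds (G : IsGT n μ t) (hk : k + 2 ≤ n) (i : ℕ) (h : t (k + 1) i ≤ J) :
    max (t (k + 2) (i + 1)) (t k i) ≤ t (k + 1) i ∧
      t (k + 1) i ≤ upperBd (t (k + 2)) (t k) J i := by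
  have h1 : t (k + 2) (i + 1) ≤ t (k + 1) i := G.ge (k + 1) i (by omega)
  have h2 := G.le k i (by omega)
  have h3 : t (k + 1) i ≤ t (k + 2) i := G.le (k + 1) i (by omega)
  refine ⟨max_le h1 h2, ?_⟩
  cases i with
  | zero => exact le_min h h3
  | succ i => exact le_min h (le_min h3 (G.ge k i (by omega)))

theorem upperBd_le (a b : ℕ → ℕ) (J i : ℕ) : upperBd a b J i ≤ J ∧ upperBd a b J i ≤ a i := by
  cases i <;> simp only [upperBd] <;> omega

theorem IsGT.tog_le_iff (G : IsGT n μ t) (hk : k + 2 ≤ n) (i : ℕ) :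
    tog k J t (k + 1) i ≤ J ↔ t (k + 1) i ≤ J := by
  by_cases h : t (k + 1) i ≤ J
  · have := G.bounds hk i h
    have := upperBd_le (t (k + 2)) (t k) J i
    rw [tog_of_le h]
    omega
  · rw [tog_of_lt (by omega)]

theorem IsGT.tog_tog (G : IsGT n μ t) (hk : k + 2 ≤ n) : tog k J (tog k J t) = t := by
  funext r i
  by_cases hr : r = k + 1
  · subst hr
    by_cases h : t (k + 1) i ≤ J
    · have b := G.bounds hk i h
      have e1 : tog k J t (k + 2) = t (k + 2) := funext fun i => tog_of_ne (by omega) i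
      have e2 : tog k J t k = t k := funext fun i => tog_of_ne (by omega) i
      rw [tog_of_le ((G.tog_le_iff hk i).2 h), e1, e2, tog_of_le h]
      omega
    · have e : tog k J t (k + 1) i = t (k + 1) i := tog_of_lt (by omega)
      rw [tog_of_lt (by omega), e]
  · rw [tog_of_ne hr, tog_of_ne hr]

theorem IsGT.toggle (G : IsGT n μ t) (hk : k + 2 ≤ n) : IsGT n μ (tog k J t) where
  zero r i h := by
    by_cases hr : r = k + 1
    · subst hr
      have h0 := G.zero (k + 1) i h
      have b := G.bounds hk i (J := J) (by omega)
      rw [tog_of_le (by omega)]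
      have h1 := G.zero k i (by omega)
      have h2 := G.zero (k + 2) (i + 1) (by omega)
      obtain ⟨i, rfl⟩ : ∃ i', i = i' + 1 := ⟨i - 1, by omega⟩
      have h3 := G.zero k i (by omega)
      simp only [upperBd] at *
      omega
    · rw [tog_of_ne hr, G.zero r i h]
  big r i h := by rw [tog_of_ne (by omega), G.big r i h]
  top i h := by rw [tog_of_ne (by omega), G.top i h]
  le r i h := by
    have g := G.le r i h
    by_cases hr : r = k + 1
    · subst hr
      rw [tog_of_ne (r := k + 1 + 1) (by omega)]
      rw [show k + 1 + 1 = k + 2 from rfl] at g ⊢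
      by_cases h : t (k + 1) i ≤ J
      · have b := G.bounds hk i h
        have := upperBd_le (t (k + 2)) (t k) J i
        rw [tog_of_le h]
        omega
      · rwa [tog_of_lt (by omega)]
    · rw [tog_of_ne hr]
      by_cases hr' : r = k
      · subst hr'
        by_cases h : t (r + 1) i ≤ J
        · have b := G.bounds hk i h
          rw [tog_of_le h]
          omega
        · rwa [tog_of_lt (by omega)]
      · rwa [tog_of_ne (by omega)]
  ge r i h := by
    have g := G.ge r i h
    by_cases hr : r = k + 1
    · subst hr
      rw [tog_of_ne (r := k + 1 + 1) (by omega)]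
      rw [show k + 1 + 1 = k + 2 from rfl] at g ⊢
      by_cases h : t (k + 1) i ≤ J
      · have b := G.bounds hk i h
        rw [tog_of_le h]
        omega
      · rwa [tog_of_lt (by omega)]
    · rw [tog_of_ne hr]
      by_cases hr' : r = k
      · subst hr'
        by_cases h : t (r + 1) (i + 1) ≤ J
        · have b := G.bounds hk (i + 1) h
          rw [tog_of_le h]
          simp only [upperBd] at *
          omega
        · rwa [tog_of_lt (by omega)]
      · rwa [tog_of_ne (by omega)]

theorem IsGT.tog_sub (G : IsGT n μ t) (hk : k + 2 ≤ n) {J' : ℕ} (hJ : J ≤ J') (r i : ℕ) :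
    tog k J t r i - J' = t r i - J' := by
  by_cases hr : r = k + 1
  · subst hr
    by_cases h : t (k + 1) i ≤ J
    · have := (G.tog_le_iff hk i).2 h
      omega
    · rw [tog_of_lt (not_le.1 h)]
  · rw [tog_of_ne hr]

theorem sum_min_add_max (a b m : ℕ → ℕ) (h0 : m 0 = a 0)
    (h : ∀ i, m (i + 1) = min (a (i + 1)) (b i)) (n : ℕ) :
    ∑ i ∈ Finset.range n, (m i + max (a (i + 1)) (b i)) + m n =
      ∑ i ∈ Finset.range n, (a i + b i) + a n := by
  induction n with
  | zero => simp [h0]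
  | succ n ih =>
    rw [Finset.sum_range_succ, Finset.sum_range_succ, h]
    omega

/-- The sum of the `k`-th row. -/
def rowSum (n : ℕ) (t : ℕ → ℕ → ℕ) (k : ℕ) : ℕ := ∑ i ∈ Finset.range n, t k i

/-- The number of boxes of the `k`-th row diagram in columns beyond `J`. -/
def tail (n : ℕ) (t : ℕ → ℕ → ℕ) (k J : ℕ) : ℕ := ∑ i ∈ Finset.range n, (t k i - J)

theorem rowSum_eq_add_tail (n : ℕ) (t : ℕ → ℕ → ℕ) (k J : ℕ) :
    rowSum n t k = ∑ i ∈ Finset.range n, min (t k i) J + tail n t k J := by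
  rw [rowSum, tail, ← Finset.sum_add_distrib]
  exact Finset.sum_congr rfl fun i _ => by omega

theorem tail_zero (n : ℕ) (t : ℕ → ℕ → ℕ) (k : ℕ) : tail n t k 0 = rowSum n t k := rfl

theorem IsGT.tail_tog (G : IsGT n μ t) (hk : k + 2 ≤ n) {J' : ℕ} (hJ : J ≤ J') (r : ℕ) :
    tail n (tog k J t) r J' = tail n t r J' :=
  Finset.sum_congr rfl fun i _ => G.tog_sub hk hJ r i

theorem rowSum_tog_of_ne {r : ℕ} (h : r ≠ k + 1) : rowSum n (tog k J t) r = rowSum n t r :=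
  Finset.sum_congr rfl fun i _ => tog_of_ne h i

theorem IsGT.rowSum_tog (G : IsGT n μ t) (hk : k + 2 ≤ n)
    (hQ : ∀ i, J < t (k + 1) i → J ≤ t k i) :
    rowSum n (tog k J t) (k + 1) + rowSum n t (k + 1) + tail n t k J + tail n t (k + 2) J =
      2 * tail n t (k + 1) J + rowSum n t k + rowSum n t (k + 2) := by
  have key : ∑ i ∈ Finset.range n, min (tog k J t (k + 1) i) J +
      ∑ i ∈ Finset.range n, min (t (k + 1) i) J =
      ∑ i ∈ Finset.range n, min (t k i) J + ∑ i ∈ Finset.range n, min (t (k + 2) i) J := by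
    have e := sum_min_add_max (fun i => min (t (k + 2) i) J) (fun i => min (t k i) J)
      (fun i => upperBd (t (k + 2)) (t k) J i) (by simp only [upperBd]; omega)
      (fun i => by simp only [upperBd]; omega) n
    have z1 : upperBd (t (k + 2)) (t k) J n = 0 := by
      have := G.zero (k + 2) n hk
      have := upperBd_le (t (k + 2)) (t k) J n
      omega
    rw [z1, add_zero, G.zero (k + 2) n hk, Nat.zero_min, add_zero, Finset.sum_add_distrib
      (f := fun i => min (t (k + 2) i) J)] at e
    rw [← Finset.sum_add_distrib,
      add_comm (∑ i ∈ Finset.range n, min (t k i) J)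
        (∑ i ∈ Finset.range n, min (t (k + 2) i) J), ← e]
    refine Finset.sum_congr rfl fun i _ => ?_
    have h1 : t (k + 2) (i + 1) ≤ t (k + 1) i := G.ge (k + 1) i (by omega)
    have h2 := G.le k i (by omega)
    have h3 : t (k + 1) i ≤ t (k + 2) i := G.le (k + 1) i (by omega)
    by_cases h : t (k + 1) i ≤ J
    · have b := G.bounds hk i h
      have b2 := upperBd_le (t (k + 2)) (t k) J i
      rw [tog_of_le h]
      omega
    · have hQ := hQ i (by omega)
      rw [tog_of_lt (by omega)]
      have : upperBd (t (k + 2)) (t k) J i = J := by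
        cases i with
        | zero => simp only [upperBd]; omega
        | succ i =>
          have := G.ge k i (by omega)
          simp only [upperBd]; omega
      omega
  have e1 := rowSum_eq_add_tail n (tog k J t) (k + 1) J
  have e2 := rowSum_eq_add_tail n t (k + 1) J
  have e3 := rowSum_eq_add_tail n t k J
  have e4 := rowSum_eq_add_tail n t (k + 2) J
  rw [G.tail_tog hk le_rfl] at e1
  omega

/-- The lattice condition for `λ` fails at `k` for the columns beyond `J`. -/
def Bad (n : ℕ) (lam : ℕ → ℕ) (t : ℕ → ℕ → ℕ) (k J : ℕ) : Prop :=
  k + 2 ≤ n ∧ lam k + 2 * tail n t (k + 1) J < lam (k + 1) + tail n t k J + tail n t (k + 2) J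

theorem IsGT.bad_tog_iff (G : IsGT n μ t) (hk : k + 2 ≤ n) {lam : ℕ → ℕ} {J' : ℕ} (hJ : J ≤ J')
    (r : ℕ) : Bad n lam (tog k J t) r J' ↔ Bad n lam t r J' := by
  simp only [Bad, G.tail_tog hk hJ]

/-- The place at which a bad pattern is toggled. -/
structure IsSel (n : ℕ) (lam : ℕ → ℕ) (t : ℕ → ℕ → ℕ) (p : ℕ × ℕ) : Prop where
  bad : Bad n lam t p.1 p.2
  max : ∀ k J, p.2 < J → ¬ Bad n lam t k J
  min : ∀ k, k < p.1 → ¬ Bad n lam t k p.2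

theorem IsSel.unique {lam : ℕ → ℕ} {p q : ℕ × ℕ} (h : IsSel n lam t p) (h' : IsSel n lam t q) :
    p = q := by
  have e : p.2 = q.2 := by
    rcases lt_trichotomy p.2 q.2 with hl | hl | hl
    · exact (h.max _ _ hl h'.bad).elim
    · exact hl
    · exact (h'.max _ _ hl h.bad).elim
  refine Prod.ext ?_ e
  rcases lt_trichotomy p.1 q.1 with hl | hl | hl
  · exact (h'.min _ hl (e ▸ h.bad)).elim
  · exact hl
  · exact (h.min _ hl (e ▸ h'.bad)).elim

theorem exists_isSel {lam : ℕ → ℕ} (hlam : ∀ k, k + 1 < n → lam (k + 1) ≤ lam k)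
    (h : ∃ k J, Bad n lam t k J) : ∃ p, IsSel n lam t p := by
  classical
  set B := ∑ k ∈ Finset.range (n + 1), rowSum n t k with hB
  have hle : ∀ k ≤ n, ∀ i < n, t k i ≤ B := fun k hk i hi =>
    (Finset.single_le_sum (f := fun i => t k i) (fun _ _ => Nat.zero_le _)
      (Finset.mem_range.2 hi)).trans
    (Finset.single_le_sum (f := fun k => rowSum n t k) (fun _ _ => Nat.zero_le _)
      (Finset.mem_range.2 (by omega)))
  have ht : ∀ k ≤ n, ∀ J, B ≤ J → tail n t k J = 0 := fun k hk J hJ =>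
    Finset.sum_eq_zero fun i hi => by
      have := hle k hk i (Finset.mem_range.1 hi)
      omega
  have hb : ∀ k J, Bad n lam t k J → J ≤ B := fun k J b => by
    by_contra! hJ
    obtain ⟨b1, b2⟩ := b
    rw [ht _ (by omega) _ hJ.le, ht _ (by omega) _ hJ.le, ht _ (by omega) _ hJ.le] at b2
    have := hlam k (by omega)
    omega
  obtain ⟨k, J, b⟩ := h
  have hs := Nat.findGreatest_spec (P := fun J => ∃ k, Bad n lam t k J) (hb k J b) ⟨k, b⟩
  refine ⟨(Nat.find hs, Nat.findGreatest (fun J => ∃ k, Bad n lam t k J) B), Nat.find_spec hs,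
    fun k' J' hJ b' => ?_, fun k' hk => Nat.find_min hs hk⟩
  exact Nat.findGreatest_is_greatest hJ (hb _ _ b') ⟨k', b'⟩

theorem IsSel.toggle {lam : ℕ → ℕ} {p : ℕ × ℕ} (G : IsGT n μ t) (h : IsSel n lam t p) :
    IsSel n lam (tog p.1 p.2 t) p where
  bad := (G.bad_tog_iff h.bad.1 le_rfl _).2 h.bad
  max k J hJ := by rw [G.bad_tog_iff h.bad.1 hJ.le]; exact h.max k J hJ
  min k hk := by rw [G.bad_tog_iff h.bad.1 le_rfl]; exact h.min k hk

theorem tail_succ (n : ℕ) (t : ℕ → ℕ → ℕ) (k J : ℕ) :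
    tail n t k J = tail n t k (J + 1) + ∑ i ∈ Finset.range n, if J < t k i then 1 else 0 := by
  rw [tail, tail, ← Finset.sum_add_distrib]
  exact Finset.sum_congr rfl fun i _ => by split_ifs <;> omega

theorem IsSel.spec {lam : ℕ → ℕ} (G : IsGT n μ t) (h : IsSel n lam t (k, J)) :
    lam k + 2 * tail n t (k + 1) J + 1 = lam (k + 1) + tail n t k J + tail n t (k + 2) J ∧
      ∀ i, J < t (k + 1) i → J ≤ t k i := by
  obtain ⟨hk, hb⟩ := h.bad
  have hn := h.max k (J + 1) (Nat.lt_succ_self J)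
  simp only [Bad, hk, true_and, not_lt] at hb hn
  rw [tail_succ n t (k + 1) J, tail_succ n t k J, tail_succ n t (k + 2) J] at *
  set c : ℕ → ℕ → ℕ := fun k i => if J < t k i then 1 else 0 with hc
  have h1 : ∑ i ∈ Finset.range n, c (k + 2) i ≤ ∑ i ∈ Finset.range n, c (k + 1) i + 1 := by
    calc ∑ i ∈ Finset.range n, c (k + 2) i ≤ ∑ i ∈ Finset.range (n + 1), c (k + 2) i :=
          Finset.sum_le_sum_of_subset (Finset.range_mono (Nat.le_succ n))
      _ = ∑ i ∈ Finset.range n, c (k + 2) (i + 1) + c (k + 2) 0 := Finset.sum_range_succ' _ _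
      _ ≤ _ := by
        refine add_le_add (Finset.sum_le_sum fun i _ => ?_) ?_
        · have : t (k + 2) (i + 1) ≤ t (k + 1) i := G.ge (k + 1) i (by omega)
          simp only [hc]; split_ifs <;> omega
        · simp only [hc]; split_ifs <;> omega
  have h2 : ∀ i, c k i ≤ c (k + 1) i := fun i => by
    have := G.le k i (by omega)
    simp only [hc]; split_ifs <;> omega
  have h3 : ∑ i ∈ Finset.range n, c k i ≤ ∑ i ∈ Finset.range n, c (k + 1) i :=
    Finset.sum_le_sum fun i _ => h2 i
  simp only [hc] at h1 h2 h3
  refine ⟨by omega, fun i hi => ?_⟩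
  by_contra! hlt
  have hin : i < n := by
    by_contra! hni
    rw [G.zero (k + 1) i (by omega)] at hi
    omega
  have h4 : ∑ i ∈ Finset.range n, c k i < ∑ i ∈ Finset.range n, c (k + 1) i := by
    refine Finset.sum_lt_sum (fun i _ => h2 i) ⟨i, Finset.mem_range.2 hin, ?_⟩
    simp only [hc]; rw [if_neg (by omega), if_pos hi]; exact one_pos
  simp only [hc] at h4
  omega

end LRRule

namespace LRRule

variable {n k J : ℕ} {μ : ℕ → ℕ} {t : ℕ → ℕ → ℕ}

theorem IsGT.le_sum (G : IsGT n μ t) (k i : ℕ) : t k i ≤ ∑ j ∈ Finset.range n, μ j := by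
  by_cases hk : n < k
  · rw [G.big k i hk]; exact Nat.zero_le _
  · have h1 : ∀ d k, k + d = n → t k i ≤ t n i := by
      intro d
      induction d with
      | zero => intro k hk; rw [← hk, add_zero]
      | succ d ih => exact fun k hk => (G.le k i (by omega)).trans (ih (k + 1) (by omega))
    refine (h1 (n - k) k (by omega)).trans ?_
    by_cases hi : i < n
    · rw [G.top i hi]
      exact Finset.single_le_sum (f := μ) (fun _ _ => Nat.zero_le _) (Finset.mem_range.2 hi)
    · rw [G.zero n i (by omega)]; exact Nat.zero_le _

theorem finite_isGT (n : ℕ) (μ : ℕ → ℕ) : {t | IsGT n μ t}.Finite := by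
  set B := ∑ j ∈ Finset.range n, μ j with hB
  refine ((Set.finite_univ (α := Fin (n + 1) → Fin n → Fin (B + 1))).image
    fun c k i => if h : k < n + 1 ∧ i < n then (c ⟨k, h.1⟩ ⟨i, h.2⟩ : ℕ) else 0).subset ?_
  intro t (G : IsGT n μ t)
  refine ⟨fun k i => ⟨t k i, Nat.lt_succ_of_le (G.le_sum k i)⟩, Set.mem_univ _, ?_⟩
  funext k i
  by_cases h : k < n + 1 ∧ i < n
  · simp [h]
  · simp only [h, dite_false]
    by_cases hk : n < k
    · rw [G.big k i hk]
    · rw [G.zero k i (by omega)]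

/-- The finite set of Gelfand–Tsetlin patterns with top row `μ`. -/
def gtFinset (n : ℕ) (μ : ℕ → ℕ) : Finset (ℕ → ℕ → ℕ) := (finite_isGT n μ).toFinset

@[simp] theorem mem_gtFinset : t ∈ gtFinset n μ ↔ IsGT n μ t := by
  rw [gtFinset, Set.Finite.mem_toFinset]; rfl

/-- The weight of a pattern. -/
def wt (n : ℕ) (t : ℕ → ℕ → ℕ) (k : Fin n) : ℕ := rowSum n t (k + 1) - rowSum n t k

theorem IsGT.rowSum_le (G : IsGT n μ t) (hk : k < n) : rowSum n t k ≤ rowSum n t (k + 1) :=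
  Finset.sum_le_sum fun i _ => G.le k i hk

theorem IsGT.wt_toggle (G : IsGT n μ t) {k : ℕ} (hk : k + 1 < n)
    (hs : rowSum n (tog k J t) (k + 1) + rowSum n t (k + 1) = rowSum n t k + rowSum n t (k + 2)) :
    wt n (tog k J t) = wt n t ∘ Equiv.swap ⟨k, by omega⟩ ⟨k + 1, hk⟩ := by
  have g1 := G.rowSum_le (k := k) (by omega)
  have g2 := G.rowSum_le hk
  have g3 := (G.toggle (k := k) (J := J) hk).rowSum_le (k := k) (by omega)
  have g4 := (G.toggle (k := k) (J := J) hk).rowSum_le hk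
  rw [show k + 1 + 1 = k + 2 from rfl] at *
  have e1 : rowSum n (tog k J t) k = rowSum n t k := rowSum_tog_of_ne (by omega)
  have e2 : rowSum n (tog k J t) (k + 2) = rowSum n t (k + 2) := rowSum_tog_of_ne (by omega)
  funext r
  simp only [Function.comp_apply]
  by_cases h1 : r = ⟨k, by omega⟩
  · rw [h1, Equiv.swap_apply_left]
    simp only [wt, show k + 1 + 1 = k + 2 from rfl]
    omega
  · by_cases h2 : r = ⟨k + 1, hk⟩
    · rw [h2, Equiv.swap_apply_right]
      simp only [wt, show k + 1 + 1 = k + 2 from rfl]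
      omega
    · rw [Equiv.swap_apply_of_ne_of_ne h1 h2]
      have h1' : (r : ℕ) ≠ k := fun h => h1 (Fin.ext h)
      have h2' : (r : ℕ) ≠ k + 1 := fun h => h2 (Fin.ext h)
      rw [wt, wt, rowSum_tog_of_ne (by omega), rowSum_tog_of_ne h2']

theorem sum_wt_comp_swap (μ : ℕ → ℕ) (F : (Fin n → ℕ) → ℤ) (hk : k + 1 < n) :
    ∑ t ∈ gtFinset n μ, F (wt n t ∘ Equiv.swap ⟨k, by omega⟩ ⟨k + 1, hk⟩) =
      ∑ t ∈ gtFinset n μ, F (wt n t) := by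
  set B := ∑ j ∈ Finset.range n, μ j with hB
  refine Finset.sum_nbij' (tog k B) (tog k B) ?_ ?_ ?_ ?_ ?_
  · intro t ht; rw [mem_gtFinset] at *; exact ht.toggle hk
  · intro t ht; rw [mem_gtFinset] at *; exact ht.toggle hk
  · intro t ht; rw [mem_gtFinset] at *; exact ht.tog_tog hk
  · intro t ht; rw [mem_gtFinset] at *; exact ht.tog_tog hk
  · intro t ht
    rw [mem_gtFinset] at *
    rw [ht.wt_toggle hk]
    have h0 : ∀ r, tail n t r B = 0 := fun r => Finset.sum_eq_zero fun i _ => by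
      have := ht.le_sum r i
      omega
    have := ht.rowSum_tog (J := B) hk fun i hi => absurd (ht.le_sum (k + 1) i) (by omega)
    simpa [h0] using this

theorem sum_wt_comp_perm (μ : ℕ → ℕ) (σ : Equiv.Perm (Fin n)) (F : (Fin n → ℕ) → ℤ) :
    ∑ t ∈ gtFinset n μ, F (wt n t ∘ σ) = ∑ t ∈ gtFinset n μ, F (wt n t) := by
  cases n with
  | zero => rw [Subsingleton.elim σ 1]; rfl
  | succ m =>
    have hσ : σ ∈ Submonoid.closure
        (Set.range fun i : Fin m => Equiv.swap i.castSucc i.succ) := by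
      rw [Equiv.Perm.mclosure_swap_castSucc_succ]; trivial
    induction hσ using Submonoid.closure_induction generalizing F with
    | mem σ h =>
      obtain ⟨i, rfl⟩ := h
      exact sum_wt_comp_swap μ F (k := i) (by have := i.isLt; omega)
    | one => rfl
    | mul σ τ _ _ h1 h2 =>
      rw [← h2 F, ← h1 fun v => F (v ∘ τ)]
      rfl

/-- The coefficient of `x ^ β` in the alternant with exponents `γ`. -/
def eps (β γ : Fin n → ℕ) : ℤ :=
  ∑ σ : Equiv.Perm (Fin n), (Equiv.Perm.sign σ : ℤ) * if γ ∘ σ = β then 1 else 0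

theorem eps_swap (β γ : Fin n → ℕ) {i j : Fin n} (h : i ≠ j) :
    eps β (γ ∘ Equiv.swap i j) = - eps β γ := by
  rw [eps, eps, ← Equiv.sum_comp (Equiv.mulLeft (Equiv.swap i j)), ← Finset.sum_neg_distrib]
  refine Finset.sum_congr rfl fun σ _ => ?_
  have : (γ ∘ Equiv.swap i j) ∘ (Equiv.swap i j * σ : Equiv.Perm (Fin n)) = γ ∘ σ := by
    funext r; simp
  simp only [Equiv.coe_mulLeft, this, Equiv.Perm.sign_mul, Equiv.Perm.sign_swap h]
  split_ifs <;> simp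

theorem eps_of_strictAnti {β γ : Fin n → ℕ} (hβ : StrictAnti β) (hγ : StrictAnti γ) :
    eps β γ = if γ = β then 1 else 0 := by
  rw [eps, Finset.sum_eq_single 1]
  · simp
  · intro σ _ hσ
    rw [if_neg, mul_zero]
    intro e
    refine hσ (Equiv.ext fun i => ?_)
    have hm : StrictMono σ := fun a b hab => by
      have := hβ hab
      rw [← e] at this
      exact hγ.lt_iff_gt.1 this
    have := (hm.range_inj strictMono_id).1 (by rw [σ.surjective.range_eq, Set.range_id])
    exact congrFun this i
  · simp

theorem alternant_eq_sum (α : Fin n → ℕ) : alternant n α = ∑ σ : Equiv.Perm (Fin n),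
    (Equiv.Perm.sign σ : ℤ) • monomial (Finsupp.equivFunOnFinite.symm (α ∘ σ)) (1 : ℤ) := by
  rw [alternant, Matrix.det_apply]
  refine Finset.sum_congr rfl fun σ _ => ?_
  rw [Units.smul_def]
  congr 1
  rw [monomial_eq, Finsupp.prod_fintype _ _ (by simp)]
  simp

theorem coeff_alternant (β α : Fin n → ℕ) :
    coeff (Finsupp.equivFunOnFinite.symm β) (alternant n α) = eps β α := by
  rw [alternant_eq_sum, coeff_sum, eps]
  refine Finset.sum_congr rfl fun σ _ => ?_
  rw [coeff_smul, coeff_monomial, smul_eq_mul]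
  simp only [EmbeddingLike.apply_eq_iff_eq]

/-- The generating polynomial of Gelfand–Tsetlin patterns. -/
def gtPoly (n : ℕ) (μ : ℕ → ℕ) : MvPolynomial (Fin n) ℤ :=
  ∑ t ∈ gtFinset n μ, monomial (Finsupp.equivFunOnFinite.symm (wt n t)) 1

theorem coeff_gtPoly_mul_alternant (μ : ℕ → ℕ) (β α : Fin n → ℕ) :
    coeff (Finsupp.equivFunOnFinite.symm β) (gtPoly n μ * alternant n α) =
      ∑ t ∈ gtFinset n μ, eps β (fun i => α i + wt n t i) := by
  have e1 : coeff (Finsupp.equivFunOnFinite.symm β) (gtPoly n μ * alternant n α) =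
      ∑ σ : Equiv.Perm (Fin n), ∑ t ∈ gtFinset n μ,
        (Equiv.Perm.sign σ : ℤ) * if wt n t + α ∘ σ = β then 1 else 0 := by
    rw [alternant_eq_sum, gtPoly, Finset.mul_sum, coeff_sum]
    refine Finset.sum_congr rfl fun σ _ => ?_
    rw [Finset.sum_mul, coeff_sum]
    refine Finset.sum_congr rfl fun t _ => ?_
    rw [mul_smul_comm, monomial_mul, one_mul, coeff_smul, coeff_monomial, smul_eq_mul]
    have : Finsupp.equivFunOnFinite.symm (wt n t) + Finsupp.equivFunOnFinite.symm (α ∘ σ) =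
        Finsupp.equivFunOnFinite.symm (wt n t + α ∘ σ) := by ext; simp
    rw [this]
    simp only [EmbeddingLike.apply_eq_iff_eq]
  rw [e1]
  simp only [eps]
  rw [Finset.sum_comm (s := gtFinset n μ)]
  refine Finset.sum_congr rfl fun σ _ => ?_
  rw [← sum_wt_comp_perm μ σ fun v => (Equiv.Perm.sign σ : ℤ) * if v + α ∘ σ = β then 1 else 0]
  refine Finset.sum_congr rfl fun t _ => ?_
  have : wt n t ∘ σ + α ∘ σ = (fun i => α i + wt n t i) ∘ σ := by
    funext i; simp [add_comm]
  rw [this]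

/-- The lattice condition. -/
def IsLattice (n : ℕ) (lam : ℕ → ℕ) (t : ℕ → ℕ → ℕ) : Prop := ∀ k J, ¬ Bad n lam t k J

theorem sum_not_isLattice {lam : ℕ → ℕ} (hlam : ∀ k, k + 1 < n → lam (k + 1) ≤ lam k)
    (μ : ℕ → ℕ) (β : Fin n → ℕ) [DecidablePred (IsLattice n lam)] :
    ∑ t ∈ (gtFinset n μ).filter (fun t => ¬ IsLattice n lam t),
      eps β (fun i => lam i + stair n i + wt n t i) = 0 := by
  have hs : ∀ t ∈ (gtFinset n μ).filter (fun t => ¬ IsLattice n lam t),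
      IsGT n μ t ∧ ∃ p, IsSel n lam t p := fun t ht => by
    rw [Finset.mem_filter, mem_gtFinset] at ht
    refine ⟨ht.1, exists_isSel hlam ?_⟩
    simpa [IsLattice] using ht.2
  have hsel : ∀ t (ht : t ∈ (gtFinset n μ).filter (fun t => ¬ IsLattice n lam t)),
      IsSel n lam t (hs t ht).2.choose := fun t ht => (hs t ht).2.choose_spec
  have hmem : ∀ t (ht : t ∈ (gtFinset n μ).filter (fun t => ¬ IsLattice n lam t)),
      tog (hs t ht).2.choose.1 (hs t ht).2.choose.2 t ∈
        (gtFinset n μ).filter (fun t => ¬ IsLattice n lam t) := fun t ht => by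
    rw [Finset.mem_filter, mem_gtFinset]
    exact ⟨(hs t ht).1.toggle (hsel t ht).bad.1, fun hl =>
      hl _ _ ((hsel t ht).toggle (hs t ht).1).bad⟩
  have hneg : ∀ t (ht : t ∈ (gtFinset n μ).filter (fun t => ¬ IsLattice n lam t)),
      eps β (fun i => lam i + stair n i + wt n t i) + eps β (fun i => lam i + stair n i +
        wt n (tog (hs t ht).2.choose.1 (hs t ht).2.choose.2 t) i) = 0 := by
    intro t ht
    have S := hsel t ht
    have G := (hs t ht).1
    generalize (hs t ht).2.choose = p at S ⊢
    obtain ⟨k, J⟩ := p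
    obtain ⟨s1, s2⟩ := S.spec G
    have hk : k + 1 < n := S.bad.1
    have hsum := G.rowSum_tog hk s2
    have g1 := G.rowSum_le (k := k) (by omega)
    have g2 := G.rowSum_le hk
    have g3 := (G.toggle (k := k) (J := J) hk).rowSum_le (k := k) (by omega)
    have g4 := (G.toggle (k := k) (J := J) hk).rowSum_le hk
    have e1 : rowSum n (tog k J t) k = rowSum n t k := rowSum_tog_of_ne (by omega)
    have e2 : rowSum n (tog k J t) (k + 2) = rowSum n t (k + 2) := rowSum_tog_of_ne (by omega)
    rw [show k + 1 + 1 = k + 2 from rfl] at *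
    have e : (fun i : Fin n => lam i + stair n i + wt n (tog k J t) i) =
        (fun i : Fin n => lam i + stair n i + wt n t i) ∘
          Equiv.swap ⟨k, by omega⟩ ⟨k + 1, hk⟩ := by
      funext r
      simp only [Function.comp_apply]
      by_cases h1 : r = ⟨k, by omega⟩
      · rw [h1, Equiv.swap_apply_left]
        simp only [wt, stair, show k + 1 + 1 = k + 2 from rfl]
        omega
      · by_cases h2 : r = ⟨k + 1, hk⟩
        · rw [h2, Equiv.swap_apply_right]
          simp only [wt, stair, show k + 1 + 1 = k + 2 from rfl]
          omega
        · rw [Equiv.swap_apply_of_ne_of_ne h1 h2]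
          have h1' : (r : ℕ) ≠ k := fun h => h1 (Fin.ext h)
          have h2' : (r : ℕ) ≠ k + 1 := fun h => h2 (Fin.ext h)
          rw [wt, wt, rowSum_tog_of_ne (by omega), rowSum_tog_of_ne h2']
    simp only
    rw [e, eps_swap _ _ (by simp), add_neg_cancel]
  refine Finset.sum_involution (fun t ht => tog (hs t ht).2.choose.1 (hs t ht).2.choose.2 t)
    hneg ?_ hmem ?_
  · intro t ht hne heq
    have := hneg t ht
    rw [heq] at this
    omega
  · intro t ht
    have e := (hsel _ (hmem t ht)).unique ((hsel t ht).toggle (hs t ht).1)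
    rw [e]
    exact (hs t ht).1.tog_tog (hsel t ht).bad.1

theorem IsLattice.strictAnti {lam : ℕ → ℕ} (h : IsLattice n lam t) (G : IsGT n μ t) :
    StrictAnti fun i : Fin n => lam i + stair n i + wt n t i := by
  cases n with
  | zero => exact fun i => i.elim0
  | succ m =>
    rw [Fin.strictAnti_iff_succ_lt]
    intro i
    have hi := i.isLt
    have := h i 0
    simp only [Bad, not_and, not_lt, tail_zero] at this
    have := this (by omega)
    have g1 := G.rowSum_le (k := i) (by omega)
    have g2 := G.rowSum_le (k := i + 1) (by omega)
    simp only [stair, wt, Fin.val_succ, Fin.val_castSucc]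
    rw [show (i : ℕ) + 1 + 1 = i + 2 from rfl] at *
    omega

theorem coeff_gtPoly_mul_alternant_stair {lam : ℕ → ℕ}
    (hlam : ∀ k, k + 1 < n → lam (k + 1) ≤ lam k) (μ : ℕ → ℕ) (β : Fin n → ℕ)
    [DecidablePred (IsLattice n lam)] :
    coeff (Finsupp.equivFunOnFinite.symm β) (gtPoly n μ * alternant n fun i => lam i + stair n i) =
      ∑ t ∈ (gtFinset n μ).filter (IsLattice n lam),
        eps β (fun i => lam i + stair n i + wt n t i) := by
  rw [coeff_gtPoly_mul_alternant, ← Finset.sum_filter_add_sum_filter_not _ (IsLattice n lam),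
    sum_not_isLattice hlam, add_zero]

end LRRule

namespace LRRule

variable {n k J : ℕ} {μ : ℕ → ℕ} {t : ℕ → ℕ → ℕ}

theorem IsGT.antitone (G : IsGT n μ t) (r : ℕ) : Antitone (t r) := by
  refine antitone_nat_of_succ_le fun i => ?_
  cases r with
  | zero => rw [G.zero 0 (i + 1) (Nat.zero_le _)]; exact Nat.zero_le _
  | succ r =>
    by_cases hr : r < n
    · exact (G.ge r i hr).trans (G.le r i hr)
    · rw [G.big (r + 1) (i + 1) (by omega)]; exact Nat.zero_le _

theorem sum_le_tail_add (t : ℕ → ℕ → ℕ) (k J : ℕ) {m : ℕ} (hm : m ≤ n) :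
    ∑ i ∈ Finset.range m, t k i ≤ tail n t k J + m * J := by
  have h1 : ∑ i ∈ Finset.range m, (t k i - J) ≤ tail n t k J :=
    Finset.sum_le_sum_of_subset (Finset.range_mono hm)
  have h2 : ∑ i ∈ Finset.range m, t k i ≤ ∑ i ∈ Finset.range m, ((t k i - J) + J) :=
    Finset.sum_le_sum fun i _ => by omega
  rw [Finset.sum_add_distrib, Finset.sum_const, Finset.card_range, smul_eq_mul] at h2
  omega

theorem tail_add_eq_sum {m : ℕ} (hm : m ≤ n) (h1 : ∀ i, i < m → J ≤ t k i)
    (h2 : ∀ i, m ≤ i → t k i ≤ J) :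
    tail n t k J + m * J = ∑ i ∈ Finset.range m, t k i := by
  have e1 : tail n t k J = ∑ i ∈ Finset.range m, (t k i - J) := by
    refine (Finset.sum_subset (Finset.range_mono hm) fun i _ hi => ?_).symm
    have := h2 i (by simpa using hi)
    omega
  have e2 : ∑ i ∈ Finset.range m, t k i = ∑ i ∈ Finset.range m, ((t k i - J) + J) :=
    Finset.sum_congr rfl fun i hi => by
      have := h1 i (by simpa using hi)
      omega
  rw [e2, e1, Finset.sum_add_distrib, Finset.sum_const, Finset.card_range, smul_eq_mul]

/-- The lattice condition as finitely many linear inequalities. -/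
def IsHiveLattice (n : ℕ) (lam : ℕ → ℕ) (t : ℕ → ℕ → ℕ) : Prop :=
  ∀ k i, k + 2 ≤ n → i ≤ k →
    lam (k + 1) + ∑ j ∈ Finset.range i, t k j + ∑ j ∈ Finset.range (i + 1), t (k + 2) j ≤
      lam k + ∑ j ∈ Finset.range i, t (k + 1) j + ∑ j ∈ Finset.range (i + 1), t (k + 1) j

theorem IsGT.isLattice_iff (G : IsGT n μ t) {lam : ℕ → ℕ} :
    IsLattice n lam t ↔ IsHiveLattice n lam t := by
  constructor
  · intro h k i hk hi
    have hb := h k (t (k + 1) i)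
    simp only [Bad, hk, true_and, not_lt] at hb
    set J := t (k + 1) i with hJ
    have b1 := sum_le_tail_add (n := n) t k J (m := i) (by omega)
    have b2 := sum_le_tail_add (n := n) t (k + 2) J (m := i + 1) (by omega)
    have b3 := tail_add_eq_sum (n := n) (t := t) (k := k + 1) (J := J) (m := i) (by omega)
      (fun j hj => G.antitone (k + 1) hj.le) (fun j hj => G.antitone (k + 1) hj)
    rw [add_mul, one_mul] at b2
    rw [Finset.sum_range_succ (fun j => t (k + 1) j)]
    omega
  · rintro h k J ⟨hk, hb⟩
    have hex : ∃ i, t (k + 1) i ≤ J := ⟨k + 1, by rw [G.zero _ _ le_rfl]; exact Nat.zero_le _⟩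
    obtain ⟨i, hi, hmin⟩ : ∃ i, t (k + 1) i ≤ J ∧ ∀ j, j < i → J < t (k + 1) j :=
      ⟨Nat.find hex, Nat.find_spec hex, fun j hj => not_le.1 (Nat.find_min hex hj)⟩
    have hik : i ≤ k + 1 := by
      by_contra! hlt
      have := hmin (k + 1) hlt
      rw [G.zero _ _ le_rfl] at this
      omega
    have le1 : ∀ j, t k j ≤ t (k + 1) j := fun j => G.le k j (by omega)
    have le2 : ∀ j, t (k + 1) j ≤ t (k + 2) j := fun j => G.le (k + 1) j (by omega)
    have ge1 : ∀ j, t (k + 1) (j + 1) ≤ t k j := fun j => G.ge k j (by omega)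
    have ge2 : ∀ j, t (k + 2) (j + 1) ≤ t (k + 1) j := fun j => G.ge (k + 1) j (by omega)
    have a1 := tail_add_eq_sum (n := n) (t := t) (k := k + 1) (J := J) (m := i) (by omega)
      (fun j hj => (hmin j hj).le) (fun j hj => (G.antitone (k + 1) hj).trans hi)
    have a2 : tail n t (k + 2) J + i * J = ∑ j ∈ Finset.range i, t (k + 2) j +
        (t (k + 2) i - J) := by
      by_cases hJ : J ≤ t (k + 2) i
      · have := tail_add_eq_sum (n := n) (t := t) (k := k + 2) (J := J) (m := i + 1) (by omega)
          (fun j hj => by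
            rcases Nat.lt_succ_iff_lt_or_eq.1 hj with hj | rfl
            · exact (hmin j hj).le.trans (le2 j)
            · exact hJ)
          (fun j hj => (G.antitone (k + 2) hj).trans ((ge2 i).trans hi))
        rw [add_mul, one_mul, Finset.sum_range_succ] at this
        omega
      · have := tail_add_eq_sum (n := n) (t := t) (k := k + 2) (J := J) (m := i) (by omega)
          (fun j hj => (hmin j hj).le.trans (le2 j))
          (fun j hj => (G.antitone (k + 2) hj).trans (by omega))
        omega
    by_cases hc : 1 ≤ i ∧ t k (i - 1) ≤ J
    · obtain ⟨i, rfl⟩ : ∃ i', i = i' + 1 := ⟨i - 1, by omega⟩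
      rw [add_tsub_cancel_right] at hc
      have a3 := tail_add_eq_sum (n := n) (t := t) (k := k) (J := J) (m := i) (by omega)
        (fun j hj => (hmin (j + 1) (by omega)).le.trans (ge1 j))
        (fun j hj => (G.antitone k hj).trans hc.2)
      have g := h k i hk (by omega)
      rw [Finset.sum_range_succ (fun j => t (k + 1) j)] at g a1
      rw [add_mul, one_mul] at a1 a2
      have := hmin i (Nat.lt_succ_self i)
      have := ge2 i
      omega
    · have hi' : i ≤ k := by
        by_contra! hlt
        obtain rfl : i = k + 1 := by omega
        rw [add_tsub_cancel_right, G.zero k k le_rfl] at hc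
        omega
      have a3 := tail_add_eq_sum (n := n) (t := t) (k := k) (J := J) (m := i) (by omega)
        (fun j hj => by
          have := G.antitone k (show j ≤ i - 1 by omega)
          omega)
        (fun j hj => (G.antitone k hj).trans ((le1 i).trans hi))
      have g := h k i hk hi'
      rw [Finset.sum_range_succ (fun j => t (k + 1) j),
        Finset.sum_range_succ (fun j => t (k + 2) j)] at g
      have := le2 i
      omega

/-- The pattern all of whose rows are initial segments of `μ`. -/
def constGT (n : ℕ) (μ : ℕ → ℕ) (k i : ℕ) : ℕ := if i < k ∧ k ≤ n then μ i else 0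

theorem constGT_isGT (hμ : ∀ k, k + 1 < n → μ (k + 1) ≤ μ k) : IsGT n μ (constGT n μ) where
  zero k i h := by rw [constGT, if_neg (by omega)]
  big k i h := by rw [constGT, if_neg (by omega)]
  top i h := by rw [constGT, if_pos (by omega)]
  le k i h := by
    rw [constGT, constGT]
    split_ifs <;> omega
  ge k i h := by
    rw [constGT, constGT]
    by_cases hi : i < k
    · rw [if_pos (by omega), if_pos (by omega)]; exact hμ i (by omega)
    · rw [if_neg (by omega)]; exact Nat.zero_le _

theorem isHiveLattice_constGT : IsHiveLattice n 0 (constGT n μ) := by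
  intro k i hk hi
  have e1 : ∀ r j, j < r → r ≤ n → constGT n μ r j = μ j := fun r j h h' => by
    rw [constGT, if_pos ⟨h, h'⟩]
  have e2 : ∀ r m, m ≤ r → r ≤ n → ∑ j ∈ Finset.range m, constGT n μ r j =
      ∑ j ∈ Finset.range m, μ j := fun r m h h' =>
    Finset.sum_congr rfl fun j hj => e1 r j (by have := Finset.mem_range.1 hj; omega) h'
  rw [e2 k i hi (by omega), e2 (k + 2) (i + 1) (by omega) hk, e2 (k + 1) i (by omega) (by omega),
    e2 (k + 1) (i + 1) (by omega) (by omega)]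
  simp

theorem IsGT.eq_constGT (G : IsGT n μ t) (h : IsHiveLattice n 0 t) : t = constGT n μ := by
  have step : ∀ i k, i ≤ k → k + 2 ≤ n → t (k + 1) i = t (k + 2) i := by
    intro i
    induction i using Nat.strong_induction_on with
    | _ i ih =>
      intro k hik hk
      have e2 : ∑ j ∈ Finset.range i, t (k + 1) j = ∑ j ∈ Finset.range i, t (k + 2) j :=
        Finset.sum_congr rfl fun j hj => by
          have := Finset.mem_range.1 hj
          exact ih j this k (by omega) hk
      have e1 : ∑ j ∈ Finset.range i, t k j = ∑ j ∈ Finset.range i, t (k + 1) j :=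
        Finset.sum_congr rfl fun j hj => by
          have := Finset.mem_range.1 hj
          obtain ⟨k, rfl⟩ : ∃ k', k = k' + 1 := ⟨k - 1, by omega⟩
          exact ih j this k (by omega) (by omega)
      have g := h k i hk hik
      rw [Finset.sum_range_succ, Finset.sum_range_succ] at g
      have : t (k + 1) i ≤ t (k + 2) i := G.le (k + 1) i (by omega)
      simp only [Pi.zero_apply] at g
      omega
  have main : ∀ d k i, k + d = n → i < k → t k i = μ i := by
    intro d
    induction d with
    | zero =>
      intro k i hk hi
      rw [add_zero] at hk
      rw [hk, G.top i (by omega)]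
    | succ d ih =>
      intro k i hk hi
      obtain ⟨k, rfl⟩ : ∃ k', k = k' + 1 := ⟨k - 1, by omega⟩
      rw [step i k (by omega) (by omega)]
      exact ih (k + 2) i (by omega) (by omega)
  funext k i
  rw [constGT]
  split_ifs with hc
  · exact main (n - k) k i (by omega) hc.1
  · by_cases hk : n < k
    · exact G.big k i hk
    · exact G.zero k i (by omega)

theorem wt_constGT (i : Fin n) : wt n (constGT n μ) i = μ i := by
  have hi := i.isLt
  have : rowSum n (constGT n μ) (i + 1) = rowSum n (constGT n μ) i + μ i := by
    have : ∀ j, constGT n μ (i + 1) j = constGT n μ i j + if j = i then μ i else 0 := by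
      intro j
      rw [constGT, constGT]
      rcases lt_trichotomy j i with h | h | h
      · rw [if_pos (by omega), if_pos (by omega), if_neg (by omega), add_zero]
      · rw [if_pos (by omega), if_neg (by omega), if_pos h, zero_add, h]
      · rw [if_neg (by omega), if_neg (by omega), if_neg (by omega)]
    rw [rowSum, Finset.sum_congr rfl fun j _ => this j, Finset.sum_add_distrib,
      Finset.sum_ite_eq', if_pos (Finset.mem_range.2 hi), rowSum]
  rw [wt, this, add_tsub_cancel_left]

theorem gtPoly_mul_alternant_stair (hμ : ∀ k, k + 1 < n → μ (k + 1) ≤ μ k) :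
    gtPoly n μ * alternant n (stair n) = alternant n fun i => μ i + stair n i := by
  classical
  ext d
  obtain ⟨β, rfl⟩ := Finsupp.equivFunOnFinite.symm.surjective d
  have e := coeff_gtPoly_mul_alternant_stair (n := n) (lam := 0) (fun _ _ => le_rfl) μ β
  simp only [Pi.zero_apply, zero_add] at e
  have hf : (gtFinset n μ).filter (IsLattice n 0) = {constGT n μ} := by
    ext t
    rw [Finset.mem_filter, mem_gtFinset, Finset.mem_singleton]
    constructor
    · rintro ⟨G, h⟩
      exact G.eq_constGT (G.isLattice_iff.1 h)
    · rintro rfl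
      exact ⟨constGT_isGT hμ, (constGT_isGT hμ).isLattice_iff.2 isHiveLattice_constGT⟩
  rw [hf, Finset.sum_singleton] at e
  refine e.trans ?_
  rw [coeff_alternant]
  congr 1
  funext i
  rw [wt_constGT, add_comm]

theorem vandermondePoly_ne_zero (n : ℕ) : vandermondePoly n ≠ 0 := by
  rw [vandermondePoly, Finset.prod_ne_zero_iff]
  intro i _
  rw [Finset.prod_ne_zero_iff]
  intro j hj
  rw [sub_ne_zero]
  exact fun h => (Finset.mem_Ioi.1 hj).ne (X_injective h)

/-- Extension of a finite sequence by zeros. -/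
def ext (f : Fin n → ℕ) (k : ℕ) : ℕ := if h : k < n then f ⟨k, h⟩ else 0

@[simp] theorem ext_val (f : Fin n → ℕ) (i : Fin n) : ext f i = f i := by simp [ext]

theorem ext_succ_le {f : Fin n → ℕ} (hf : Antitone f) (k : ℕ) (hk : k + 1 < n) :
    ext f (k + 1) ≤ ext f k := by
  rw [ext, ext, dif_pos hk, dif_pos (by omega)]
  exact hf (by simp)

theorem schurPoly_eq_gtPoly {mu : Fin n → ℕ} (hmu : Antitone mu) :
    schurPoly n mu = gtPoly n (ext mu) := by
  refine mul_right_cancel₀ (vandermondePoly_ne_zero n) ?_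
  rw [schurPoly_mul_vandermondePoly, vandermondePoly_eq,
    gtPoly_mul_alternant_stair (ext_succ_le hmu)]
  simp only [ext_val]

theorem lrCoeff_eq_sum {lam mu nu : Fin n → ℕ} (hlam : Antitone lam) (hmu : Antitone mu)
    (hnu : Antitone nu) [DecidablePred (IsLattice n (ext lam))] :
    lrCoeff n lam mu nu = ∑ t ∈ (gtFinset n (ext mu)).filter (IsLattice n (ext lam)),
      if ∀ i, lam i + wt n t i = nu i then 1 else 0 := by
  have e := coeff_gtPoly_mul_alternant_stair (ext_succ_le hlam) (ext mu)
    (fun i => nu i + stair n i)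
  have e2 : schurPoly n lam * schurPoly n mu * vandermondePoly n =
      gtPoly n (ext mu) * alternant n fun i => ext lam i + stair n i := by
    rw [mul_right_comm, schurPoly_mul_vandermondePoly, schurPoly_eq_gtPoly hmu, mul_comm]
    simp only [ext_val]
  rw [lrCoeff, e2]
  refine e.trans (Finset.sum_congr rfl fun t ht => ?_)
  rw [Finset.mem_filter, mem_gtFinset] at ht
  have hanti : StrictAnti fun i => nu i + stair n i := fun i j hij => by
    have h1 := hnu hij.le
    have h2 := Fin.lt_def.1 hij
    have h3 := j.isLt
    simp only [stair]
    omega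
  rw [eps_of_strictAnti hanti (ht.2.strictAnti ht.1)]
  simp only [funext_iff, ext_val]
  refine if_congr (forall_congr' fun i => ?_) rfl rfl
  omega

theorem lrCoeff_nonneg {lam mu nu : Fin n → ℕ} (hlam : Antitone lam) (hmu : Antitone mu)
    (hnu : Antitone nu) : 0 ≤ lrCoeff n lam mu nu := by
  classical
  rw [lrCoeff_eq_sum hlam hmu hnu]
  exact Finset.sum_nonneg fun t _ => by split_ifs <;> simp

/-- The Littlewood–Richardson rule. -/
theorem lrCoeff_ne_zero_iff {lam mu nu : Fin n → ℕ} (hlam : Antitone lam) (hmu : Antitone mu)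
    (hnu : Antitone nu) : lrCoeff n lam mu nu ≠ 0 ↔ ∃ t, IsGT n (ext mu) t ∧
      IsHiveLattice n (ext lam) t ∧ ∀ i, lam i + wt n t i = nu i := by
  classical
  rw [lrCoeff_eq_sum hlam hmu hnu, Ne, Finset.sum_eq_zero_iff_of_nonneg
    (fun t _ => by split_ifs <;> simp)]
  push Not
  constructor
  · rintro ⟨t, ht, h⟩
    rw [Finset.mem_filter, mem_gtFinset] at ht
    exact ⟨t, ht.1, ht.1.isLattice_iff.1 ht.2, by simpa using h⟩
  · rintro ⟨t, G, h, hw⟩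
    refine ⟨t, ?_, by simpa using hw⟩
    rw [Finset.mem_filter, mem_gtFinset]
    exact ⟨G, G.isLattice_iff.2 h⟩

end LRRule

namespace LRRule

variable {n : ℕ}

/-- The rhombus inequalities on the triangle `0 ≤ i ≤ k ≤ n`. -/
structure IsTile (n : ℕ) (g : ℤ → ℤ → ℝ) : Prop where
  rh1 : ∀ k i : ℤ, 0 ≤ i → i + 1 ≤ k → k + 1 ≤ n →
    g (k + 1) i + g k (i + 1) ≤ g (k + 1) (i + 1) + g k i
  rh2 : ∀ k i : ℤ, 0 ≤ i → i + 1 ≤ k → k + 1 ≤ n →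
    g k i + g (k + 1) (i + 2) ≤ g k (i + 1) + g (k + 1) (i + 1)
  rh3 : ∀ k i : ℤ, 0 ≤ i → i ≤ k → k + 2 ≤ n →
    g k i + g (k + 2) (i + 1) ≤ g (k + 1) i + g (k + 1) (i + 1)

/-- Partial sums of a partition. -/
def psum (f : Fin n → ℕ) (k : ℤ) : ℤ := ∑ j ∈ Finset.range k.toNat, (ext f j : ℤ)

theorem psum_zero (f : Fin n → ℕ) : psum f 0 = 0 := by simp [psum]

theorem psum_succ (f : Fin n → ℕ) {k : ℤ} (hk : 0 ≤ k) :
    psum f (k + 1) = psum f k + ext f k.toNat := by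
  rw [psum, psum, show (k + 1).toNat = k.toNat + 1 by omega, Finset.sum_range_succ]

theorem psum_smul (r : ℕ) (f : Fin n → ℕ) (k : ℤ) : psum (fun i => r * f i) k = r * psum f k := by
  rw [psum, psum, Finset.mul_sum]
  refine Finset.sum_congr rfl fun j _ => ?_
  simp only [ext]
  split_ifs <;> simp

theorem psum_eq_iff (f : Fin n → ℕ) (F : ℤ → ℤ) (h0 : F 0 = 0) :
    (∀ k : ℤ, 0 ≤ k → k ≤ n → F k = psum f k) ↔
      ∀ i : Fin n, F ((i : ℕ) + 1) = F (i : ℕ) + f i := by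
  constructor
  · intro h i
    have hi := i.isLt
    rw [h _ (by omega) (by omega), h _ (by omega) (by omega), psum_succ f (by omega)]
    simp
  · intro h k hk hkn
    lift k to ℕ using hk
    induction k with
    | zero => simpa [psum] using h0
    | succ k ih =>
      have h1 := h ⟨k, by omega⟩
      simp only at h1
      rw [Nat.cast_succ, h1, ih (by omega), psum_succ f (by omega)]
      simp [ext, show k < n by omega]

/-- Boundary conditions of a tile. -/
structure TileBorder (lam mu nu : Fin n → ℕ) (g : ℤ → ℤ → ℤ) : Prop where
  left : ∀ k : ℤ, 0 ≤ k → k ≤ n → g k 0 = psum lam k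
  right : ∀ i : ℤ, 0 ≤ i → i ≤ n → g n i = psum lam n + psum mu i
  base : ∀ k : ℤ, 0 ≤ k → k ≤ n → g k k = psum nu k

/-- The tile of a Gelfand–Tsetlin pattern. -/
def toTile (lam : Fin n → ℕ) (t : ℕ → ℕ → ℕ) (k i : ℤ) : ℤ :=
  psum lam k + ∑ j ∈ Finset.range i.toNat, (t k.toNat j : ℤ)

theorem exists_tile {lam mu nu : Fin n → ℕ} {t : ℕ → ℕ → ℕ} (G : IsGT n (ext mu) t)
    (L : IsHiveLattice n (ext lam) t) (W : ∀ i, lam i + wt n t i = nu i) :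
    ∃ g : ℤ → ℤ → ℤ, IsTile n (fun k i => g k i) ∧ TileBorder lam mu nu g := by
  refine ⟨toTile lam t, ⟨?_, ?_, ?_⟩, ⟨?_, ?_, ?_⟩⟩
  · intro k i hi hik hkn
    lift i to ℕ using hi
    lift k to ℕ using by omega
    have := G.le k i (by omega)
    norm_cast
    simp only [toTile, Int.toNat_natCast, Finset.sum_range_succ]
    push_cast
    linarith [(Nat.cast_le (α := ℤ)).2 this]
  · intro k i hi hik hkn
    lift i to ℕ using hi
    lift k to ℕ using by omega
    have := G.ge k i (by omega)
    norm_cast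
    simp only [toTile, Int.toNat_natCast, Finset.sum_range_succ]
    push_cast
    linarith [(Nat.cast_le (α := ℤ)).2 this]
  · intro k i hi hik hkn
    lift i to ℕ using hi
    lift k to ℕ using by omega
    have := L k i (by omega) (by omega)
    norm_cast
    simp only [toTile, Int.toNat_natCast]
    have e1 := psum_succ lam (k := k) (by omega)
    have e2 := psum_succ lam (k := k + 1) (by omega)
    rw [show (k + 1 : ℤ).toNat = k + 1 by omega, add_assoc] at e2
    rw [Int.toNat_natCast] at e1
    have := (Nat.cast_le (α := ℤ)).2 this
    push_cast at this ⊢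
    norm_num at e2
    linarith
  · intro k hk hkn
    simp [toTile]
  · intro i hi hin
    rw [toTile, psum, psum]
    congr 1
    refine Finset.sum_congr rfl fun j hj => ?_
    rw [Finset.mem_range] at hj
    rw [Int.toNat_natCast, G.top j (by omega)]
  · have key : ∀ k : ℕ, k ≤ n → toTile lam t k k = psum lam k + rowSum n t k := by
      intro k hk
      rw [toTile, rowSum, Int.toNat_natCast]
      push_cast
      congr 1
      refine Finset.sum_subset (Finset.range_mono hk) fun i _ hi => ?_
      rw [G.zero k i (by simpa using hi), Nat.cast_zero]
    refine (psum_eq_iff nu (fun k => toTile lam t k k) (by simp [toTile, psum])).2 fun i => ?_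
    have hi := i.isLt
    have h1 := W i
    have h2 := G.rowSum_le hi
    have e1 := key i (by omega)
    have e2 := key (i + 1) (by omega)
    have e3 := psum_succ lam (k := (i : ℕ)) (by omega)
    rw [Int.toNat_natCast, ext_val] at e3
    push_cast at e2
    simp only [e1, e2, e3]
    rw [wt] at h1
    omega

theorem exists_pattern {lam mu nu : Fin n → ℕ} {g : ℤ → ℤ → ℤ} (T : IsTile n (fun k i => g k i))
    (B : TileBorder lam mu nu g) : ∃ t, IsGT n (ext mu) t ∧
      IsHiveLattice n (ext lam) t ∧ ∀ i, lam i + wt n t i = nu i := by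
  have top : ∀ i : ℕ, i < n → g n (i + 1) - g n i = ext mu i := by
    intro i hi
    rw [B.right _ (by omega) (by omega), B.right _ (by omega) (by omega),
      psum_succ mu (by omega), Int.toNat_natCast]
    ring
  have r1 : ∀ k i : ℕ, i + 1 ≤ k → k + 1 ≤ n →
      g k (i + 1) - g k i ≤ g (k + 1) (i + 1) - g (k + 1) i := by
    intro k i h1 h2
    have := T.rh1 k i (by omega) (by omega) (by omega)
    norm_cast at this ⊢
    push_cast at this ⊢
    linarith
  have r2 : ∀ k i : ℕ, i + 1 ≤ k → k + 1 ≤ n →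
      g (k + 1) (i + 2) - g (k + 1) (i + 1) ≤ g k (i + 1) - g k i := by
    intro k i h1 h2
    have := T.rh2 k i (by omega) (by omega) (by omega)
    norm_cast at this ⊢
    push_cast at this ⊢
    linarith
  have nn : ∀ d k i : ℕ, k + d = n → i < k → 0 ≤ g k (i + 1) - g k i := by
    intro d
    induction d with
    | zero =>
      intro k i hk hi
      obtain rfl : k = n := by omega
      rw [top i hi]
      omega
    | succ d ih =>
      intro k i hk hi
      have h1 := ih (k + 1) (i + 1) (by omega) (by omega)
      have h2 := r2 k i (by omega) (by omega)
      push_cast at h1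
      rw [add_assoc] at h1
      norm_num at h1
      linarith
  let t : ℕ → ℕ → ℕ := fun k i => if i < k ∧ k ≤ n then (g k (i + 1) - g k i).toNat else 0
  have ht : ∀ k i : ℕ, i < k → k ≤ n → (t k i : ℤ) = g k (i + 1) - g k i := by
    intro k i h1 h2
    simp only [t, if_pos (And.intro h1 h2)]
    have := nn (n - k) k i (by omega) h1
    omega
  have ht0 : ∀ k i : ℕ, ¬ (i < k ∧ k ≤ n) → t k i = 0 := fun k i h => if_neg h
  have hs : ∀ k m : ℕ, m ≤ k → k ≤ n →
      ((∑ j ∈ Finset.range m, t k j : ℕ) : ℤ) = g k m - psum lam k := by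
    intro k m hm hk
    induction m with
    | zero => simp [B.left k (by omega) (by omega)]
    | succ m ih =>
      rw [Finset.sum_range_succ, Nat.cast_add, ih (by omega), ht k m (by omega) hk]
      push_cast
      ring
  have G : IsGT n (ext mu) t := by
    refine ⟨fun k i h => ht0 k i (by omega), fun k i h => ht0 k i (by omega), fun i hi => ?_,
      fun k i hk => ?_, fun k i hk => ?_⟩
    · have := ht n i hi le_rfl
      have := top i hi
      omega
    · by_cases h : i < k
      · have h1 := ht k i h (by omega)
        have h2 := ht (k + 1) i (by omega) (by omega)
        have h3 := r1 k i (by omega) (by omega)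
        push_cast at h2
        omega
      · rw [ht0 k i (by omega)]; omega
    · by_cases h : i < k
      · have h1 := ht k i h (by omega)
        have h2 := ht (k + 1) (i + 1) (by omega) (by omega)
        have h3 := r2 k i (by omega) (by omega)
        push_cast at h2
        rw [add_assoc (i : ℤ)] at h2
        norm_num at h2
        omega
      · rw [ht0 (k + 1) (i + 1) (by omega)]; omega
  refine ⟨t, G, fun k i hk hi => ?_, ?_⟩
  · have h := T.rh3 k i (by omega) (by omega) (by omega)
    norm_cast at h
    have a1 := hs k i (by omega) (by omega)
    have a2 := hs (k + 2) (i + 1) (by omega) (by omega)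
    have a3 := hs (k + 1) i (by omega) (by omega)
    have a4 := hs (k + 1) (i + 1) (by omega) (by omega)
    have e1 := psum_succ lam (k := k) (by omega)
    have e2 := psum_succ lam (k := k + 1) (by omega)
    rw [show (k + 1 : ℤ).toNat = k + 1 by omega, add_assoc] at e2
    rw [Int.toNat_natCast] at e1
    norm_num at e2
    push_cast at h a1 a2 a3 a4
    zify
    linarith
  · have key : ∀ k : ℕ, k ≤ n → psum nu k = psum lam k + rowSum n t k := by
      intro k hk
      have h1 := hs k k le_rfl hk
      rw [B.base k (by omega) (by omega)] at h1
      have h2 : rowSum n t k = ∑ j ∈ Finset.range k, t k j :=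
        (Finset.sum_subset (Finset.range_mono hk) fun i _ hi =>
          G.zero k i (by simpa using hi)).symm
      rw [h2, h1]
      ring
    intro i
    have hi := i.isLt
    have h2 := G.rowSum_le hi
    have e1 := key i (by omega)
    have e2 := key (i + 1) (by omega)
    have e3 := psum_succ lam (k := (i : ℕ)) (by omega)
    have e4 := psum_succ nu (k := (i : ℕ)) (by omega)
    rw [Int.toNat_natCast, ext_val] at e3 e4
    push_cast at e2
    rw [wt]
    omega

/-- Littlewood–Richardson coefficients and integral hives. -/
theorem lrCoeff_ne_zero_iff_tile {lam mu nu : Fin n → ℕ} (hlam : Antitone lam)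
    (hmu : Antitone mu) (hnu : Antitone nu) : lrCoeff n lam mu nu ≠ 0 ↔
      ∃ g : ℤ → ℤ → ℤ, IsTile n (fun k i => g k i) ∧ TileBorder lam mu nu g := by
  rw [lrCoeff_ne_zero_iff hlam hmu hnu]
  exact ⟨fun ⟨_, G, L, W⟩ => exists_tile G L W, fun ⟨_, T, B⟩ => exists_pattern T B⟩

end LRRule

namespace LRRule

variable {n : ℕ}

theorem psum_card (f : Fin n → ℕ) : psum f n = ∑ i, (f i : ℤ) := by
  rw [psum, Int.toNat_natCast, Finset.sum_range]
  simp

theorem le_psum_card (f : Fin n → ℕ) (i : Fin n) : (f i : ℤ) ≤ psum f n := by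
  rw [psum_card]
  exact Finset.single_le_sum (f := fun i => (f i : ℤ)) (fun j _ => Int.natCast_nonneg _)
    (Finset.mem_univ i)

theorem TileBorder.le_psum {lam mu nu : Fin n → ℕ} {g : ℤ → ℤ → ℤ} (B : TileBorder lam mu nu g)
    (i : Fin n) : (mu i : ℤ) ≤ psum nu n := by
  have h1 := B.right n (by omega) le_rfl
  have h2 := B.base n (by omega) le_rfl
  have h3 := le_psum_card mu i
  have h4 : 0 ≤ psum lam n := by rw [psum_card]; positivity
  linarith

/-- A chain of integral hives with the outer boundary prescribed by `lam`. -/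
def HasTiles (n m : ℕ) (lam : ℕ → Fin n → ℕ) : Prop :=
  ∃ ν : ℕ → Fin n → ℕ, ν 0 = lam 1 ∧ ν (m - 2) = lam m ∧ (∀ j ≤ m - 2, Antitone (ν j)) ∧
    ∀ j < m - 2, ∃ g : ℤ → ℤ → ℤ, IsTile n (fun k i => g k i) ∧
      TileBorder (ν j) (ν (j + 1)) (lam (j + 2)) g

theorem antitone_chainNu {m : ℕ} (hm : 3 ≤ m) {lam : ℕ → Fin n → ℕ}
    (hlam : ∀ i, 1 ≤ i → i ≤ m → Antitone (lam i)) {mu : Fin (m - 3) → Fin n → ℕ}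
    (hmu : ∀ k, Antitone (mu k)) (j : ℕ) : Antitone (chainNu n m lam mu j) := by
  rw [chainNu]
  split_ifs with h1 h2 h3
  · exact hlam 1 le_rfl (by omega)
  · exact hlam m (by omega) le_rfl
  · exact hmu _
  · exact antitone_const

theorem genLR_ne_zero_iff {m : ℕ} (hm : 3 ≤ m) {lam : ℕ → Fin n → ℕ}
    (hlam : ∀ i, 1 ≤ i → i ≤ m → Antitone (lam i)) : genLR n m lam ≠ 0 ↔ HasTiles n m lam := by
  set F : (Fin (m - 3) → Fin n → ℕ) → ℤ := fun mu =>
    if ∀ k, Antitone (mu k) then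
      ∏ j ∈ Finset.range (m - 2),
        lrCoeff n (chainNu n m lam mu j) (chainNu n m lam mu (j + 1)) (lam (j + 2))
    else 0 with hF
  have hnu : ∀ j ∈ Finset.range (m - 2), Antitone (lam (j + 2)) := fun j hj =>
    hlam _ (by omega) (by rw [Finset.mem_range] at hj; omega)
  have tiles : ∀ mu, F mu ≠ 0 → (∀ k, Antitone (mu k)) ∧ ∀ j < m - 2, ∃ g : ℤ → ℤ → ℤ,
      IsTile n (fun k i => g k i) ∧
        TileBorder (chainNu n m lam mu j) (chainNu n m lam mu (j + 1)) (lam (j + 2)) g := by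
    intro mu h
    simp only [hF] at h
    split_ifs at h with hmu
    · refine ⟨hmu, fun j hj => ?_⟩
      have hj := Finset.mem_range.2 hj
      exact (lrCoeff_ne_zero_iff_tile (antitone_chainNu hm hlam hmu j)
        (antitone_chainNu hm hlam hmu (j + 1)) (hnu j hj)).1 (Finset.prod_ne_zero_iff.1 h j hj)
    · exact absurd rfl h
  have hpos : ∀ mu, 0 ≤ F mu := by
    intro mu
    simp only [hF]
    split_ifs with hmu
    · exact Finset.prod_nonneg fun j hj => lrCoeff_nonneg (antitone_chainNu hm hlam hmu j)
        (antitone_chainNu hm hlam hmu (j + 1)) (hnu j hj)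
    · exact le_rfl
  have hfin : F.support.Finite := by
    refine (Set.finite_Icc (0 : Fin (m - 3) → Fin n → ℕ)
      fun k _ => (psum (lam (k + 2)) n).toNat).subset fun mu h => ⟨fun _ _ => Nat.zero_le _, ?_⟩
    intro k i
    obtain ⟨-, ht⟩ := tiles mu h
    obtain ⟨g, -, B⟩ := ht k (by omega)
    have hb := B.le_psum i
    rw [chainNu, if_neg (by omega), if_neg (by omega), dif_pos (by simp)] at hb
    simp only [Nat.add_sub_cancel] at hb
    have : ((mu k i : ℕ) : ℤ) ≤ psum (lam (k + 2)) n := hb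
    simp only
    omega
  change ∑ᶠ mu, F mu ≠ 0 ↔ _
  constructor
  · intro h
    obtain ⟨mu, hmu⟩ : ∃ mu, F mu ≠ 0 := by
      by_contra! h'
      exact h (finsum_eq_zero_of_forall_eq_zero h')
    obtain ⟨h1, h2⟩ := tiles mu hmu
    refine ⟨chainNu n m lam mu, by simp [chainNu], ?_,
      fun j _ => antitone_chainNu hm hlam h1 j, h2⟩
    rw [chainNu, if_neg (by omega), if_pos rfl]
  · rintro ⟨ν, h0, h1, h2, h3⟩
    have hmu : ∀ k : Fin (m - 3), Antitone (ν (k + 1)) := fun k => h2 _ (by omega)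
    have hc : ∀ j ≤ m - 2, chainNu n m lam (fun k : Fin (m - 3) => ν (k + 1)) j = ν j := by
      intro j hj
      rw [chainNu]
      split_ifs with e1 e2 e3
      · rw [e1, h0]
      · rw [e2, h1]
      · simp only
        rw [Nat.sub_add_cancel (by omega)]
      · omega
    have hne : F (fun k => ν (k + 1)) ≠ 0 := by
      simp only [hF]
      rw [if_pos hmu]
      refine Finset.prod_ne_zero_iff.2 fun j hj => ?_
      have hj' := Finset.mem_range.1 hj
      rw [hc j hj'.le, hc (j + 1) (by omega)]
      exact (lrCoeff_ne_zero_iff_tile (h2 j hj'.le) (h2 (j + 1) (by omega)) (hnu j hj)).2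
        (h3 j hj')
    have := single_le_finsum (fun k : Fin (m - 3) => ν (k + 1)) hfin hpos
    have := (hpos (fun k => ν (k + 1))).lt_of_ne' hne
    omega

theorem HasTiles.smul {m : ℕ} {lam : ℕ → Fin n → ℕ} (h : HasTiles n m lam) (r : ℕ) :
    HasTiles n m fun i j => r * lam i j := by
  obtain ⟨ν, h0, h1, h2, h3⟩ := h
  refine ⟨fun j i => r * ν j i, by simp only [h0], by simp only [h1],
    fun j hj a b hab => Nat.mul_le_mul_left r (h2 j hj hab), fun j hj => ?_⟩
  obtain ⟨g, T, B⟩ := h3 j hj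
  have hr : (0 : ℝ) ≤ r := Nat.cast_nonneg r
  refine ⟨fun k i => r * g k i, ⟨fun k i a b c => ?_, fun k i a b c => ?_, fun k i a b c => ?_⟩,
    ⟨fun k a b => ?_, fun k a b => ?_, fun k a b => ?_⟩⟩
  · have := mul_le_mul_of_nonneg_left (T.rh1 k i a b c) hr
    push_cast
    linarith
  · have := mul_le_mul_of_nonneg_left (T.rh2 k i a b c) hr
    push_cast
    linarith
  · have := mul_le_mul_of_nonneg_left (T.rh3 k i a b c) hr
    push_cast
    linarith
  · rw [psum_smul, B.left k a b]
  · rw [psum_smul, psum_smul, B.right k a b, mul_add]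
  · rw [psum_smul, B.base k a b]

end LRRule

namespace LRRule

variable {n : ℕ}

theorem min_le_of_concave {f : ℕ → ℝ} {k : ℕ}
    (hf : ∀ i, i + 2 ≤ k → f i + f (i + 2) ≤ f (i + 1) + f (i + 1)) {i : ℕ} (hi : i ≤ k) :
    min (f 0) (f k) ≤ f i := by
  by_contra! h
  rw [lt_min_iff] at h
  obtain ⟨j, hj, hd⟩ : ∃ j < i, f (j + 1) < f j := by
    by_contra! hm
    have : ∀ l, l ≤ i → f 0 ≤ f l := by
      intro l hl
      induction l with
      | zero => exact le_rfl
      | succ l ih => exact (ih (by omega)).trans (hm l (by omega))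
    exact absurd (this i le_rfl) (not_le.2 h.1)
  have step : ∀ l, j ≤ l → l + 1 ≤ k → f (l + 1) < f l := by
    intro l hl
    induction l, hl using Nat.le_induction with
    | base => exact fun _ => hd
    | succ l hl ih =>
      intro hk
      have := hf l hk
      have := ih (by omega)
      rw [add_assoc]
      linarith
  have : ∀ l, i ≤ l → l ≤ k → f l ≤ f i := by
    intro l hl
    induction l, hl using Nat.le_induction with
    | base => exact fun _ => le_rfl
    | succ l hl ih => exact fun hk => (step l (by omega) hk).le.trans (ih (by omega))
  exact absurd (this k hi le_rfl) (not_le.2 h.2)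

theorem IsTile.row_concave {g : ℤ → ℤ → ℝ} (T : IsTile n g) {k i : ℤ} (hi : 0 ≤ i)
    (hik : i + 2 ≤ k) (hk : k ≤ n) : g k i + g k (i + 2) ≤ g k (i + 1) + g k (i + 1) := by
  rcases hk.eq_or_lt with rfl | hk
  · have h1 := T.rh1 (n - 1) i hi (by omega) (by omega)
    have h2 := T.rh2 (n - 1) i hi (by omega) (by omega)
    rw [sub_add_cancel] at h1 h2
    linarith
  · have h1 := T.rh1 k (i + 1) (by omega) (by omega) (by omega)
    have h2 := T.rh2 k i hi (by omega) (by omega)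
    rw [add_assoc, one_add_one_eq_two] at h1
    linarith

theorem IsTile.parallelogram {g : ℤ → ℤ → ℝ} (T : IsTile n g) (p q : ℕ) (h : p + q ≤ n) :
    g (p + q) q + g 0 0 ≤ g p 0 + g q q := by
  have step : ∀ q p : ℕ, p + q + 1 ≤ n →
      g (p + q + 1) (q + 1) + g q q ≤ g (p + q) q + g (q + 1) (q + 1) := by
    intro q p
    induction p with
    | zero => intro _; simp [add_comm]
    | succ p ih =>
      intro h
      have h1 := ih (by omega)
      have h2 := T.rh3 (p + q) q (by omega) (by omega) (by omega)
      push_cast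
      rw [show (p : ℤ) + 1 + q + 1 = p + q + 2 by ring, show (p : ℤ) + 1 + q = p + q + 1 by ring]
      linarith
  induction q with
  | zero => simp
  | succ q ih =>
    have h1 := ih (by omega)
    have h2 := step q p (by omega)
    push_cast
    rw [← add_assoc]
    linarith

theorem IsTile.abs_le {g : ℤ → ℤ → ℝ} (T : IsTile n g) {M : ℝ}
    (hl : ∀ k : ℤ, 0 ≤ k → k ≤ n → |g k 0| ≤ M) (hb : ∀ k : ℤ, 0 ≤ k → k ≤ n → |g k k| ≤ M)
    {k i : ℤ} (hi : 0 ≤ i) (hik : i ≤ k) (hk : k ≤ n) : |g k i| ≤ 3 * M := by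
  have hM : 0 ≤ M := (abs_nonneg _).trans (hl 0 le_rfl (by omega))
  rw [_root_.abs_le]
  constructor
  · lift k to ℕ using hi.trans hik
    lift i to ℕ using hi
    have h := min_le_of_concave (f := fun i : ℕ => g k i) (k := k) (fun i hi => by
      have := T.row_concave (k := k) (i := i) (by omega) (by omega) hk
      push_cast
      exact this) (i := i) (by omega)
    have h1 := neg_le_of_abs_le (hl k (by omega) hk)
    have h2 := neg_le_of_abs_le (hb k (by omega) hk)
    simp only [Nat.cast_zero] at h
    have := (le_min h1 h2).trans h
    linarith
  · obtain ⟨p, rfl⟩ : ∃ p, k = p + i := ⟨k - i, by ring⟩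
    lift p to ℕ using by omega
    lift i to ℕ using hi
    have h := T.parallelogram p i (by omega)
    have h1 := le_of_abs_le (hl p (by omega) (by omega))
    have h2 := le_of_abs_le (hb i (by omega) (by omega))
    have h3 := neg_le_of_abs_le (hl 0 (by omega) (by omega))
    linarith

theorem exists_abs_le (n : ℕ) (f : ℤ → ℝ) : ∃ M, ∀ k : ℤ, 0 ≤ k → k ≤ n → |f k| ≤ M :=
  ⟨∑ k ∈ Finset.Icc (0 : ℤ) n, |f k|, fun _ h1 h2 =>
    Finset.single_le_sum (f := fun k => |f k|) (fun _ _ => abs_nonneg _)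
      (Finset.mem_Icc.2 ⟨h1, h2⟩)⟩

/-- A chain of tiles has values bounded in terms of the outer boundary. -/
theorem exists_tile_bound (G : ℕ → ℤ → ℤ → ℝ) (t : ℕ) : ∃ R, ∀ X : ℕ → ℤ → ℤ → ℝ,
    (∀ j < t, IsTile n (X j)) → (∀ k : ℤ, 0 ≤ k → k ≤ n → X 0 k 0 = G 0 k 0) →
    (∀ j < t, ∀ k : ℤ, 0 ≤ k → k ≤ n → X j k k = G j k k) →
    (∀ j, j + 1 < t → ∀ i : ℤ, 0 ≤ i → i ≤ n → X j n i = X (j + 1) i 0) →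
    ∀ j < t, ∀ k i : ℤ, 0 ≤ i → i ≤ k → k ≤ n → |X j k i| ≤ R := by
  induction t with
  | zero => exact ⟨0, fun _ _ _ _ _ j hj => absurd hj (by omega)⟩
  | succ t ih =>
    obtain ⟨R, hR⟩ := ih
    obtain ⟨M, hM⟩ := exists_abs_le n fun k => G t k k
    obtain ⟨L, hL⟩ := exists_abs_le n fun k => G 0 k 0
    refine ⟨3 * max M (max L R) + |R|, fun X hT h0 hb hg j hj k i hi hik hk => ?_⟩
    have old : ∀ j < t, ∀ k i : ℤ, 0 ≤ i → i ≤ k → k ≤ n → |X j k i| ≤ R :=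
      hR X (fun j hj => hT j (by omega)) h0 (fun j hj => hb j (by omega))
        fun j hj => hg j (by omega)
    have hL0 : 0 ≤ max M (max L R) :=
      ((abs_nonneg _).trans (hL 0 le_rfl (by omega))).trans
        ((le_max_left _ _).trans (le_max_right _ _))
    by_cases hjt : j < t
    · have := old j hjt k i hi hik hk
      have := le_abs_self R
      linarith
    · obtain rfl : j = t := by omega
      have := (hT j hj).abs_le (M := max M (max L R)) (fun k h1 h2 => ?_)
        (fun k h1 h2 => ?_) hi hik hk
      · have := abs_nonneg R
        linarith
      · cases j with
        | zero =>
          rw [h0 k h1 h2]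
          exact (hL k h1 h2).trans ((le_max_left _ _).trans (le_max_right _ _))
        | succ j =>
          rw [← hg j hj k h1 h2]
          exact (old j (by omega) n k h1 h2 le_rfl).trans
            ((le_max_right _ _).trans (le_max_right _ _))
      · rw [hb j hj k h1 h2]
        exact (hM k h1 h2).trans (le_max_left _ _)

end LRRule

namespace LRRule

open HexHive

variable {n t : ℕ}

/-- Support numbers of the trapezoid tiled by `t` triangles of side `n`. -/
def stripBd (n t : ℕ) : Fin 6 → ℤ :=
  ![((t + 1) / 2 : ℕ) * n, ((t / 2 : ℕ) + 1) * n, n, 0, 0, 0]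

theorem stripBd_quad (hn : 1 ≤ n) (ht : 1 ≤ t) : Quad (stripBd n t) := by
  have h0 : (1 : ℤ) ≤ n := by omega
  have h1 : (n : ℤ) ≤ ((t + 1) / 2 : ℕ) * n :=
    le_mul_of_one_le_left (by omega) (by omega)
  have h2 : (((t + 1) / 2 : ℕ) : ℤ) * n ≤ ((t / 2 : ℕ) + 1) * n :=
    mul_le_mul_of_nonneg_right (by omega) (by omega)
  have h3 : (((t / 2 : ℕ) : ℤ) + 1) * n ≤ (((t + 1) / 2 : ℕ) + 1) * n :=
    mul_le_mul_of_nonneg_right (by omega) (by omega)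
  rw [add_mul _ 1, one_mul] at h2 h3
  rw [add_mul _ 1 (n : ℤ), one_mul] at h3
  rw [stripBd, add_mul _ 1, one_mul]
  generalize (((t + 1) / 2 : ℕ) : ℤ) * n = p at *
  generalize ((t / 2 : ℕ) : ℤ) * n = q at *
  refine ⟨fun k => ?_, fun k => ?_, rfl, rfl, rfl⟩
  · rcases fin6_cases k with rfl | rfl | rfl | rfl | rfl | rfl <;> simp <;> omega
  · rcases fin6_cases k with rfl | rfl | rfl | rfl | rfl | rfl <;> simp <;> omega

theorem mem_strip (hn : 1 ≤ n) (ht : 1 ≤ t) {x y : ℤ} : (x, y) ∈ region (stripBd n t) ↔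
    0 ≤ x ∧ 0 ≤ y ∧ x ≤ ((t + 1) / 2 : ℕ) * n ∧ y ≤ n ∧ x + y ≤ (t / 2 : ℕ) * n + n := by
  rw [(stripBd_quad hn ht).mem, ← add_one_mul]
  rfl

theorem mem_even (hn : 1 ≤ n) {s : ℕ} (hs : 2 * s < t) {x y : ℤ} (hx : (s : ℤ) * n ≤ x)
    (hy : 0 ≤ y) (hxy : x + y ≤ s * n + n) : (x, y) ∈ region (stripBd n t) := by
  have h1 : ((s : ℤ) + 1) * n ≤ ((t + 1) / 2 : ℕ) * n :=
    mul_le_mul_of_nonneg_right (by omega) (by omega)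
  have h2 : (s : ℤ) * n ≤ (t / 2 : ℕ) * n := mul_le_mul_of_nonneg_right (by omega) (by omega)
  have h3 : 0 ≤ (s : ℤ) * n := by positivity
  rw [add_one_mul] at h1
  rw [mem_strip hn (by omega)]
  omega

theorem mem_odd (hn : 1 ≤ n) {s : ℕ} (hs : 2 * s + 1 < t) {x y : ℤ} (hx : x ≤ s * n + n)
    (hy : y ≤ n) (hxy : s * n + n ≤ x + y) : (x, y) ∈ region (stripBd n t) := by
  have h1 : ((s : ℤ) + 1) * n ≤ ((t + 1) / 2 : ℕ) * n :=
    mul_le_mul_of_nonneg_right (by omega) (by omega)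
  have h2 : ((s : ℤ) + 1) * n ≤ (t / 2 : ℕ) * n :=
    mul_le_mul_of_nonneg_right (by omega) (by omega)
  have h3 : 0 ≤ (s : ℤ) * n := by positivity
  rw [add_one_mul] at h1 h2
  rw [mem_strip hn (by omega)]
  omega

theorem lt_of_mul_add_lt {s T : ℕ} {c : ℤ} (hc : 0 ≤ c) (h : (s : ℤ) * n + c < T * n) : s < T := by
  by_contra! hT
  have : (T : ℤ) * n ≤ s * n := mul_le_mul_of_nonneg_right (by omega) (by omega)
  omega

theorem even_lt {s : ℕ} {x : ℤ} (hx : (s : ℤ) * n < x)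
    (h : x ≤ ((t + 1) / 2 : ℕ) * n) : 2 * s < t := by
  have := lt_of_mul_add_lt (c := 0) le_rfl (by rw [add_zero]; exact hx.trans_le h)
  omega

theorem odd_lt {s : ℕ} {x y : ℤ} (hx : (s : ℤ) * n < x)
    (h : x ≤ ((t + 1) / 2 : ℕ) * n) (hz : s * n + n < x + y)
    (h' : x + y ≤ (t / 2 : ℕ) * n + n) : 2 * s + 1 < t := by
  have := even_lt hx h
  have := lt_of_mul_add_lt (n := n) (s := s) (T := t / 2) (c := 0) le_rfl (by omega)
  omega

theorem exists_strip (hn : 1 ≤ n) {x : ℤ} (hx : 0 ≤ x) :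
    ∃ s : ℕ, (s : ℤ) * n ≤ x ∧ x < s * n + n := by
  refine ⟨(x / n).toNat, ?_⟩
  have h0 : 0 ≤ x / n := Int.ediv_nonneg hx (by omega)
  rw [Int.toNat_of_nonneg h0]
  have h1 := Int.emod_add_mul_ediv x n
  have h2 := Int.emod_nonneg x (b := n) (by omega)
  have h3 := Int.emod_lt_of_pos x (b := n) (by omega)
  rw [mul_comm] at h1
  omega

theorem ediv_eq_of_mem {s : ℕ} {x : ℤ} (h1 : (s : ℤ) * n ≤ x) (h2 : x < s * n + n) :
    x / n = s := by
  have := (Int.ediv_emod_unique (a := x) (b := n) (r := x - s * n) (q := s) (by omega)).2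
    ⟨by ring, by omega, by omega⟩
  exact this.1

/-- The lattice points of the `j`-th tile. -/
def pt (n j : ℕ) (k i : ℤ) : ℤ × ℤ :=
  if j % 2 = 0 then ((j / 2 : ℕ) * n + i, k - i) else ((j / 2 : ℕ) * n + k, n - k + i)

theorem pt_even (s : ℕ) (k i : ℤ) : pt n (2 * s) k i = (s * n + i, k - i) := by
  rw [pt, if_pos (by omega), Nat.mul_div_cancel_left _ (by omega)]

theorem pt_odd (s : ℕ) (k i : ℤ) : pt n (2 * s + 1) k i = (s * n + k, n - k + i) := by
  rw [pt, if_neg (by omega), show (2 * s + 1) / 2 = s by omega]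

theorem pt_succ (j : ℕ) (i : ℤ) : pt n (j + 1) i 0 = pt n j n i := by
  obtain ⟨s, rfl | rfl⟩ : ∃ s, j = 2 * s ∨ j = 2 * s + 1 := ⟨j / 2, by omega⟩
  · rw [pt_even, pt_odd]; simp
  · rw [show 2 * s + 1 + 1 = 2 * (s + 1) by ring, pt_even, pt_odd]
    simp [add_mul]

theorem pt_mem (hn : 1 ≤ n) {j : ℕ} (hj : j < t) {k i : ℤ} (hi : 0 ≤ i) (hik : i ≤ k)
    (hk : k ≤ n) : pt n j k i ∈ region (stripBd n t) := by
  obtain ⟨s, rfl | rfl⟩ : ∃ s, j = 2 * s ∨ j = 2 * s + 1 := ⟨j / 2, by omega⟩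
  · rw [pt_even]; exact mem_even hn hj (by omega) (by omega) (by omega)
  · rw [pt_odd]; exact mem_odd hn hj (by omega) (by omega) (by omega)

theorem exists_pt (hn : 1 ≤ n) (ht : 1 ≤ t) {v : ℤ × ℤ} (hv : v ∈ region (stripBd n t)) :
    ∃ j < t, ∃ k i : ℤ, 0 ≤ i ∧ i ≤ k ∧ k ≤ n ∧ v = pt n j k i := by
  obtain ⟨x, y⟩ := v
  rw [mem_strip hn ht] at hv
  obtain ⟨h1, h2, h3, h4, h5⟩ := hv
  rcases h1.eq_or_lt with rfl | h1
  · refine ⟨0, ht, y, 0, le_rfl, h2, h4, ?_⟩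
    simp [pt]
  · obtain ⟨s, a, b⟩ := exists_strip hn (x := x - 1) (by omega)
    by_cases hxy : x + y ≤ s * n + n
    · refine ⟨2 * s, even_lt (by omega) h3, x + y - s * n, x - s * n, by omega, by omega,
        by omega, ?_⟩
      rw [pt_even]
      ext <;> simp
    · refine ⟨2 * s + 1, odd_lt (by omega) h3 (not_le.1 hxy) h5, x - s * n, x + y - s * n - n,
        by omega, by omega, by omega, ?_⟩
      rw [pt_odd]
      ext
      · simp
      · simp only; ring

end LRRule

namespace LRRule

open HexHive

variable {n t : ℕ}

/-- A convex function on the integers with kinks at the positive multiples of `n`. -/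
def kink (n : ℕ) (s : ℤ) : ℤ := ∑ j ∈ Finset.range s.toNat, (j : ℤ) / n

theorem kink_succ (n : ℕ) {s : ℤ} (hs : 0 ≤ s) : kink n (s + 1) = kink n s + s / n := by
  rw [kink, kink, show (s + 1).toNat = s.toNat + 1 by omega, Finset.sum_range_succ,
    Int.toNat_of_nonneg hs]

/-- A hive bending exactly along the edges shared by two tiles. -/
def bend (n : ℕ) (v : ℤ × ℤ) : ℤ := -(kink n v.1 + kink n (v.1 + v.2))

theorem bend_rhombus0 (x y : ℤ) :
    bend n (x, y + 1) + bend n (x + 1, y - 1) = bend n (x, y) + bend n (x + 1, y) := by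
  simp only [bend]
  ring_nf

theorem bend_rhombus1 {x : ℤ} (hx : 1 ≤ x) (y : ℤ) :
    bend n (x - 1, y + 1) + bend n (x + 1, y) + (x / n - (x - 1) / n) =
      bend n (x, y) + bend n (x, y + 1) := by
  have h1 := kink_succ n (s := x) (by omega)
  have h2 := kink_succ n (s := x - 1) (by omega)
  rw [sub_add_cancel] at h2
  simp only [bend]
  rw [show x - 1 + (y + 1) = x + y by ring, show x + 1 + y = x + (y + 1) by ring]
  linarith

theorem bend_rhombus2 {x y : ℤ} (h : 0 ≤ x + y) :
    bend n (x, y) + bend n (x + 1, y + 1) + ((x + y + 1) / n - (x + y) / n) =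
      bend n (x + 1, y) + bend n (x, y + 1) := by
  have h1 := kink_succ n (s := x + y) h
  have h2 := kink_succ n (s := x + y + 1) (by omega)
  simp only [bend]
  rw [show x + 1 + (y + 1) = x + y + 1 + 1 by ring, show x + 1 + y = x + y + 1 by ring,
    show x + (y + 1) = x + y + 1 by ring]
  linarith

/-- The function on the strip with prescribed values on the tiles. -/
def glue (n : ℕ) (G : ℕ → ℤ → ℤ → ℝ) (v : ℤ × ℤ) : ℝ :=
  if v.1 + v.2 ≤ (v.1 / n).toNat * n + n then
    G (2 * (v.1 / n).toNat) (v.1 + v.2 - (v.1 / n).toNat * n) (v.1 - (v.1 / n).toNat * n)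
  else
    G (2 * (v.1 / n).toNat + 1) (v.1 - (v.1 / n).toNat * n)
      (v.1 + v.2 - (v.1 / n).toNat * n - n)

theorem glue_of_strip (G : ℕ → ℤ → ℤ → ℝ) {s : ℕ} {x : ℤ} (h1 : (s : ℤ) * n ≤ x)
    (h2 : x < s * n + n) (y : ℤ) : glue n G (x, y) = if x + y ≤ s * n + n then
      G (2 * s) (x + y - s * n) (x - s * n) else G (2 * s + 1) (x - s * n) (x + y - s * n - n) := by
  simp only [glue, ediv_eq_of_mem h1 h2, Int.toNat_natCast]

theorem glue_even (hn : 1 ≤ n) {G : ℕ → ℤ → ℤ → ℝ}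
    (hG : ∀ j, ∀ i : ℤ, 0 ≤ i → i ≤ n → G j n i = G (j + 1) i 0) {s : ℕ} {x y : ℤ}
    (hx : (s : ℤ) * n ≤ x) (hy : 0 ≤ y) (hxy : x + y ≤ s * n + n) :
    glue n G (x, y) = G (2 * s) (x + y - s * n) (x - s * n) := by
  by_cases h : x < s * n + n
  · rw [glue_of_strip G hx h, if_pos hxy]
  · obtain rfl : y = 0 := by omega
    obtain rfl : x = (s + 1 : ℕ) * n := by push_cast; rw [add_one_mul]; omega
    rw [glue_of_strip G (s := s + 1) le_rfl (by omega), if_pos (by omega)]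
    have h1 := hG (2 * s) n (by omega) le_rfl
    have h2 := hG (2 * s + 1) 0 le_rfl (by omega)
    rw [add_zero, sub_self, Nat.cast_succ, add_one_mul, add_sub_cancel_left, h1, h2,
      show 2 * (s + 1) = 2 * s + 1 + 1 by ring]

theorem glue_odd (hn : 1 ≤ n) {G : ℕ → ℤ → ℤ → ℝ}
    (hG : ∀ j, ∀ i : ℤ, 0 ≤ i → i ≤ n → G j n i = G (j + 1) i 0) {s : ℕ} {x y : ℤ}
    (hx : x ≤ s * n + n) (hy : y ≤ n) (hxy : s * n + n ≤ x + y) :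
    glue n G (x, y) = G (2 * s + 1) (x - s * n) (x + y - s * n - n) := by
  rcases hxy.eq_or_lt with hxy | hxy
  · rw [glue_even hn hG (s := s) (by omega) (by omega) hxy.ge, ← hxy, add_sub_cancel_left,
      hG _ _ (by omega) (by omega), sub_self]
  · by_cases h : x < s * n + n
    · rw [glue_of_strip G (s := s) (by omega) h, if_neg (by omega)]
    · obtain rfl : x = (s + 1 : ℕ) * n := by push_cast; rw [add_one_mul]; omega
      rw [glue_of_strip G (s := s + 1) le_rfl (by omega), if_pos (by omega)]
      rw [sub_self, Nat.cast_succ, add_one_mul, add_sub_cancel_left, add_sub_cancel_left,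
        hG _ _ (by omega) (by omega)]
      congr 1
      ring

theorem glue_pt (hn : 1 ≤ n) {G : ℕ → ℤ → ℤ → ℝ}
    (hG : ∀ j, ∀ i : ℤ, 0 ≤ i → i ≤ n → G j n i = G (j + 1) i 0) (j : ℕ) {k i : ℤ} (hi : 0 ≤ i)
    (hik : i ≤ k) (hk : k ≤ n) : glue n G (pt n j k i) = G j k i := by
  obtain ⟨s, rfl | rfl⟩ : ∃ s, j = 2 * s ∨ j = 2 * s + 1 := ⟨j / 2, by omega⟩
  · rw [pt_even, glue_even hn hG (s := s) (by omega) (by omega) (by omega)]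
    congr 1 <;> ring
  · rw [pt_odd, glue_odd hn hG (s := s) (by omega) (by omega) (by omega)]
    congr 1 <;> ring

theorem isHive_of_rhombi {A : Fin 6 → ℤ} {h : ℤ × ℤ → ℝ}
    (h0 : ∀ x y, (x, y + 1) ∈ region A → (x + 1, y - 1) ∈ region A →
      h (x, y + 1) + h (x + 1, y - 1) ≤ h (x, y) + h (x + 1, y))
    (h1 : ∀ x y, (x - 1, y + 1) ∈ region A → (x + 1, y) ∈ region A →
      h (x - 1, y + 1) + h (x + 1, y) ≤ h (x, y) + h (x, y + 1))
    (h2 : ∀ x y, (x, y) ∈ region A → (x + 1, y + 1) ∈ region A →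
      h (x, y) + h (x + 1, y + 1) ≤ h (x + 1, y) + h (x, y + 1)) : IsHive A h := by
  rintro k ⟨x, y⟩ a b
  rcases fin6_cases k with rfl | rfl | rfl | rfl | rfl | rfl <;>
    simp [slack, dir, ← sub_eq_add_neg] at a b ⊢
  · linarith [h0 x y a b]
  · linarith [h1 x y a b]
  · have := h2 (x - 1) y (by simpa using a) (by simpa using b)
    simp at this
    linarith
  · have := h0 (x - 1) y (by simpa using b) (by simpa using a)
    simp at this
    linarith
  · have := h1 x (y - 1) (by simpa using b) (by simpa using a)
    simp at this
    linarith
  · have := h2 x (y - 1) (by simpa using b) (by simpa using a)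
    simp at this
    linarith

section Kinks

variable {H : ℤ × ℤ → ℝ} {N : ℕ} {R : ℝ}

theorem kink_rhombus1 (hn : 1 ≤ n) (hH : ∀ v ∈ region (stripBd n t), |H v - N * bend n v| ≤ R)
    (hN : 4 * R < N) {s : ℕ} {x y : ℤ} (hx : x = s * n + n)
    (h1 : (x - 1, y + 1) ∈ region (stripBd n t)) (h2 : (x + 1, y) ∈ region (stripBd n t))
    (h3 : (x, y) ∈ region (stripBd n t)) (h4 : (x, y + 1) ∈ region (stripBd n t)) :
    H (x - 1, y + 1) + H (x + 1, y) < H (x, y) + H (x, y + 1) := by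
  have h0 : 0 ≤ (s : ℤ) * n := by positivity
  have b := bend_rhombus1 (n := n) (x := x) (by omega) y
  rw [ediv_eq_of_mem (s := s + 1) (by push_cast; rw [add_one_mul]; omega)
    (by push_cast; rw [add_one_mul]; omega), ediv_eq_of_mem (s := s) (by omega) (by omega)] at b
  have b := congrArg (fun z : ℤ => (N : ℝ) * (z : ℝ)) b
  push_cast at b
  linarith [abs_le.1 (hH _ h1), abs_le.1 (hH _ h2), abs_le.1 (hH _ h3), abs_le.1 (hH _ h4)]

theorem kink_rhombus2 (hn : 1 ≤ n) (hH : ∀ v ∈ region (stripBd n t), |H v - N * bend n v| ≤ R)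
    (hN : 4 * R < N) {s : ℕ} {x y : ℤ} (hx : x + y + 1 = s * n + n)
    (h1 : (x, y) ∈ region (stripBd n t)) (h2 : (x + 1, y + 1) ∈ region (stripBd n t))
    (h3 : (x + 1, y) ∈ region (stripBd n t)) (h4 : (x, y + 1) ∈ region (stripBd n t)) :
    H (x, y) + H (x + 1, y + 1) < H (x + 1, y) + H (x, y + 1) := by
  have h0 : 0 ≤ (s : ℤ) * n := by positivity
  have b := bend_rhombus2 (n := n) (x := x) (y := y) (by omega)
  rw [ediv_eq_of_mem (s := s + 1) (by push_cast; rw [add_one_mul]; omega)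
    (by push_cast; rw [add_one_mul]; omega), ediv_eq_of_mem (s := s) (by omega) (by omega)] at b
  have b := congrArg (fun z : ℤ => (N : ℝ) * (z : ℝ)) b
  push_cast at b
  linarith [abs_le.1 (hH _ h1), abs_le.1 (hH _ h2), abs_le.1 (hH _ h3), abs_le.1 (hH _ h4)]

end Kinks

theorem strip_isHive (hn : 1 ≤ n) (ht : 1 ≤ t) {G : ℕ → ℤ → ℤ → ℝ}
    (hG : ∀ j, ∀ i : ℤ, 0 ≤ i → i ≤ n → G j n i = G (j + 1) i 0) (hT : ∀ j < t, IsTile n (G j))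
    {N : ℕ} {R : ℝ} (hN : 4 * R < N)
    (hR : ∀ j < t, ∀ k i : ℤ, 0 ≤ i → i ≤ k → k ≤ n → |G j k i| ≤ R) :
    IsHive (stripBd n t) fun v => glue n G v + N * bend n v := by
  have hb : ∀ v ∈ region (stripBd n t), |glue n G v + N * bend n v - N * bend n v| ≤ R := by
    intro v hv
    obtain ⟨j, hj, k, i, h1, h2, h3, rfl⟩ := exists_pt hn ht hv
    rw [add_sub_cancel_right, glue_pt hn hG j h1 h2 h3]
    exact hR j hj k i h1 h2 h3
  refine isHive_of_rhombi (fun x y a b => ?_) (fun x y a b => ?_) (fun x y a b => ?_)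
  · have e := congrArg (fun z : ℤ => (N : ℝ) * (z : ℝ)) (bend_rhombus0 (n := n) x y)
    push_cast at e
    rw [mem_strip hn ht] at a b
    obtain ⟨s, h1, h2⟩ := exists_strip hn a.1
    suffices glue n G (x, y + 1) + glue n G (x + 1, y - 1) ≤
        glue n G (x, y) + glue n G (x + 1, y) by
      linarith
    by_cases hxy : x + y + 1 ≤ s * n + n
    · have T := (hT (2 * s) (even_lt (by omega) b.2.2.1)).rh1 (x + y - s * n) (x - s * n)
        (by omega) (by omega) (by omega)
      rw [glue_even hn hG (s := s), glue_even hn hG (s := s), glue_even hn hG (s := s),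
        glue_even hn hG (s := s)] <;> try omega
      ring_nf at T ⊢
      linarith
    · have T := (hT (2 * s + 1)
        (odd_lt (n := n) (s := s) (x := x + 1) (y := y) (by omega) b.2.2.1 (by omega)
        (by omega))).rh1 (x - s * n) (x + y - s * n - n) (by omega) (by omega) (by omega)
      rw [glue_odd hn hG (s := s), glue_odd hn hG (s := s), glue_odd hn hG (s := s),
        glue_odd hn hG (s := s)] <;> try omega
      ring_nf at T ⊢
      linarith
  · have am := a
    have bm := b
    rw [mem_strip hn ht] at a b
    obtain ⟨s, h1, h2⟩ := exists_strip hn (x := x) (by omega)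
    rcases h1.eq_or_lt with h1 | h1
    · have hs : s ≠ 0 := by rintro rfl; simp at h1; omega
      obtain ⟨s, rfl⟩ := Nat.exists_eq_succ_of_ne_zero hs
      refine (kink_rhombus1 hn hb hN (s := s) (by rw [← h1]; push_cast; ring) am bm ?_ ?_).le <;>
        rw [mem_strip hn ht] <;> omega
    · have e := congrArg (fun z : ℤ => (N : ℝ) * (z : ℝ))
        (bend_rhombus1 (n := n) (x := x) (by omega) y)
      rw [ediv_eq_of_mem h1.le h2, ediv_eq_of_mem (s := s) (by omega) (by omega), sub_self,
        add_zero] at e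
      push_cast at e
      suffices glue n G (x - 1, y + 1) + glue n G (x + 1, y) ≤
        glue n G (x, y) + glue n G (x, y + 1) by linarith
      by_cases hxy : x + y + 1 ≤ s * n + n
      · have T := (hT (2 * s) (even_lt h1 (by omega))).rh2 (x + y - s * n) (x - s * n - 1)
          (by omega) (by omega) (by omega)
        rw [glue_even hn hG (s := s), glue_even hn hG (s := s), glue_even hn hG (s := s),
          glue_even hn hG (s := s)] <;> try omega
        ring_nf at T ⊢
        linarith
      · have T := (hT (2 * s + 1) (odd_lt (n := n) (s := s) (x := x + 1) (y := y) (by omega) b.2.2.1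
          (by omega) (by omega))).rh3 (x - s * n - 1) (x + y - s * n - n) (by omega) (by omega)
          (by omega)
        rw [glue_odd hn hG (s := s), glue_odd hn hG (s := s), glue_odd hn hG (s := s),
          glue_odd hn hG (s := s)] <;> try omega
        ring_nf at T ⊢
        linarith
  · have am := a
    have bm := b
    rw [mem_strip hn ht] at a b
    obtain ⟨s, h1, h2⟩ := exists_strip hn (x := x) (by omega)
    have s0 : 0 ≤ (s : ℤ) * n := by positivity
    rcases lt_trichotomy (x + y + 1) (s * n + n) with hxy | hxy | hxy
    · have e := congrArg (fun z : ℤ => (N : ℝ) * (z : ℝ))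
        (bend_rhombus2 (n := n) (x := x) (y := y) (by omega))
      rw [ediv_eq_of_mem (s := s) (by omega) (by omega),
        ediv_eq_of_mem (s := s) (by omega) (by omega), sub_self, add_zero] at e
      push_cast at e
      suffices glue n G (x, y) + glue n G (x + 1, y + 1) ≤
        glue n G (x + 1, y) + glue n G (x, y + 1) by linarith
      have T := (hT (2 * s)
          (even_lt (n := n) (s := s) (x := x + 1) (by omega) (by omega))).rh3 (x + y - s * n)
        (x - s * n) (by omega) (by omega) (by omega)
      rw [glue_even hn hG (s := s), glue_even hn hG (s := s), glue_even hn hG (s := s),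
        glue_even hn hG (s := s)] <;> try omega
      ring_nf at T ⊢
      linarith
    · refine (kink_rhombus2 hn hb hN (s := s) hxy am bm ?_ ?_).le <;>
        rw [mem_strip hn ht] <;> omega
    · have e := congrArg (fun z : ℤ => (N : ℝ) * (z : ℝ))
        (bend_rhombus2 (n := n) (x := x) (y := y) (by omega))
      rw [ediv_eq_of_mem (s := s + 1) (by push_cast; rw [add_one_mul]; omega)
          (by push_cast; rw [add_one_mul]; omega),
        ediv_eq_of_mem (s := s + 1) (by push_cast; rw [add_one_mul]; omega)
          (by push_cast; rw [add_one_mul]; omega), sub_self, add_zero] at e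
      push_cast at e
      suffices glue n G (x, y) + glue n G (x + 1, y + 1) ≤
        glue n G (x + 1, y) + glue n G (x, y + 1) by linarith
      have T := (hT (2 * s + 1)
          (odd_lt (n := n) (s := s) (x := x + 1) (y := y + 1) (by omega) (by omega)
        (by omega) (by omega))).rh2 (x - s * n) (x + y - s * n - n) (by omega) (by omega) (by omega)
      rw [glue_odd hn hG (s := s), glue_odd hn hG (s := s), glue_odd hn hG (s := s),
        glue_odd hn hG (s := s)] <;> try omega
      ring_nf at T ⊢
      linarith

end LRRule

namespace LRRule

open HexHive

variable {n t : ℕ}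

theorem isTile_of_isHive (hn : 1 ≤ n) {h : ℤ × ℤ → ℝ} (H : IsHive (stripBd n t) h) (N : ℕ) {j : ℕ}
    (hj : j < t) : IsTile n fun k i => h (pt n j k i) - N * bend n (pt n j k i) := by
  obtain ⟨s, rfl | rfl⟩ : ∃ s, j = 2 * s ∨ j = 2 * s + 1 := ⟨j / 2, by omega⟩
  · have s0 : 0 ≤ (s : ℤ) * n := by positivity
    refine ⟨fun k i h1 h2 h3 => ?_, fun k i h1 h2 h3 => ?_, fun k i h1 h2 h3 => ?_⟩ <;>
      simp only [pt_even]
    · have e := congrArg (fun z : ℤ => (N : ℝ) * (z : ℝ))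
        (bend_rhombus0 (n := n) (s * n + i) (k - i))
      have r := H.rhombus0 (s * n + i) (k - i) (mem_even hn hj (by omega) (by omega) (by omega))
        (mem_even hn hj (by omega) (by omega) (by omega))
      push_cast at e
      ring_nf at e r ⊢
      linarith
    · have e := congrArg (fun z : ℤ => (N : ℝ) * (z : ℝ))
        (bend_rhombus1 (n := n) (x := s * n + (i + 1)) (by omega) (k - (i + 1)))
      rw [ediv_eq_of_mem (s := s) (by omega) (by omega),
        ediv_eq_of_mem (s := s) (by omega) (by omega), sub_self, add_zero] at e
      have r := H.rhombus1 (s * n + (i + 1)) (k - (i + 1))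
        (mem_even hn hj (by omega) (by omega) (by omega))
        (mem_even hn hj (by omega) (by omega) (by omega))
      push_cast at e
      ring_nf at e r ⊢
      linarith
    · have e := congrArg (fun z : ℤ => (N : ℝ) * (z : ℝ))
        (bend_rhombus2 (n := n) (x := s * n + i) (y := k - i) (by omega))
      rw [ediv_eq_of_mem (s := s) (by omega) (by omega),
        ediv_eq_of_mem (s := s) (by omega) (by omega), sub_self, add_zero] at e
      have r := H.rhombus2 (s * n + i) (k - i)
        (mem_even hn hj (by omega) (by omega) (by omega))
        (mem_even hn hj (by omega) (by omega) (by omega))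
      push_cast at e
      ring_nf at e r ⊢
      linarith
  · have s0 : 0 ≤ (s : ℤ) * n := by positivity
    have s1 : ((s + 1 : ℕ) : ℤ) * n = s * n + n := by push_cast; ring
    refine ⟨fun k i h1 h2 h3 => ?_, fun k i h1 h2 h3 => ?_, fun k i h1 h2 h3 => ?_⟩ <;>
      simp only [pt_odd]
    · have e := congrArg (fun z : ℤ => (N : ℝ) * (z : ℝ))
        (bend_rhombus0 (n := n) (s * n + k) (n - k + i))
      have r := H.rhombus0 (s * n + k) (n - k + i) (mem_odd hn hj (by omega) (by omega) (by omega))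
        (mem_odd hn hj (by omega) (by omega) (by omega))
      push_cast at e
      ring_nf at e r ⊢
      linarith
    · have e := congrArg (fun z : ℤ => (N : ℝ) * (z : ℝ))
        (bend_rhombus2 (n := n) (x := s * n + k) (y := n - k + i) (by omega))
      rw [ediv_eq_of_mem (s := s + 1) (by omega) (by omega),
        ediv_eq_of_mem (s := s + 1) (by omega) (by omega), sub_self, add_zero] at e
      have r := H.rhombus2 (s * n + k) (n - k + i)
        (mem_odd hn hj (by omega) (by omega) (by omega))
        (mem_odd hn hj (by omega) (by omega) (by omega))
      push_cast at e
      ring_nf at e r ⊢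
      linarith
    · have e := congrArg (fun z : ℤ => (N : ℝ) * (z : ℝ))
        (bend_rhombus1 (n := n) (x := s * n + (k + 1)) (by omega) (n - (k + 1) + i))
      rw [ediv_eq_of_mem (s := s) (by omega) (by omega),
        ediv_eq_of_mem (s := s) (by omega) (by omega), sub_self, add_zero] at e
      have r := H.rhombus1 (s * n + (k + 1)) (n - (k + 1) + i)
        (mem_odd hn hj (by omega) (by omega) (by omega))
        (mem_odd hn hj (by omega) (by omega) (by omega))
      push_cast at e
      ring_nf at e r ⊢
      linarith

theorem border_left (k : ℤ) : ∃ e, lf e (pt n 0 k 0) = stripBd n t e :=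
  ⟨3, by simp [pt, lf, stripBd]⟩

theorem border_base (j : ℕ) (k : ℤ) : ∃ e, lf e (pt n j k k) = stripBd n t e := by
  obtain ⟨s, rfl | rfl⟩ : ∃ s, j = 2 * s ∨ j = 2 * s + 1 := ⟨j / 2, by omega⟩
  · exact ⟨5, by rw [pt_even]; simp [lf, stripBd]⟩
  · exact ⟨2, by rw [pt_odd]; simp [lf, stripBd]⟩

theorem border_right (j : ℕ) (i : ℤ) : ∃ e, lf e (pt n j n i) = stripBd n (j + 1) e := by
  obtain ⟨s, rfl | rfl⟩ : ∃ s, j = 2 * s ∨ j = 2 * s + 1 := ⟨j / 2, by omega⟩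
  · refine ⟨1, ?_⟩
    rw [pt_even, stripBd, show (2 * s + 1) / 2 = s by omega]
    simp only [lf, Matrix.cons_val]
    ring
  · refine ⟨0, ?_⟩
    rw [pt_odd, stripBd, show (2 * s + 1 + 1 + 1) / 2 = s + 1 by omega]
    simp only [lf, Matrix.cons_val]
    push_cast
    ring

theorem border_cases (hn : 1 ≤ n) (t : ℕ) {v : ℤ × ℤ} (hv : v ∈ region (stripBd n (t + 1)))
    {e : Fin 6} (he : lf e v = stripBd n (t + 1) e) :
    (∃ k : ℤ, 0 ≤ k ∧ k ≤ n ∧ v = pt n 0 k 0) ∨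
      (∃ j < t + 1, ∃ k : ℤ, 0 ≤ k ∧ k ≤ n ∧ v = pt n j k k) ∨
      ∃ i : ℤ, 0 ≤ i ∧ i ≤ n ∧ v = pt n t n i := by
  obtain ⟨x, y⟩ := v
  rw [mem_strip hn (by omega)] at hv
  obtain ⟨hx, hy, h0, h2, h1⟩ := hv
  have left : x = 0 → ∃ k : ℤ, 0 ≤ k ∧ k ≤ n ∧ (x, y) = pt n 0 k 0 := fun h =>
    ⟨y, hy, h2, by simp [pt, h]⟩
  have right : lf 0 (x, y) = stripBd n (t + 1) 0 ∨ lf 1 (x, y) = stripBd n (t + 1) 1 →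
      ∃ i : ℤ, 0 ≤ i ∧ i ≤ n ∧ (x, y) = pt n t n i := by
    obtain ⟨T, rfl | rfl⟩ : ∃ T, t = 2 * T ∨ t = 2 * T + 1 := ⟨t / 2, by omega⟩
    · rw [show (2 * T + 1) / 2 = T by omega] at h1
      rw [show (2 * T + 1 + 1) / 2 = T + 1 by omega] at h0
      rw [stripBd, show (2 * T + 1) / 2 = T by omega, show (2 * T + 1 + 1) / 2 = T + 1 by omega]
      simp only [lf, Matrix.cons_val, Nat.cast_succ, add_one_mul] at h0 h1 ⊢
      refine fun h => ⟨x - T * n, by omega, by omega, ?_⟩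
      rw [pt_even]
      ext <;> simp only <;> omega
    · rw [show (2 * T + 1 + 1) / 2 = T + 1 by omega] at h1
      rw [show (2 * T + 1 + 1 + 1) / 2 = T + 1 by omega] at h0
      rw [stripBd, show (2 * T + 1 + 1) / 2 = T + 1 by omega,
        show (2 * T + 1 + 1 + 1) / 2 = T + 1 by omega]
      simp only [lf, Matrix.cons_val, Nat.cast_succ, add_one_mul] at h0 h1 ⊢
      refine fun h => ⟨y, hy, h2, ?_⟩
      rw [pt_odd]
      ext <;> simp only <;> omega
  rcases fin6_cases e with rfl | rfl | rfl | rfl | rfl | rfl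
  · exact Or.inr (Or.inr (right (Or.inl he)))
  · exact Or.inr (Or.inr (right (Or.inr he)))
  · rcases hx.eq_or_lt with hx | hx
    · exact Or.inl (left hx.symm)
    · obtain ⟨s, a, b⟩ := exists_strip hn (x := x - 1) (by omega)
      have he : y = n := he
      refine Or.inr (Or.inl ⟨2 * s + 1, odd_lt (n := n) (s := s) (x := x) (y := y) (by omega) h0
        (by omega) h1, x - s * n, by omega, by omega, ?_⟩)
      rw [pt_odd]
      ext <;> simp only <;> omega
  · exact Or.inl (left (by simpa [lf, stripBd] using he))
  · exact Or.inl (left (by simp [lf, stripBd] at he; omega))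
  · rcases hx.eq_or_lt with hx | hx
    · exact Or.inl (left hx.symm)
    · obtain ⟨s, a, b⟩ := exists_strip hn (x := x - 1) (by omega)
      have he : y = 0 := by simpa [lf, stripBd] using he
      refine Or.inr (Or.inl ⟨2 * s, even_lt (n := n) (s := s) (x := x) (by omega) h0, x - s * n,
        by omega, by omega, ?_⟩)
      rw [pt_even]
      ext <;> simp only <;> omega

end LRRule

namespace LRRule

open HexHive

variable {n t : ℕ}

/-- The last unit edge on the right side of the `j`-th tile. -/
def lastEdge (n j : ℕ) : (ℤ × ℤ) × Fin 6 := (pt n j n (n - 1), if j % 2 = 0 then 5 else 1)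

theorem lastEdge_even (s : ℕ) : lastEdge n (2 * s) =
    (((s : ℤ) * n + (n - 1), (n : ℤ) - (n - 1)), 5) := by
  rw [lastEdge, pt_even, if_pos (by omega)]

theorem lastEdge_odd (s : ℕ) : lastEdge n (2 * s + 1) =
    (((s : ℤ) * n + n, (n : ℤ) - n + (n - 1)), 1) := by
  rw [lastEdge, pt_odd, if_neg (by omega)]

theorem lastEdge_add (j : ℕ) : (lastEdge n j).1 + dir (lastEdge n j).2 = pt n j n n := by
  obtain ⟨s, rfl | rfl⟩ : ∃ s, j = 2 * s ∨ j = 2 * s + 1 := ⟨j / 2, by omega⟩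
  · rw [lastEdge_even, add_dir5, pt_even]
    ext <;> (simp only; ring)
  · rw [lastEdge_odd, add_dir1, pt_odd]
    ext <;> simp only <;> ring

theorem lastEdge_bend (hn : 1 ≤ n) {H : ℤ × ℤ → ℝ} {N : ℕ} {R : ℝ}
    (hH : ∀ v ∈ region (stripBd n t), |H v - N * bend n v| ≤ R) (hN : 4 * R < N) {j : ℕ}
    (hj : j + 1 < t) :
    (lastEdge n j).1 + dir ((lastEdge n j).2 + 1) ∈ region (stripBd n t) ∧
      (lastEdge n j).1 + dir ((lastEdge n j).2 + 5) ∈ region (stripBd n t) ∧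
      0 < slack H (lastEdge n j).2 (lastEdge n j).1 := by
  obtain ⟨s, rfl | rfl⟩ : ∃ s, j = 2 * s ∨ j = 2 * s + 1 := ⟨j / 2, by omega⟩
  · have e1 : (n : ℤ) - (n - 1) = 1 := by ring
    have e2 : (s : ℤ) * n + (n - 1) + 1 = s * n + n := by ring
    have m1 : ((s : ℤ) * n + n, (1 : ℤ)) ∈ region (stripBd n t) :=
      mem_odd hn hj (by omega) (by omega) (by omega)
    have m2 : ((s : ℤ) * n + (n - 1), (0 : ℤ)) ∈ region (stripBd n t) :=
      mem_even hn (s := s) (by omega) (by omega) (by omega) (by omega)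
    have h := kink_rhombus2 (x := s * n + (n - 1)) (y := 0) hn hH hN (s := s) (by omega) m2
      (by rw [e2]; exact m1) (mem_even hn (s := s) (by omega) (by omega) (by omega) (by omega))
      (mem_even hn (s := s) (by omega) (by omega) (by omega) (by omega))
    rw [e2, zero_add] at h
    rw [lastEdge_even, slack, show (5 + 1 : Fin 6) = 0 from rfl, show (5 + 5 : Fin 6) = 4 from rfl,
      add_dir0, add_dir4, add_dir5, e1, e2, sub_self]
    exact ⟨m1, m2, by linarith⟩
  · have e1 : (n : ℤ) - n + (n - 1) = n - 1 := by ring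
    have e2 : (n : ℤ) - 1 + 1 = n := by ring
    have e3 : ((s + 1 : ℕ) : ℤ) * n = s * n + n := by push_cast; ring
    have m1 : ((s : ℤ) * n + n - 1, (n : ℤ)) ∈ region (stripBd n t) :=
      mem_odd hn (s := s) (by omega) (by omega) (by omega) (by omega)
    have m2 : ((s : ℤ) * n + n + 1, (n : ℤ) - 1) ∈ region (stripBd n t) :=
      mem_even hn (s := s + 1) (by omega) (by omega) (by omega) (by omega)
    have h := kink_rhombus1 (x := s * n + n) (y := n - 1) hn hH hN (s := s) rfl
      (by rw [e2]; exact m1) m2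
      (mem_odd hn (s := s) (by omega) (by omega) (by omega) (by omega))
      (mem_odd hn (s := s) (by omega) (by omega) (by omega) (by omega))
    rw [e2] at h
    rw [lastEdge_odd, slack, show (1 + 1 : Fin 6) = 2 from rfl, show (1 + 5 : Fin 6) = 0 from rfl,
      add_dir0, add_dir1, add_dir2, e1, e2]
    exact ⟨m1, m2, by linarith⟩

/-- Saturation for chains of hives with integral outer boundary. -/
theorem exists_int_chain (hn : 1 ≤ n) (t : ℕ) {G : ℕ → ℤ → ℤ → ℝ}
    (hG : ∀ j, ∀ i : ℤ, 0 ≤ i → i ≤ n → G j n i = G (j + 1) i 0)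
    (hT : ∀ j < t + 1, IsTile n (G j)) (hpos : ∀ j < t, G j n (n - 1) ≤ G j n n)
    (hl : ∀ k : ℤ, 0 ≤ k → k ≤ n → IsInt (G 0 k 0))
    (hb : ∀ j < t + 1, ∀ k : ℤ, 0 ≤ k → k ≤ n → IsInt (G j k k))
    (hr : ∀ i : ℤ, 0 ≤ i → i ≤ n → IsInt (G t n i)) :
    ∃ X : ℕ → ℤ → ℤ → ℤ, (∀ j < t + 1, IsTile n fun k i => X j k i) ∧
      (∀ j i, X j n i = X (j + 1) i 0) ∧ (∀ j < t, X j n (n - 1) ≤ X j n n) ∧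
      (∀ k : ℤ, 0 ≤ k → k ≤ n → (X 0 k 0 : ℝ) = G 0 k 0) ∧
      (∀ j < t + 1, ∀ k : ℤ, 0 ≤ k → k ≤ n → (X j k k : ℝ) = G j k k) ∧
      ∀ i : ℤ, 0 ≤ i → i ≤ n → (X t n i : ℝ) = G t n i := by
  classical
  obtain ⟨R, hR⟩ := exists_tile_bound (n := n) G (t + 1)
  obtain ⟨N, hN⟩ := exists_nat_gt (4 * R)
  have ht : 1 ≤ t + 1 := by omega
  set A := stripBd n (t + 1) with hA
  set b : ℤ × ℤ → ℝ := fun v => glue n G v + N * bend n v with hbdef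
  set E := (Finset.range t).image (lastEdge n) with hEdef
  set c : (ℤ × ℤ) × Fin 6 → ℤ := fun e => N * (bend n (e.1 + dir e.2) - bend n e.1) with hc
  have res : ∀ h : ℤ × ℤ → ℝ, IsHive A h →
      (∀ v ∈ region A, ∀ k, lf k v = A k → h v = b v) →
      (∀ k : ℤ, 0 ≤ k → k ≤ n → h (pt n 0 k 0) - N * bend n (pt n 0 k 0) = G 0 k 0) ∧
      (∀ j < t + 1, ∀ k : ℤ, 0 ≤ k → k ≤ n →
        h (pt n j k k) - N * bend n (pt n j k k) = G j k k) ∧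
      (∀ i : ℤ, 0 ≤ i → i ≤ n → h (pt n t n i) - N * bend n (pt n t n i) = G t n i) := by
    intro h _ hbd
    refine ⟨fun k h1 h2 => ?_, fun j hj k h1 h2 => ?_, fun i h1 h2 => ?_⟩
    · obtain ⟨e, he⟩ := border_left (n := n) (t := t + 1) k
      rw [hbd _ (pt_mem hn ht le_rfl h1 h2) e he, hbdef]
      simp only
      rw [add_sub_cancel_right, glue_pt hn hG 0 le_rfl h1 h2]
    · obtain ⟨e, he⟩ := border_base (n := n) (t := t + 1) j k
      rw [hbd _ (pt_mem hn hj h1 le_rfl h2) e he, hbdef]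
      simp only
      rw [add_sub_cancel_right, glue_pt hn hG j h1 le_rfl h2]
    · obtain ⟨e, he⟩ := border_right (n := n) t i
      rw [hbd _ (pt_mem hn (Nat.lt_succ_self t) h1 h2 le_rfl) e he, hbdef]
      simp only
      rw [add_sub_cancel_right, glue_pt hn hG t h1 h2 le_rfl]
  have bdd : ∀ h : ℤ × ℤ → ℝ, IsHive A h →
      (∀ v ∈ region A, ∀ k, lf k v = A k → h v = b v) →
      ∀ v ∈ region A, |h v - N * bend n v| ≤ R := by
    intro h hh hbd v hv
    obtain ⟨h1, h2, h3⟩ := res h hh hbd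
    obtain ⟨j, hj, k, i, hi, hik, hk, rfl⟩ := exists_pt hn ht hv
    exact hR (fun j k i => h (pt n j k i) - N * bend n (pt n j k i))
      (fun j hj => isTile_of_isHive hn hh N hj) h1 h2
      (fun j _ i _ _ => by simp only [pt_succ]) j hj k i hi hik hk
  obtain ⟨C, hC⟩ := ((finite_region A).image fun v => |(N : ℝ) * bend n v|).bddAbove
  have hGR := hR G hT (fun _ _ _ => rfl) (fun _ _ _ _ _ => rfl) fun j _ => hG j
  have bhive : IsHive A b := strip_isHive hn ht hG hT hN hGR
  have key := exists_integral_mem (A := A) (b := b) (E := E) (c := c) (R := R + C)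
    (stripBd_quad hn ht) ?_ ?_ ?_ ?_
  · obtain ⟨h, ⟨-, h2, h3, h4⟩, h_int⟩ := key
    obtain ⟨r1, r2, r3⟩ := res h h3 h2
    have T := fun j hj => isTile_of_isHive (j := j) hn h3 N hj
    have hz : ∀ v, v ∈ region A → ∃ m : ℤ, h v = m := h_int
    choose! z hz using hz
    have hX : ∀ j < t + 1, ∀ k i : ℤ, 0 ≤ i → i ≤ k → k ≤ n →
        ((z (pt n j k i) - N * bend n (pt n j k i) : ℤ) : ℝ) =
          h (pt n j k i) - N * bend n (pt n j k i) := by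
      intro j hj k i h1 h2 h3
      rw [hz _ (pt_mem hn hj h1 h2 h3)]
      push_cast
      ring
    refine ⟨fun j k i => z (pt n j k i) - N * bend n (pt n j k i), fun j hj => ?_, fun j i => ?_,
      fun j hj => ?_, fun k a1 a2 => ?_, fun j hj k a1 a2 => ?_, fun i a1 a2 => ?_⟩
    · refine ⟨fun k i a1 a2 a3 => ?_, fun k i a1 a2 a3 => ?_, fun k i a1 a2 a3 => ?_⟩
      · have := (T j hj).rh1 k i a1 a2 a3
        rwa [← hX j hj, ← hX j hj, ← hX j hj, ← hX j hj] at this <;> omega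
      · have := (T j hj).rh2 k i a1 a2 a3
        rwa [← hX j hj, ← hX j hj, ← hX j hj, ← hX j hj] at this <;> omega
      · have := (T j hj).rh3 k i a1 a2 a3
        rwa [← hX j hj, ← hX j hj, ← hX j hj, ← hX j hj] at this <;> omega
    · simp only [pt_succ]
    · have e := h4 (lastEdge n j) (Finset.mem_image_of_mem _ (Finset.mem_range.2 hj))
      simp only [hc] at e
      rw [lastEdge_add] at e
      have e1 := hX j (by omega) n (n - 1) (by omega) (by omega) le_rfl
      have e2 := hX j (by omega) n n (by omega) le_rfl le_rfl
      rw [← Int.cast_le (R := ℝ), e1, e2]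
      simp only [lastEdge] at e
      push_cast at e
      linarith
    · rw [hX 0 (by omega) k 0 le_rfl a1 a2]
      exact r1 k a1 a2
    · rw [hX j hj k k a1 le_rfl a2]
      exact r2 j hj k a1 a2
    · rw [hX t (by omega) n i a1 a2 le_rfl]
      exact r3 i a1 a2
  · rintro h ⟨-, h2, h3, -⟩ v hv
    have e1 := bdd h h3 h2 v hv
    have e2 := hC (Set.mem_image_of_mem _ hv)
    have e3 := abs_add_le (h v - N * bend n v) (N * bend n v)
    rw [sub_add_cancel] at e3
    linarith
  · refine ⟨fun v => if v ∈ region A then b v else 0, fun v hv => if_neg hv,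
      fun v hv _ _ => if_pos hv, fun k v a1 a2 => ?_, fun e he => ?_⟩
    · rw [slack_congr (h' := b) (fun v hv => if_pos hv) a1 a2]
      exact bhive k v a1 a2
    · obtain ⟨j, hj, rfl⟩ := Finset.mem_image.1 he
      rw [Finset.mem_range] at hj
      have p := hpos j hj
      have m1 : pt n j n (n - 1) ∈ region A :=
        pt_mem hn (by omega) (by omega) (by omega) le_rfl
      have m2 : pt n j n n ∈ region A := pt_mem hn (by omega) (by omega) le_rfl le_rfl
      rw [lastEdge_add]
      simp only [hc]
      rw [lastEdge_add]
      simp only [lastEdge, if_pos m1, if_pos m2, hbdef]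
      rw [glue_pt hn hG j (k := n) (i := n - 1) (by omega) (by omega) le_rfl,
        glue_pt hn hG j (k := n) (i := n) (by omega) le_rfl le_rfl]
      push_cast
      linarith
  · intro v hv e he
    have hbend : IsInt ((N : ℝ) * bend n v) := ⟨N * bend n v, by push_cast; rfl⟩
    refine IsInt.add ?_ hbend
    rcases border_cases hn t hv he with
      ⟨k, h1, h2, rfl⟩ | ⟨j, hj, k, h1, h2, rfl⟩ | ⟨i, h1, h2, rfl⟩
    · rw [glue_pt hn hG 0 le_rfl h1 h2]
      exact hl k h1 h2
    · rw [glue_pt hn hG j h1 le_rfl h2]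
      exact hb j hj k h1 h2
    · rw [glue_pt hn hG t h1 h2 le_rfl]
      exact hr i h1 h2
  · rintro h ⟨-, h2, h3, -⟩ e he
    obtain ⟨j, hj, rfl⟩ := Finset.mem_image.1 he
    rw [Finset.mem_range] at hj
    exact lastEdge_bend hn (bdd h h3 h2) hN (by omega)

end LRRule

namespace LRRule

open HexHive

variable {n : ℕ}

theorem IsTile.shift {g : ℤ → ℤ → ℝ} (T : IsTile n g) {r : ℝ} (hr : 0 < r) (o : ℝ) :
    IsTile n fun k i => (o + g k i) / r := by
  refine ⟨fun k i a1 a2 a3 => ?_, fun k i a1 a2 a3 => ?_, fun k i a1 a2 a3 => ?_⟩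
  · rw [← add_div, ← add_div]
    have := T.rh1 k i a1 a2 a3
    exact div_le_div_of_nonneg_right (by linarith) hr.le
  · rw [← add_div, ← add_div]
    have := T.rh2 k i a1 a2 a3
    exact div_le_div_of_nonneg_right (by linarith) hr.le
  · rw [← add_div, ← add_div]
    have := T.rh3 k i a1 a2 a3
    exact div_le_div_of_nonneg_right (by linarith) hr.le

/-- The row of differences of a sequence of integers. -/
def diffRow (n : ℕ) (F : ℤ → ℤ) (i : Fin n) : ℕ := (F ((i : ℕ) + 1) - F (i : ℕ)).toNat

theorem psum_pred_le (hn : 1 ≤ n) (f : Fin n → ℕ) : psum f (n - 1) ≤ psum f n := by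
  have := psum_succ f (k := (n : ℤ) - 1) (by omega)
  rw [sub_add_cancel] at this
  omega

theorem nonneg_of_concave {F : ℤ → ℤ}
    (hF : ∀ i : ℤ, 0 ≤ i → i + 2 ≤ n → F i + F (i + 2) ≤ F (i + 1) + F (i + 1))
    (hpos : F (n - 1) ≤ F n) (d : ℕ) (hd : d + 1 ≤ n) :
    F (n - d - 1) ≤ F (n - d) := by
  induction d with
  | zero => simpa using hpos
  | succ d ih =>
    have h1 := ih (by omega)
    have h2 := hF (n - (d + 1) - 1) (by omega) (by omega)
    rw [show (n : ℤ) - (d + 1) - 1 + 2 = n - d by ring,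
      show (n : ℤ) - (d + 1) - 1 + 1 = n - d - 1 by ring] at h2
    push_cast
    rw [show (n : ℤ) - (d + 1) = n - d - 1 by ring] at h2 ⊢
    linarith

theorem diffRow_cast {F : ℤ → ℤ}
    (hF : ∀ i : ℤ, 0 ≤ i → i + 2 ≤ n → F i + F (i + 2) ≤ F (i + 1) + F (i + 1))
    (hpos : F (n - 1) ≤ F n) (i : Fin n) :
    (diffRow n F i : ℤ) = F ((i : ℕ) + 1) - F (i : ℕ) := by
  have h := nonneg_of_concave hF hpos (n - 1 - i) (by omega)
  rw [show (n : ℤ) - ((n - 1 - i : ℕ) : ℤ) = (i : ℕ) + 1 by omega, add_sub_cancel_right] at h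
  rw [diffRow]
  omega

theorem antitone_diffRow {F : ℤ → ℤ}
    (hF : ∀ i : ℤ, 0 ≤ i → i + 2 ≤ n → F i + F (i + 2) ≤ F (i + 1) + F (i + 1)) :
    Antitone (diffRow n F) := by
  obtain _ | n := n
  · exact fun i => i.elim0
  refine Fin.antitone_iff_succ_le.2 fun i => Int.toNat_le_toNat ?_
  have := hF (i : ℕ) (by omega) (by omega)
  simp only [Fin.val_succ, Fin.val_castSucc]
  push_cast
  rw [add_assoc, one_add_one_eq_two]
  linarith

theorem psum_diffRow {F : ℤ → ℤ}
    (hF : ∀ i : ℤ, 0 ≤ i → i + 2 ≤ n → F i + F (i + 2) ≤ F (i + 1) + F (i + 1))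
    (hpos : F (n - 1) ≤ F n) {k : ℤ} (h0 : 0 ≤ k) (hk : k ≤ n) :
    psum (diffRow n F) k = F k - F 0 := by
  refine ((psum_eq_iff (diffRow n F) (fun k => F k - F 0) (sub_self _)).2
    (fun i => ?_) k h0 hk).symm
  rw [diffRow_cast hF hpos]
  ring

theorem psum_injective {f g : Fin n → ℕ} (h : ∀ k : ℤ, 0 ≤ k → k ≤ n → psum f k = psum g k) :
    f = g := by
  funext i
  have h1 := (psum_eq_iff g (psum f) (psum_zero f)).1 h i
  have h2 := (psum_eq_iff f (psum f) (psum_zero f)).1 (fun _ _ _ => rfl) i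
  omega

/-- The values on a chain of hives glued along their common sides, scaled by `r`. -/
def chainVal (n t r : ℕ) (ν : ℕ → Fin n → ℕ) (g : ℕ → ℤ → ℤ → ℤ) (j : ℕ) (k i : ℤ) : ℝ :=
  if j < t then (((∑ l ∈ Finset.range j, psum (ν l) n : ℤ) : ℝ) + (g j k i : ℝ)) / r
  else ((∑ l ∈ Finset.range t, psum (ν l) n + psum (ν t) (if j = t then k else n) : ℤ) : ℝ) / r

theorem HasTiles.of_smul (hn : 1 ≤ n) {m : ℕ} (hm : 3 ≤ m) {lam : ℕ → Fin n → ℕ}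
    (hlam : ∀ i, 1 ≤ i → i ≤ m → Antitone (lam i)) {r : ℕ} (hr : 1 ≤ r)
    (h : HasTiles n m fun i j => r * lam i j) : HasTiles n m lam := by
  obtain ⟨t, rfl⟩ : ∃ t, m = t + 3 := ⟨m - 3, by omega⟩
  have hm2 : t + 3 - 2 = t + 1 := by omega
  obtain ⟨ν, hν0, hνt, -, hg⟩ := h
  rw [hm2] at hνt hg
  choose! g hT hB using hg
  set o : ℕ → ℤ := fun j => ∑ l ∈ Finset.range j, psum (ν l) n with ho
  have ho' : ∀ j, o (j + 1) = o j + psum (ν j) n := fun j => Finset.sum_range_succ _ _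
  have hr0 : (0 : ℝ) < r := by exact_mod_cast hr
  have hdiv : ∀ j ≤ t + 1, ∃ c : ℤ, o j = r * c := by
    intro j
    induction j using Nat.twoStepInduction with
    | zero => exact fun _ => ⟨0, by simp [ho]⟩
    | one => exact fun _ => ⟨psum (lam 1) n, by rw [ho', hν0, psum_smul]; simp [ho]⟩
    | more j ih _ =>
      intro hj
      obtain ⟨c, hc⟩ := ih (by omega)
      refine ⟨c + psum (lam (j + 2)) n, ?_⟩
      have B := hB j (by omega)
      have e1 := B.right n (by omega) le_rfl
      have e2 := B.base n (by omega) le_rfl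
      rw [psum_smul] at e2
      rw [ho', ho', hc]
      linarith
  set G := chainVal n (t + 1) r ν g with hGdef
  have G1 : ∀ j < t + 1, ∀ k i, G j k i = ((o j : ℝ) + (g j k i : ℝ)) / r := fun j hj k i => by
    rw [hGdef, chainVal, if_pos hj]
  have G2 : ∀ k i, G (t + 1) k i = ((o (t + 1) + psum (ν (t + 1)) k : ℤ) : ℝ) / r := fun k i => by
    rw [hGdef, chainVal, if_neg (lt_irrefl _), if_pos rfl]
  have G3 : ∀ j, t + 1 < j → ∀ k i,
      G j k i = ((o (t + 1) + psum (ν (t + 1)) n : ℤ) : ℝ) / r := fun j hj k i => by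
    rw [hGdef, chainVal, if_neg (by omega), if_neg (by omega)]
  have Gr : ∀ j < t + 1, ∀ i : ℤ, 0 ≤ i → i ≤ n →
      G j n i = ((o (j + 1) + psum (ν (j + 1)) i : ℤ) : ℝ) / r := by
    intro j hj i h1 h2
    rw [G1 j hj, (hB j hj).right i h1 h2, ho']
    push_cast
    ring
  have hG : ∀ j, ∀ i : ℤ, 0 ≤ i → i ≤ n → G j n i = G (j + 1) i 0 := by
    intro j i h1 h2
    rcases lt_trichotomy j (t + 1) with hj | rfl | hj
    · rw [Gr j hj i h1 h2]
      rcases (show j + 1 ≤ t + 1 from hj).lt_or_eq with hj' | hj'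
      · rw [G1 _ hj', (hB _ hj').left i h1 h2]
        push_cast
        ring
      · rw [hj', G2]
    · rw [G2, G3 _ (Nat.lt_succ_self _)]
    · rw [G3 j hj, G3 (j + 1) (by omega)]
  have Gb : ∀ j < t + 1, ∀ k : ℤ, 0 ≤ k → k ≤ n → ∀ c : ℤ, o j = r * c →
      G j k k = ((c + psum (lam (j + 2)) k : ℤ) : ℝ) := by
    intro j hj k h1 h2 c hc
    rw [G1 j hj, (hB j hj).base k h1 h2, psum_smul, hc]
    push_cast
    field_simp
  have Gl : ∀ k : ℤ, 0 ≤ k → k ≤ n → G 0 k 0 = (psum (lam 1) k : ℝ) := by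
    intro k h1 h2
    rw [G1 0 (by omega), (hB 0 (by omega)).left k h1 h2, hν0, psum_smul]
    simp only [ho, Finset.sum_range_zero]
    push_cast
    field_simp
    ring
  have Gt : ∀ i : ℤ, 0 ≤ i → i ≤ n → ∀ c : ℤ, o (t + 1) = r * c →
      G t n i = ((c + psum (lam (t + 3)) i : ℤ) : ℝ) := by
    intro i h1 h2 c hc
    rw [Gr t (by omega) i h1 h2, hνt, psum_smul, hc]
    push_cast
    field_simp
  obtain ⟨ct, hct⟩ := hdiv (t + 1) le_rfl
  obtain ⟨X, XT, Xs, Xp, Xl, Xb, Xr⟩ := exists_int_chain hn t hG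
    (fun j hj => by
      rw [show G j = fun k i => ((o j : ℝ) + (g j k i : ℝ)) / r from
        funext fun k => funext fun i => G1 j hj k i]
      exact (hT j hj).shift hr0 _)
    (fun j hj => by
      rw [Gr j (by omega) _ (by omega) (by omega), Gr j (by omega) _ (by omega) le_rfl]
      have := psum_pred_le hn (ν (j + 1))
      gcongr)
    (fun k h1 h2 => ⟨_, Gl k h1 h2⟩)
    (fun j hj k h1 h2 => by
      obtain ⟨c, hc⟩ := hdiv j (by omega)
      exact ⟨_, Gb j hj k h1 h2 c hc⟩)
    (fun i h1 h2 => ⟨_, Gt i h1 h2 ct hct⟩)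
  have Xl' : ∀ k : ℤ, 0 ≤ k → k ≤ n → X 0 k 0 = psum (lam 1) k := fun k h1 h2 => by
    have := Xl k h1 h2
    rw [Gl k h1 h2] at this
    exact_mod_cast this
  have Xr' : ∀ i : ℤ, 0 ≤ i → i ≤ n → X t n i = ct + psum (lam (t + 3)) i := fun i h1 h2 => by
    have := Xr i h1 h2
    rw [Gt i h1 h2 ct hct] at this
    exact_mod_cast this
  have Xb' : ∀ j < t + 1, ∀ k : ℤ, 0 ≤ k → k ≤ n → X j k k - X j 0 0 = psum (lam (j + 2)) k := by
    intro j hj k h1 h2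
    obtain ⟨c, hc⟩ := hdiv j (by omega)
    have e1 := Xb j hj k h1 h2
    have e2 := Xb j hj 0 le_rfl (by omega)
    rw [Gb j hj _ h1 h2 c hc] at e1
    rw [Gb j hj 0 le_rfl (by omega) c hc, psum_zero] at e2
    have e1 : X j k k = c + psum (lam (j + 2)) k := by exact_mod_cast e1
    have e2 : X j 0 0 = c + 0 := by exact_mod_cast e2
    linarith
  have conc : ∀ j < t + 1, ∀ i : ℤ, 0 ≤ i → i + 2 ≤ n →
      X j n i + X j n (i + 2) ≤ X j n (i + 1) + X j n (i + 1) := by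
    intro j hj i h1 h2
    exact_mod_cast (XT j hj).row_concave h1 h2 le_rfl
  have last : ∀ j < t + 1, X j n (n - 1) ≤ X j n n := by
    intro j hj
    rcases (Nat.lt_succ_iff.1 hj).lt_or_eq with hj | rfl
    · exact Xp j hj
    · rw [Xr' _ (by omega) (by omega), Xr' _ (by omega) le_rfl]
      have := psum_pred_le hn (lam (j + 3))
      linarith
  set ν' : ℕ → Fin n → ℕ := fun j => if j = 0 then lam 1 else diffRow n (X (j - 1) n) with hν'
  have hs : ∀ j < t + 1, ∀ k : ℤ, 0 ≤ k → k ≤ n → psum (ν' (j + 1)) k = X j n k - X j n 0 := by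
    intro j hj k h1 h2
    simp only [hν', Nat.add_one_ne_zero, if_false, Nat.add_sub_cancel]
    exact psum_diffRow (conc j hj) (last j hj) h1 h2
  have hleft : ∀ j < t + 1, ∀ k : ℤ, 0 ≤ k → k ≤ n → X j k 0 - X j 0 0 = psum (ν' j) k := by
    rintro (_ | j) hj k h1 h2
    · rw [Xl' k h1 h2, Xl' 0 le_rfl (by omega), psum_zero, sub_zero]
      rfl
    · rw [hs j (by omega) k h1 h2, Xs, Xs]
  refine ⟨ν', rfl, ?_, fun j hj => ?_, fun j hj => ?_⟩
  · rw [hm2]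
    refine psum_injective fun k h1 h2 => ?_
    rw [hs t (by omega) k h1 h2, Xr' k h1 h2, Xr' 0 le_rfl (by omega), psum_zero]
    ring
  · obtain _ | j := j
    · exact hlam 1 le_rfl (by omega)
    · exact antitone_diffRow (conc j (by omega))
  · rw [hm2] at hj
    refine ⟨fun k i => X j k i - X j 0 0, ?_, hleft j hj, fun i h1 h2 => ?_, Xb' j hj⟩
    · simpa [sub_eq_neg_add] using (XT j hj).shift one_pos (-(X j 0 0 : ℝ))
    · rw [← hleft j hj n (by omega) le_rfl, hs j hj i h1 h2]
      ring

end LRRule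

/-- Saturation property of the generalized Littlewood–Richardson coefficients:
for partitions `λ(1), …, λ(m)` with at most `n` parts and any `r ≥ 1`,
`f(λ(1),…,λ(m)) ≠ 0 ↔ f(rλ(1),…,rλ(m)) ≠ 0`. -/
theorem genLR_saturation (n m : ℕ) (hn : 1 ≤ n) (hm : 3 ≤ m)
    (lam : ℕ → Fin n → ℕ) (hlam : ∀ i, 1 ≤ i → i ≤ m → Antitone (lam i))
    (r : ℕ) (hr : 1 ≤ r) :
    genLR n m lam ≠ 0 ↔ genLR n m (fun i j => r * lam i j) ≠ 0 := by
  rw [LRRule.genLR_ne_zero_iff hm hlam, LRRule.genLR_ne_zero_iff hm fun i h1 h2 a b hab =>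
    Nat.mul_le_mul_left r (hlam i h1 h2 hab)]
  exact ⟨fun h => h.smul r, LRRule.HasTiles.of_smul hn hm hlam hr⟩

end
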